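/- arXiv:2012.00444 — 2 statements merged into one kernel-verified Lean document; each statement's English description precedes it below -/
import Mathlib

section
/- There exist constants c_d > 0 and C_d > 0 depending only on the dimension d such that for every n ≥ 2, the minimax risk for estimating a Gaussian location mixture density on ℝ^d under the squared L² loss satisfies c_d·(log n)^{d/2}/n ≤ R_n(F_d, L²) ≤ C_d·(log n)^{d/2}/n. -/
open MeasureTheory Real ENNReal

noncomputable def gauss (x : ℝ) : ℝ := Real.exp (-(x^2)/2) / Real.sqrt (2*Real.pi)

noncomputable def mixDensity (d : ℕ) (G : Measure (Fin d → ℝ)) : (Fin d → ℝ) → ℝ :=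
  fun x => ∫ u, ∏ i, gauss (x i - u i) ∂G

def gaussMixtures (d : ℕ) : Set ((Fin d → ℝ) → ℝ) :=
  {f | ∃ G : Measure (Fin d → ℝ), IsProbabilityMeasure G ∧ f = mixDensity d G}

noncomputable def jointMeasure (d n : ℕ) (f : (Fin d → ℝ) → ℝ) :
    Measure (Fin n → Fin d → ℝ) :=
  volume.withDensity (fun X => ∏ i, ENNReal.ofReal (f (X i)))

noncomputable def L2sq (d : ℕ) (f g : (Fin d → ℝ) → ℝ) : ℝ≥0∞ :=
  ∫⁻ x, ENNReal.ofReal ((f x - g x)^2)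

noncomputable def minimaxRisk (d n : ℕ) (F : Set ((Fin d → ℝ) → ℝ))
    (loss : ((Fin d → ℝ) → ℝ) → ((Fin d → ℝ) → ℝ) → ℝ≥0∞) : ℝ≥0∞ :=
  ⨅ (fhat : (Fin n → Fin d → ℝ) → (Fin d → ℝ) → ℝ)
    (_ : Measurable (Function.uncurry fhat)),
    ⨆ f ∈ F, ∫⁻ X, loss (fhat X) f ∂(jointMeasure d n f)


/-! ### Gaussian kernels of variance `a` -/

noncomputable def gk (a x : ℝ) : ℝ := Real.exp (-(x^2)/(2*a)) / Real.sqrt (2*Real.pi*a)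

lemma gk_one (x : ℝ) : gk 1 x = gauss x := by simp [gk, gauss]

lemma gk_nonneg (a x : ℝ) : 0 ≤ gk a x := by unfold gk; positivity

lemma gk_neg (a x : ℝ) : gk a (-x) = gk a x := by simp [gk]

lemma gk_le (a x : ℝ) (ha : 0 < a) : gk a x ≤ 1 / Real.sqrt (2*Real.pi*a) := by
  unfold gk
  gcongr
  rw [Real.exp_le_one_iff, neg_div]
  have : 0 ≤ x^2/(2*a) := by positivity
  linarith

lemma gk_continuous (a : ℝ) : Continuous (gk a) := by unfold gk; fun_prop

lemma gk_integrable {a : ℝ} (ha : 0 < a) : Integrable (gk a) := by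
  have h := (integrable_exp_neg_mul_sq (b := 1/(2*a)) (by positivity)).div_const (Real.sqrt (2*Real.pi*a))
  refine h.congr (Filter.Eventually.of_forall fun x => ?_)
  simp only [gk]
  congr 2
  field_simp

lemma gk_integral {a : ℝ} (ha : 0 < a) : ∫ x, gk a x = 1 := by
  have h : ∀ x, gk a x = Real.exp (-(1/(2*a)) * x^2) / Real.sqrt (2*Real.pi*a) := by
    intro x; simp only [gk]; congr 2; field_simp
  simp_rw [h]
  rw [integral_div, integral_gaussian]
  rw [show Real.pi / (1/(2*a)) = 2*Real.pi*a by field_simp]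
  exact div_self (by positivity)

lemma gk_mul {a b : ℝ} (ha : 0 < a) (hb : 0 < b) (x y : ℝ) :
    gk a (x - y) * gk b y = gk (a+b) x * gk (a*b/(a+b)) (y - x*b/(a+b)) := by
  unfold gk
  rw [div_mul_div_comm, div_mul_div_comm, ← Real.exp_add, ← Real.exp_add,
    ← Real.sqrt_mul (by positivity), ← Real.sqrt_mul (by positivity)]
  congr 2
  · field_simp
    ring
  · field_simp

lemma gk_conv {a b : ℝ} (ha : 0 < a) (hb : 0 < b) (x : ℝ) :
    ∫ y, gk a (x - y) * gk b y = gk (a+b) x := by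
  simp_rw [gk_mul ha hb]
  rw [integral_const_mul, integral_sub_right_eq_self (gk (a*b/(a+b))), gk_integral (by positivity), mul_one]

noncomputable def gkd (d : ℕ) (a : ℝ) (x : Fin d → ℝ) : ℝ := ∏ i, gk a (x i)

lemma gkd_one (d : ℕ) (x u : Fin d → ℝ) : ∏ i, gauss (x i - u i) = gkd d 1 (x - u) := by
  simp [gkd, gk_one]

lemma gkd_nonneg (d : ℕ) (a : ℝ) (x : Fin d → ℝ) : 0 ≤ gkd d a x :=
  Finset.prod_nonneg fun _ _ => gk_nonneg _ _

lemma gkd_continuous (d : ℕ) (a : ℝ) : Continuous (gkd d a) :=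
  continuous_finsetProd _ fun i _ => (gk_continuous a).comp (continuous_apply i)

lemma gkd_integrable (d : ℕ) {a : ℝ} (ha : 0 < a) : Integrable (gkd d a) :=
  Integrable.fintype_prod (f := fun _ => gk a) (fun _ => gk_integrable ha)

lemma gkd_integral (d : ℕ) {a : ℝ} (ha : 0 < a) : ∫ x, gkd d a x = 1 := by
  unfold gkd
  rw [integral_fintype_prod_volume_eq_prod (fun _ => gk a)]
  simp [gk_integral ha]

lemma gkd_le (d : ℕ) {a : ℝ} (ha : 0 < a) (x : Fin d → ℝ) :
    gkd d a x ≤ (1 / Real.sqrt (2*Real.pi*a))^d := by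
  unfold gkd
  calc ∏ i, gk a (x i) ≤ ∏ _i : Fin d, (1 / Real.sqrt (2*Real.pi*a)) :=
        Finset.prod_le_prod (fun _ _ => gk_nonneg _ _) (fun _ _ => gk_le _ _ ha)
    _ = _ := by simp

lemma gkd_neg (d : ℕ) (a : ℝ) (x : Fin d → ℝ) : gkd d a (-x) = gkd d a x := by
  simp [gkd, gk_neg]

lemma gkd_conv (d : ℕ) {a b : ℝ} (ha : 0 < a) (hb : 0 < b) (x : Fin d → ℝ) :
    ∫ y, gkd d a (x - y) * gkd d b y = gkd d (a+b) x := by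
  unfold gkd
  simp_rw [← Finset.prod_mul_distrib, Pi.sub_apply]
  rw [integral_fintype_prod_volume_eq_prod (fun i y => gk a (x i - y) * gk b y)]
  simp [gk_conv ha hb]

noncomputable def ged (d : ℕ) (a : ℝ) (t : Fin d → ℝ) : ℝ := Real.exp (-(a/2) * ∑ i, t i ^ 2)

lemma ged_eq (d : ℕ) (a : ℝ) (t : Fin d → ℝ) : ged d a t = ∏ i, Real.exp (-(a/2) * t i ^ 2) := by
  unfold ged
  rw [← Real.exp_sum, Finset.mul_sum]

lemma ged_mul (d : ℕ) (a b : ℝ) (t : Fin d → ℝ) : ged d a t * ged d b t = ged d (a+b) t := by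
  unfold ged
  rw [← Real.exp_add]; congr 1; ring

lemma ged_integrable (d : ℕ) {a : ℝ} (ha : 0 < a) : Integrable (ged d a) := by
  simp_rw [funext (ged_eq d a)]
  exact Integrable.fintype_prod (f := fun _ (x:ℝ) => Real.exp (-(a/2) * x ^ 2))
    (fun _ => integrable_exp_neg_mul_sq (by positivity))

lemma ged_integral (d : ℕ) {a : ℝ} (ha : 0 < a) :
    ∫ t, ged d a t = (Real.sqrt (2*Real.pi/a))^d := by
  simp_rw [ged_eq]
  rw [integral_fintype_prod_volume_eq_prod (fun _ (x:ℝ) => Real.exp (-(a/2) * x ^ 2))]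
  simp only [integral_gaussian]
  simp
  congr 2
  field_simp

lemma gkd_inner (d : ℕ) {a b : ℝ} (ha : 0 < a) (hb : 0 < b) :
    ∫ x, gkd d a x * gkd d b x = (1/(2*Real.pi))^d * ∫ t, ged d a t * ged d b t := by
  have h := gkd_conv d ha hb 0
  simp_rw [zero_sub, gkd_neg] at h
  rw [h]
  simp_rw [ged_mul]
  rw [ged_integral d (by positivity), ← mul_pow]
  simp only [gkd, gk, Pi.zero_apply]
  simp
  rw [← inv_pow]
  congr 1
  have h1 : Real.sqrt (2*Real.pi/(a+b)) = (2*Real.pi) / Real.sqrt (2*Real.pi*(a+b)) := by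
    rw [_root_.eq_div_iff (by positivity), ← Real.sqrt_mul (by positivity)]
    rw [show 2 * Real.pi / (a + b) * (2 * Real.pi * (a + b)) = (2*Real.pi)^2 by field_simp]
    exact Real.sqrt_sq (by positivity)
  have h2 : 0 < Real.sqrt (2*Real.pi*(a+b)) := by positivity
  have h3 := Real.pi_pos
  rw [h1]
  rw [← mul_inv, inv_mul_eq_div, div_right_comm, mul_comm Real.pi 2, div_self (by positivity), one_div]

lemma gkd_mul_integrable (d : ℕ) {a b : ℝ} (ha : 0 < a) (hb : 0 < b) :
    Integrable (fun x => gkd d a x * gkd d b x) := by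
  refine (gkd_integrable d ha).mul_bdd (c := (1 / Real.sqrt (2*Real.pi*b))^d)
    (gkd_continuous d b).aestronglyMeasurable (Filter.Eventually.of_forall fun x => ?_)
  rw [Real.norm_of_nonneg (gkd_nonneg _ _ _)]
  exact gkd_le d hb x

noncomputable def gcomb (d N : ℕ) (c a : ℕ → ℝ) (x : Fin d → ℝ) : ℝ :=
  ∑ k ∈ Finset.range N, c k * gkd d (a k) x

lemma gcomb_sq (d N : ℕ) (c a : ℕ → ℝ) (x : Fin d → ℝ) : gcomb d N c a x ^ 2 =
    ∑ k ∈ Finset.range N, ∑ l ∈ Finset.range N, (c k * c l) * (gkd d (a k) x * gkd d (a l) x) := by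
  unfold gcomb
  rw [sq, Finset.sum_mul_sum]
  refine Finset.sum_congr rfl fun k _ => Finset.sum_congr rfl fun l _ => by ring

lemma gcomb_sq_integrable (d N : ℕ) (c a : ℕ → ℝ) (ha : ∀ k, 0 < a k) :
    Integrable (fun x => gcomb d N c a x ^ 2) := by
  simp_rw [gcomb_sq]
  exact integrable_finsetSum _ fun k _ => integrable_finsetSum _ fun l _ =>
    (gkd_mul_integrable d (ha k) (ha l)).const_mul _

lemma gcomb_plancherel (d N : ℕ) (c a : ℕ → ℝ) (ha : ∀ k, 0 < a k) :
    ∫ x, gcomb d N c a x ^ 2 = (1/(2*Real.pi))^d *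
      ∫ t, (∑ k ∈ Finset.range N, c k * ged d (a k) t) ^ 2 := by
  have h2 : ∀ t : Fin d → ℝ, (∑ k ∈ Finset.range N, c k * ged d (a k) t) ^ 2 =
    ∑ k ∈ Finset.range N, ∑ l ∈ Finset.range N, (c k * c l) * (ged d (a k) t * ged d (a l) t) := by
    intro t
    rw [sq, Finset.sum_mul_sum]
    refine Finset.sum_congr rfl fun k _ => Finset.sum_congr rfl fun l _ => by ring
  have hi : ∀ k l, Integrable (fun t => (c k * c l) * (ged d (a k) t * ged d (a l) t)) := by
    intro k l
    simp_rw [ged_mul]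
    exact (ged_integrable d (add_pos (ha k) (ha l))).const_mul _
  simp_rw [gcomb_sq, h2]
  rw [integral_finsetSum _ fun k _ => integrable_finsetSum _ fun l _ =>
    (gkd_mul_integrable d (ha k) (ha l)).const_mul _,
    integral_finsetSum _ fun k _ => integrable_finsetSum _ fun l _ => hi k l, Finset.mul_sum]
  refine Finset.sum_congr rfl fun k _ => ?_
  rw [integral_finsetSum _ fun l _ =>
    (gkd_mul_integrable d (ha k) (ha l)).const_mul _,
    integral_finsetSum _ fun l _ => hi k l, Finset.mul_sum]
  refine Finset.sum_congr rfl fun l _ => ?_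
  rw [integral_const_mul, integral_const_mul, gkd_inner d (ha k) (ha l)]
  ring

lemma gcomb_continuous (d N : ℕ) (c a : ℕ → ℝ) : Continuous (gcomb d N c a) := by
  unfold gcomb
  exact continuous_finsetSum _ fun k _ => (gkd_continuous d _).const_mul _

lemma gcomb_bdd (d N : ℕ) (c a : ℕ → ℝ) (ha : ∀ k, 0 < a k) :
    ∃ B, ∀ x, |gcomb d N c a x| ≤ B := by
  refine ⟨∑ k ∈ Finset.range N, |c k| * (1 / Real.sqrt (2*Real.pi*a k))^d, fun x => ?_⟩
  unfold gcomb
  refine (Finset.abs_sum_le_sum_abs _ _).trans (Finset.sum_le_sum fun k _ => ?_)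
  rw [abs_mul, abs_of_nonneg (gkd_nonneg _ _ _)]
  gcongr
  exact gkd_le d (ha k) x

lemma gcomb_conv (d N : ℕ) (c a : ℕ → ℝ) (ha : ∀ k, 0 < a k) (x : Fin d → ℝ) :
    ∫ y, gcomb d N c a (x - y) * gkd d 1 y = gcomb d N c (fun k => a k + 1) x := by
  unfold gcomb
  simp_rw [Finset.sum_mul]
  have hi : ∀ k, Integrable (fun y => c k * gkd d (a k) (x - y) * gkd d 1 y) := by
    intro k
    simp_rw [mul_assoc]
    refine Integrable.const_mul ?_ _
    refine (gkd_integrable d one_pos).bdd_mul (c := (1 / Real.sqrt (2*Real.pi*a k))^d)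
      ((gkd_continuous d _).comp (continuous_const.sub continuous_id)).aestronglyMeasurable
      (Filter.Eventually.of_forall fun x => ?_)
    rw [Real.norm_of_nonneg (gkd_nonneg _ _ _)]
    exact gkd_le d (ha k) _
  rw [integral_finsetSum _ fun k _ => hi k]
  refine Finset.sum_congr rfl fun k _ => ?_
  simp_rw [mul_assoc]
  rw [integral_const_mul, gkd_conv d (ha k) one_pos]

/-! ### The estimator kernel -/

lemma one_sub_pow_le {s : ℝ} (h0 : 0 ≤ s) (h1 : s ≤ 1) (m : ℕ) : (1 - s)^m ≤ 1 / (1 + m*s) := by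
  rw [le_div_iff₀ (by positivity)]
  have hb := one_add_mul_le_pow (a := s) (by linarith) m
  calc (1-s)^m * (1 + m*s) ≤ (1-s)^m * (1+s)^m := by
        apply mul_le_mul_of_nonneg_left _ (pow_nonneg (by linarith) _)
        linarith
    _ = (1 - s^2)^m := by rw [← mul_pow]; ring
    _ ≤ 1 := pow_le_one₀ (by nlinarith) (by nlinarith)

noncomputable def kc (m k : ℕ) : ℝ := (-1)^k * (m.choose (k+1) : ℝ)

noncomputable def kern (d m : ℕ) : (Fin d → ℝ) → ℝ := gcomb d m (kc m) (fun k => 2*((k:ℝ)+1))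

lemma ged_pow (d k : ℕ) (t : Fin d → ℝ) : ged d (2*(k:ℝ)) t = ged d 2 t ^ k := by
  unfold ged
  rw [← Real.exp_nat_mul]; congr 1; ring

lemma ged_le_one (d : ℕ) {a : ℝ} (ha : 0 ≤ a) (t : Fin d → ℝ) : ged d a t ≤ 1 := by
  unfold ged
  rw [Real.exp_le_one_iff]
  have : 0 ≤ (a/2) * ∑ i, t i ^ 2 := mul_nonneg (by linarith) (Finset.sum_nonneg fun _ _ => sq_nonneg _)
  linarith

lemma ged_pos (d : ℕ) (a : ℝ) (t : Fin d → ℝ) : 0 < ged d a t := Real.exp_pos _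

lemma alt_sum (m : ℕ) (s : ℝ) :
    ∑ k ∈ Finset.range (m+1), (-1)^k * (m.choose k : ℝ) * s^k = (1 - s)^m := by
  rw [sub_eq_add_neg, add_comm (1:ℝ), add_pow]
  refine Finset.sum_congr rfl fun k _ => ?_
  rw [neg_pow]; simp; ring

lemma kern_fourier (d m : ℕ) (t : Fin d → ℝ) :
    ∑ k ∈ Finset.range m, kc m k * ged d (2*((k:ℝ)+1)) t = 1 - (1 - ged d 2 t)^m := by
  rw [← alt_sum, Finset.sum_range_succ']
  simp only [pow_zero, Nat.choose_zero_right]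
  have : ∀ k ∈ Finset.range m, kc m k * ged d (2*((k:ℝ)+1)) t =
      - ((-1)^(k+1) * (m.choose (k+1) : ℝ) * ged d 2 t^(k+1)) := by
    intro k _
    have := ged_pow d (k+1) t
    push_cast at this
    rw [this, kc]; ring
  rw [Finset.sum_congr rfl this, Finset.sum_neg_distrib]
  simp

lemma kern_bias_eq (d m : ℕ) (x : Fin d → ℝ) :
    gcomb d m (kc m) (fun k => 2*((k:ℝ)+1) + 1) x - gkd d 1 x =
      gcomb d (m+1) (fun k => -((-1)^k * (m.choose k : ℝ))) (fun k => 2*(k:ℝ) + 1) x := by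
  unfold gcomb
  rw [Finset.sum_range_succ']
  simp only [kc]
  have : ∀ k ∈ Finset.range m, -((-1)^(k+1) * (m.choose (k+1) : ℝ)) * gkd d (2*((k+1:ℕ):ℝ)+1) x =
      (-1) ^ k * (m.choose (k + 1):ℝ) * gkd d (2 * ((k:ℝ) + 1) + 1) x := by
    intro k _
    push_cast
    ring
  rw [Finset.sum_congr rfl this]
  simp
  ring

lemma bias_fourier (d m : ℕ) (t : Fin d → ℝ) :
    ∑ k ∈ Finset.range (m+1), -((-1)^k * (m.choose k : ℝ)) * ged d (2*(k:ℝ) + 1) t =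
      - ((1 - ged d 2 t)^m * ged d 1 t) := by
  rw [← alt_sum, Finset.sum_mul, ← Finset.sum_neg_distrib]
  refine Finset.sum_congr rfl fun k _ => ?_
  rw [← ged_mul, ged_pow]; ring

lemma bias_bound (d n : ℕ) (hn : 2 ≤ n) :
    ∫ x, (gcomb d (n^2) (kc (n^2)) (fun k => 2*((k:ℝ)+1) + 1) x - gkd d 1 x)^2 ≤
      (1/(2*Real.pi))^d * Real.sqrt (2*Real.pi)^d / n := by
  simp_rw [kern_bias_eq]
  rw [gcomb_plancherel _ _ _ _ (fun k => by positivity)]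
  simp_rw [bias_fourier]
  rw [mul_div_assoc]
  apply mul_le_mul_of_nonneg_left _ (by positivity)
  have hn' : (0:ℝ) < n := by positivity
  have hi := ged_integral d (a := 1) one_pos
  rw [div_one] at hi
  rw [← hi, ← integral_div]
  apply integral_mono_of_nonneg
  · exact Filter.Eventually.of_forall fun t => sq_nonneg _
  · exact (ged_integrable d one_pos).div_const _
  · refine Filter.Eventually.of_forall fun t => ?_
    simp only
    set r := ged d 1 t with hr
    have hr0 : 0 < r := ged_pos _ _ _
    have hs : ged d 2 t = r^2 := by
      rw [hr, sq, ged_mul]; norm_num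
    have hr1 : r ≤ 1 := ged_le_one d zero_le_one t
    rw [hs]
    have h1 := one_sub_pow_le (s := r^2) (sq_nonneg _) (by nlinarith) (n^2)
    have h0 : 0 ≤ (1 - r^2)^(n^2) := pow_nonneg (by nlinarith) _
    have h2 : (1 - r^2)^(n^2) ≤ 1 := pow_le_one₀ (by nlinarith) (by nlinarith)
    push_cast at h1
    have h3 : 1 / (1 + (n:ℝ)^2*r^2) * r ≤ 1/n := by
      rw [div_mul_eq_mul_div, one_mul, div_le_div_iff₀ (by positivity) hn']
      nlinarith [sq_nonneg (1 - n*r)]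
    set w := (1 - r^2)^(n^2)
    calc (-(w*r))^2 = w * (w * r) * r := by ring
      _ ≤ 1 * (1/n) * r := by
          have : w * r ≤ 1/n := (mul_le_mul_of_nonneg_right h1 hr0.le).trans h3
          have hw : 0 ≤ w * r := by positivity
          gcongr
      _ = r / n := by ring

lemma var_bound (d n : ℕ) (hn : 2 ≤ n) :
    ∫ x, kern d (n^2) x ^ 2 ≤
      (1/(2*Real.pi))^d * (Real.exp 1 * Real.sqrt (Real.pi * (2 * Real.log n))^d) := by
  unfold kern
  rw [gcomb_plancherel _ _ _ _ (fun k => by positivity)]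
  simp_rw [kern_fourier]
  apply mul_le_mul_of_nonneg_left _ (by positivity)
  have hn2 : (2:ℝ) ≤ n := by exact_mod_cast hn
  have hlog : Real.log 2 ≤ Real.log n := Real.log_le_log (by norm_num) hn2
  have hl2 := Real.log_two_gt_d9
  set L := 2 * Real.log n with hL
  have hL1 : 1 ≤ L := by linarith
  have hi := ged_integral d (a := 2/L) (by positivity)
  rw [show 2*Real.pi/(2/L) = Real.pi * L by field_simp] at hi
  rw [← hi, ← integral_const_mul]
  apply integral_mono_of_nonneg
  · exact Filter.Eventually.of_forall fun t => sq_nonneg _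
  · exact (ged_integrable d (by positivity)).const_mul _
  · refine Filter.Eventually.of_forall fun t => ?_
    simp only
    set s := ged d 2 t with hs
    have hs0 : 0 < s := ged_pos _ _ _
    have hs1 : s ≤ 1 := ged_le_one d (by norm_num) t
    have h0 : 0 ≤ (1 - s)^(n^2) := pow_nonneg (by linarith) _
    have h2 : (1 - s)^(n^2) ≤ 1 := pow_le_one₀ (by linarith) (by linarith)
    have hb := one_add_mul_le_pow (a := -s) (by linarith) (n^2)
    rw [← sub_eq_add_neg] at hb
    push_cast at hb
    set w := (1 - s)^(n^2)
    have h3 : (1-w)^2 ≤ 1 - w := by nlinarith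
    refine h3.trans ?_
    set r := ∑ i, t i ^ 2 with hr
    have hr0 : 0 ≤ r := Finset.sum_nonneg fun _ _ => sq_nonneg _
    have hse : s = Real.exp (-r) := by rw [hs, ged]; congr 1; ring
    have hge : Real.exp 1 * ged d (2/L) t = Real.exp (1 - r/L) := by
      rw [ged, ← Real.exp_add]; congr 1; field_simp; ring
    rw [hge]
    rcases le_total r L with h | h
    · have : 1 ≤ Real.exp (1 - r/L) := by
        rw [Real.one_le_exp_iff, sub_nonneg, div_le_one (by positivity)]; exact h
      linarith
    · have hnn : (n:ℝ)^2 = Real.exp L := by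
        rw [hL, mul_comm, Real.exp_mul, Real.exp_log (by positivity)]; norm_cast
      have : 1 - w ≤ Real.exp (L - r) := by
        rw [sub_eq_add_neg L r, Real.exp_add, ← hnn, ← hse]; linarith
      refine this.trans (Real.exp_le_exp.mpr ?_)
      have : 0 ≤ (r - L) * (1 - 1/L) := mul_nonneg (by linarith) (by
        rw [sub_nonneg, div_le_one (by positivity)]; exact hL1)
      have h5 : (r - L) * (1 - 1/L) = r - L - r/L + 1 := by field_simp; ring
      linarith

/-! ### Product measures and the risk of a kernel estimator -/

lemma lint_prod {ι : Type*} [Fintype ι] {E : Type*} [MeasurableSpace E] (μ : ι → Measure E)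
    [∀ i, SigmaFinite (μ i)] (f : ι → E → ℝ) (h0 : ∀ i x, 0 ≤ f i x)
    (hi : ∀ i, Integrable (f i) (μ i)) :
    ∫⁻ X, ∏ i, ENNReal.ofReal (f i (X i)) ∂(Measure.pi μ) =
      ∏ i, ∫⁻ x, ENNReal.ofReal (f i x) ∂(μ i) := by
  have h1 : ∀ X : ι → E, ∏ i, ENNReal.ofReal (f i (X i)) = ENNReal.ofReal (∏ i, f i (X i)) :=
    fun X => (ENNReal.ofReal_prod_of_nonneg fun i _ => h0 i _).symm
  simp_rw [h1]
  rw [← ofReal_integral_eq_lintegral_ofReal (Integrable.fintype_prod hi)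
    (Filter.Eventually.of_forall fun X => Finset.prod_nonneg fun i _ => h0 i _),
    integral_fintype_prod_eq_prod,
    ENNReal.ofReal_prod_of_nonneg (fun i _ => integral_nonneg (h0 i))]
  refine Finset.prod_congr rfl fun i _ => ?_
  rw [ofReal_integral_eq_lintegral_ofReal (hi i) (Filter.Eventually.of_forall (h0 i))]

lemma jointMeasure_eq (d n : ℕ) (f : (Fin d → ℝ) → ℝ) (h0 : ∀ x, 0 ≤ f x)
    (hi : Integrable f) :
    jointMeasure d n f =
      Measure.pi (fun _ : Fin n => volume.withDensity (fun x => ENNReal.ofReal (f x))) := by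
  have : SigmaFinite (volume.withDensity (fun x => ENNReal.ofReal (f x))) :=
    SigmaFinite.withDensity_ofReal _
  symm
  apply Measure.pi_eq
  intro s hs
  unfold jointMeasure
  rw [withDensity_apply _ (MeasurableSet.univ_pi hs), volume_pi, Measure.restrict_pi_pi]
  rw [lint_prod _ (fun _ => f) (fun _ => h0) (fun i => hi.restrict)]
  refine Finset.prod_congr rfl fun i _ => ?_
  rw [withDensity_apply _ (hs i)]

lemma mixDensity_eq (d : ℕ) (G : Measure (Fin d → ℝ)) (x : Fin d → ℝ) :
    mixDensity d G x = ∫ u, gkd d 1 (x - u) ∂G := by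
  simp only [mixDensity, gkd_one]

lemma gkd_int_G (d : ℕ) (G : Measure (Fin d → ℝ)) [IsProbabilityMeasure G] (x : Fin d → ℝ) :
    Integrable (fun u => gkd d 1 (x - u)) G := by
  refine Integrable.of_bound (C := (1 / Real.sqrt (2*Real.pi*1))^d)
    ((gkd_continuous d 1).comp (continuous_const.sub continuous_id)).aestronglyMeasurable
    (Filter.Eventually.of_forall fun u => ?_)
  rw [Real.norm_of_nonneg (gkd_nonneg _ _ _)]
  exact gkd_le d one_pos _

lemma mixDensity_nonneg (d : ℕ) (G : Measure (Fin d → ℝ)) (x : Fin d → ℝ) :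
    0 ≤ mixDensity d G x := by
  rw [mixDensity_eq]
  exact integral_nonneg fun u => gkd_nonneg _ _ _

lemma mixDensity_measurable (d : ℕ) (G : Measure (Fin d → ℝ)) [IsProbabilityMeasure G] :
    Measurable (mixDensity d G) := by
  rw [funext (mixDensity_eq d G)]
  have : Continuous (fun p : (Fin d → ℝ) × (Fin d → ℝ) => gkd d 1 (p.1 - p.2)) :=
    (gkd_continuous d 1).comp (continuous_fst.sub continuous_snd)
  exact (this.stronglyMeasurable.integral_prod_right (ν := G)).measurable

lemma mixDensity_lintegral (d : ℕ) (G : Measure (Fin d → ℝ)) [IsProbabilityMeasure G] :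
    ∫⁻ x, ENNReal.ofReal (mixDensity d G x) = 1 := by
  have hc : Continuous (fun p : (Fin d → ℝ) × (Fin d → ℝ) => gkd d 1 (p.1 - p.2)) :=
    (gkd_continuous d 1).comp (continuous_fst.sub continuous_snd)
  have h1 : ∀ x, ENNReal.ofReal (mixDensity d G x) =
      ∫⁻ u, ENNReal.ofReal (gkd d 1 (x - u)) ∂G := fun x => by
    rw [mixDensity_eq, ofReal_integral_eq_lintegral_ofReal (gkd_int_G d G x)
      (Filter.Eventually.of_forall fun u => gkd_nonneg _ _ _)]
  simp_rw [h1]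
  rw [lintegral_lintegral_swap
    (f := fun x u => ENNReal.ofReal (gkd d 1 (x - u))) (hc.measurable.ennreal_ofReal.aemeasurable)]
  have h2 : ∀ u : Fin d → ℝ, ∫⁻ x, ENNReal.ofReal (gkd d 1 (x - u)) = 1 := by
    intro u
    rw [lintegral_sub_right_eq_self (fun x => ENNReal.ofReal (gkd d 1 x)) u,
      ← ofReal_integral_eq_lintegral_ofReal (gkd_integrable d one_pos)
      (Filter.Eventually.of_forall fun u => gkd_nonneg _ _ _), gkd_integral d one_pos]
    simp
  simp [h2]

lemma mixDensity_integrable (d : ℕ) (G : Measure (Fin d → ℝ)) [IsProbabilityMeasure G] :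
    Integrable (mixDensity d G) := by
  refine ⟨(mixDensity_measurable d G).aestronglyMeasurable, ?_⟩
  rw [hasFiniteIntegral_iff_ofReal (Filter.Eventually.of_forall (mixDensity_nonneg d G)),
    mixDensity_lintegral]
  exact ENNReal.one_lt_top

open ProbabilityTheory in
lemma pointwise_risk {E : Type*} [MeasurableSpace E] (P : Measure E) [IsProbabilityMeasure P]
    (n : ℕ) (hn : 0 < n) (k : E → ℝ) (hk : Measurable k) (B : ℝ) (hB : ∀ y, |k y| ≤ B) (c : ℝ) :
    ∫⁻ X : Fin n → E, ENNReal.ofReal (((1/(n:ℝ)) * (∑ i, k (X i)) - c)^2) ∂(Measure.pi fun _ => P) ≤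
      ENNReal.ofReal ((1/(n:ℝ)) * (∫ y, k y ^ 2 ∂P)) + ENNReal.ofReal ((∫ y, k y ∂P - c)^2) := by
  have hn' : (0:ℝ) < n := by exact_mod_cast hn
  have hkL : MemLp k 2 P := MemLp.of_bound hk.aestronglyMeasurable B
    (Filter.Eventually.of_forall hB)
  set Q : Measure (Fin n → E) := Measure.pi fun _ => P with hQ
  have hki : ∀ i : Fin n, MemLp (fun X : Fin n → E => k (X i)) 2 Q := fun i =>
    hkL.comp_measurePreserving (measurePreserving_eval _ i)
  have hS : MemLp (fun X : Fin n → E => ∑ i, k (X i)) 2 Q := memLp_finsetSum _ fun i _ => hki i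
  have hY0 : MemLp (fun X : Fin n → E => (1/(n:ℝ)) * (∑ i, k (X i))) 2 Q := hS.const_mul _
  have hY : MemLp (fun X : Fin n → E => (1/(n:ℝ)) * (∑ i, k (X i)) - c) 2 Q :=
    hY0.sub (memLp_const c)
  have hE : ∫ X, ((1/(n:ℝ)) * (∑ i, k (X i)) - c) ∂Q = ∫ y, k y ∂P - c := by
    rw [integral_sub (hY0.integrable one_le_two) (integrable_const _), integral_const_mul,
      integral_finsetSum _ fun i _ => (hki i).integrable one_le_two]
    have : ∀ i : Fin n, ∫ X, k (X i) ∂Q = ∫ y, k y ∂P := fun i => by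
      have hm := (measurePreserving_eval (fun _ : Fin n => P) i).map_eq
      conv_rhs => rw [← hm]
      rw [integral_map (measurable_pi_apply i).aemeasurable hk.aestronglyMeasurable]
    simp [this]
    field_simp
  have hV : Var[fun X : Fin n → E => (1/(n:ℝ)) * (∑ i, k (X i)) - c; Q] ≤ (1/(n:ℝ)) * (∫ y, k y ^ 2 ∂P) := by
    rw [variance_sub_const hY0.aestronglyMeasurable, variance_const_mul]
    have h := variance_sum_pi (μ := fun _ : Fin n => P) (X := fun _ => k) (fun _ => hkL)
    have h' : (∑ i : Fin n, fun ω : Fin n → E => k (ω i)) = fun X => ∑ i, k (X i) := by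
      ext X; simp
    rw [h'] at h
    rw [h]
    have := variance_le_expectation_sq (μ := P) (X := k) hk.aestronglyMeasurable
    simp only [Finset.sum_const, Finset.card_univ, Fintype.card_fin, nsmul_eq_mul]
    calc (1/(n:ℝ))^2 * (n * Var[k; P]) = (1/(n:ℝ)) * Var[k;P] := by field_simp
      _ ≤ _ := by
        apply mul_le_mul_of_nonneg_left _ (by positivity)
        simpa using this
  have hfin := variance_eq_sub hY
  rw [hE] at hfin
  rw [← ofReal_integral_eq_lintegral_ofReal (hY.integrable_sq)
    (Filter.Eventually.of_forall fun X => sq_nonneg _), ← ENNReal.ofReal_add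
    (mul_nonneg (by positivity) (integral_nonneg fun y => sq_nonneg _)) (sq_nonneg _)]
  apply ENNReal.ofReal_le_ofReal
  simp only [Pi.pow_apply] at hfin
  linarith

/-- Jensen for squares -/
lemma sq_integral_le {E : Type*} [MeasurableSpace E] (P : Measure E) [IsProbabilityMeasure P]
    (k : E → ℝ) (hk : Measurable k) (B : ℝ) (hB : ∀ y, |k y| ≤ B) :
    (∫ y, k y ∂P)^2 ≤ ∫ y, k y ^ 2 ∂P := by
  have hkL : MemLp k 2 P := MemLp.of_bound hk.aestronglyMeasurable B
    (Filter.Eventually.of_forall hB)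
  have := ProbabilityTheory.variance_eq_sub hkL
  have h2 := ProbabilityTheory.variance_nonneg k P
  simp only [Pi.pow_apply] at this
  linarith

lemma mean_eq (d : ℕ) (G : Measure (Fin d → ℝ)) [IsProbabilityMeasure G]
    (K : (Fin d → ℝ) → ℝ) (hK : Continuous K) (B : ℝ) (hB : ∀ y, |K y| ≤ B) (x : Fin d → ℝ) :
    ∫ y, K (x - y) ∂(volume.withDensity fun y => ENNReal.ofReal (mixDensity d G y)) =
      ∫ u, (∫ y, K (x - u - y) * gkd d 1 y) ∂G := by
  rw [integral_withDensity_eq_integral_toReal_smul (mixDensity_measurable d G).ennreal_ofReal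
    (Filter.Eventually.of_forall fun _ => ENNReal.ofReal_lt_top)]
  simp_rw [ENNReal.toReal_ofReal (mixDensity_nonneg d G _), smul_eq_mul, mixDensity_eq,
    ← integral_mul_const]
  rw [integral_integral_swap]
  · refine integral_congr_ae (Filter.Eventually.of_forall fun u => ?_)
    simp only
    rw [← integral_sub_right_eq_self (fun y => K (x - u - y) * gkd d 1 y) u]
    refine integral_congr_ae (Filter.Eventually.of_forall fun y => ?_)
    simp only
    rw [mul_comm]; congr 2; abel
  · have hc : Continuous (fun p : (Fin d → ℝ) × (Fin d → ℝ) => gkd d 1 (p.1 - p.2)) :=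
      (gkd_continuous d 1).comp (continuous_fst.sub continuous_snd)
    have hi : Integrable (fun p : (Fin d → ℝ) × (Fin d → ℝ) => gkd d 1 (p.1 - p.2))
        (volume.prod G) := by
      rw [integrable_prod_iff' hc.aestronglyMeasurable]
      constructor
      · exact Filter.Eventually.of_forall fun u => (gkd_integrable d one_pos).comp_sub_right u
      · have : ∀ u : Fin d → ℝ, ∫ x, ‖gkd d 1 (x - u)‖ = 1 := by
          intro u
          simp_rw [Real.norm_of_nonneg (gkd_nonneg _ _ _)]
          rw [integral_sub_right_eq_self (gkd d 1) u, gkd_integral d one_pos]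
        simp_rw [this]
        exact integrable_const _
    exact hi.mul_bdd (c := B) (hK.comp (continuous_const.sub continuous_fst)).aestronglyMeasurable
      (Filter.Eventually.of_forall fun p => hB _)

lemma kernel_risk (d n : ℕ) (hn : 0 < n) (G : Measure (Fin d → ℝ)) [IsProbabilityMeasure G]
    (K H : (Fin d → ℝ) → ℝ) (hK : Continuous K) (B : ℝ) (hB : ∀ y, |K y| ≤ B)
    (hK2 : Integrable (fun x => K x ^ 2))
    (hH : Continuous H) (B' : ℝ) (hB' : ∀ y, |H y| ≤ B')
    (hKH : ∀ x, ∫ y, K (x - y) * gkd d 1 y = H x)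
    (hD : Integrable (fun x => (H x - gkd d 1 x)^2)) :
    ∫⁻ X, L2sq d (fun x => (1/(n:ℝ)) * ∑ i, K (x - X i)) (mixDensity d G)
      ∂(jointMeasure d n (mixDensity d G)) ≤
    ENNReal.ofReal ((1/(n:ℝ)) * ∫ x, K x ^ 2) + ENNReal.ofReal (∫ x, (H x - gkd d 1 x)^2) := by
  have hfm := mixDensity_measurable d G
  rw [jointMeasure_eq d n _ (mixDensity_nonneg d G) (mixDensity_integrable d G)]
  set P := volume.withDensity (fun x => ENNReal.ofReal (mixDensity d G x)) with hP
  have hPp : IsProbabilityMeasure P := ⟨by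
    rw [hP, withDensity_apply _ MeasurableSet.univ, Measure.restrict_univ, mixDensity_lintegral]⟩
  unfold L2sq
  rw [lintegral_lintegral_swap]
  swap
  · apply Measurable.aemeasurable
    apply Measurable.ennreal_ofReal
    apply Measurable.pow_const
    apply Measurable.sub
    · apply Measurable.const_mul
      apply Continuous.measurable
      exact continuous_finsetSum _ fun i _ => hK.comp (continuous_snd.sub
        ((continuous_apply i).comp continuous_fst))
    · exact hfm.comp measurable_snd
  have hpt : ∀ x, ∫⁻ X : Fin n → Fin d → ℝ, ENNReal.ofReal
      (((1/(n:ℝ)) * ∑ i, K (x - X i) - mixDensity d G x)^2) ∂(Measure.pi fun _ => P) ≤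
      ENNReal.ofReal (1/(n:ℝ)) * (∫⁻ y, ENNReal.ofReal (K (x - y) ^ 2) ∂P) +
      ∫⁻ u, ENNReal.ofReal ((H (x - u) - gkd d 1 (x - u))^2) ∂G := by
    intro x
    have hKx : Continuous fun y => K (x - y) := hK.comp (continuous_const.sub continuous_id)
    refine (pointwise_risk P n hn (fun y => K (x - y)) hKx.measurable B (fun y => hB _) _).trans ?_
    apply add_le_add
    · rw [ENNReal.ofReal_mul (by positivity), ofReal_integral_eq_lintegral_ofReal _
        (Filter.Eventually.of_forall fun y => sq_nonneg _)]
      refine Integrable.of_bound (C := B^2) (hKx.pow 2).aestronglyMeasurable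
        (Filter.Eventually.of_forall fun y => ?_)
      rw [norm_pow]
      exact pow_le_pow_left₀ (norm_nonneg _) (hB _) 2
    · have hDc : Continuous fun u => H (x - u) - gkd d 1 (x - u) :=
        (hH.sub (gkd_continuous d 1)).comp (continuous_const.sub continuous_id)
      have hDB : ∀ u, |H (x - u) - gkd d 1 (x - u)| ≤ B' + (1 / Real.sqrt (2*Real.pi*1))^d := by
        intro u
        refine (abs_sub _ _).trans (add_le_add (hB' _) ?_)
        rw [abs_of_nonneg (gkd_nonneg _ _ _)]
        exact gkd_le d one_pos _
      rw [mean_eq d G K hK B hB x]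
      simp_rw [hKH]
      rw [mixDensity_eq, ← integral_sub]
      · rw [← ofReal_integral_eq_lintegral_ofReal _
          (Filter.Eventually.of_forall fun y => sq_nonneg _)]
        · apply ENNReal.ofReal_le_ofReal
          exact sq_integral_le G _ hDc.measurable _ hDB
        · refine Integrable.of_bound (C := (B' + (1 / Real.sqrt (2*Real.pi*1))^d)^2) (hDc.pow 2).aestronglyMeasurable
            (Filter.Eventually.of_forall fun y => ?_)
          rw [norm_pow]
          exact pow_le_pow_left₀ (norm_nonneg _) (hDB _) 2
      · exact Integrable.of_bound (C := B') (hH.comp (continuous_const.sub continuous_id)).aestronglyMeasurable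
          (Filter.Eventually.of_forall fun y => hB' _)
      · exact gkd_int_G d G x
  refine (lintegral_mono hpt).trans ?_
  have hm1 : Measurable (fun p : (Fin d → ℝ) × (Fin d → ℝ) => ENNReal.ofReal (K (p.1 - p.2) ^ 2)) :=
    ((hK.comp (continuous_fst.sub continuous_snd)).pow 2).measurable.ennreal_ofReal
  have hm2 : Measurable (fun p : (Fin d → ℝ) × (Fin d → ℝ) =>
      ENNReal.ofReal ((H (p.1 - p.2) - gkd d 1 (p.1 - p.2)) ^ 2)) :=
    (((hH.sub (gkd_continuous d 1)).comp (continuous_fst.sub continuous_snd)).pow 2).measurable.ennreal_ofReal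
  rw [lintegral_add_left (hm1.lintegral_prod_right'.const_mul _),
    lintegral_const_mul _ hm1.lintegral_prod_right']
  apply add_le_add
  · rw [lintegral_lintegral_swap (f := fun x y => ENNReal.ofReal (K (x - y) ^ 2)) hm1.aemeasurable]
    have : ∀ u : Fin d → ℝ, ∫⁻ x, ENNReal.ofReal (K (x - u) ^ 2) = ENNReal.ofReal (∫ x, K x ^ 2) := by
      intro u
      rw [lintegral_sub_right_eq_self (fun x => ENNReal.ofReal (K x ^ 2)) u,
        ofReal_integral_eq_lintegral_ofReal hK2 (Filter.Eventually.of_forall fun y => sq_nonneg _)]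
    simp_rw [this]
    rw [ENNReal.ofReal_mul (by positivity)]
    simp
  · rw [lintegral_lintegral_swap (f := fun x y => ENNReal.ofReal ((H (x - y) - gkd d 1 (x - y)) ^ 2)) hm2.aemeasurable]
    have : ∀ u : Fin d → ℝ, ∫⁻ x, ENNReal.ofReal ((H (x - u) - gkd d 1 (x - u)) ^ 2) =
        ENNReal.ofReal (∫ x, (H x - gkd d 1 x) ^ 2) := by
      intro u
      rw [lintegral_sub_right_eq_self (fun x => ENNReal.ofReal ((H x - gkd d 1 x) ^ 2)) u,
        ofReal_integral_eq_lintegral_ofReal hD (Filter.Eventually.of_forall fun y => sq_nonneg _)]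
    simp_rw [this]
    simp

lemma upper_bound (d : ℕ) : ∃ C : ℝ, 0 < C ∧ ∀ n : ℕ, 2 ≤ n →
    minimaxRisk d n (gaussMixtures d) (L2sq d)
          ≤ ENNReal.ofReal (C * (Real.log n) ^ ((d : ℝ)/2) / n) := by
  set A := (1/(2*Real.pi))^d * (Real.exp 1 * Real.sqrt (Real.pi * 2)^d) with hA
  set A' := (1/(2*Real.pi))^d * Real.sqrt (2*Real.pi)^d / Real.sqrt (Real.log 2) ^ d with hA'
  have hl2 : 0 < Real.log 2 := Real.log_pos (by norm_num)
  refine ⟨A + A', by positivity, fun n hn => ?_⟩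
  have hn0 : 0 < n := by omega
  have hn' : (0:ℝ) < n := by exact_mod_cast hn0
  have hlog : Real.log 2 ≤ Real.log n := Real.log_le_log (by norm_num) (by exact_mod_cast hn)
  have hpow : (Real.log n) ^ ((d : ℝ)/2) = Real.sqrt (Real.log n) ^ d := by
    rw [Real.sqrt_eq_rpow, ← Real.rpow_natCast, ← Real.rpow_mul (by linarith)]
    congr 1; ring
  unfold minimaxRisk
  have ha : ∀ k : ℕ, (0:ℝ) < 2*((k:ℝ)+1) := fun k => by positivity
  have ha' : ∀ k : ℕ, (0:ℝ) < 2*((k:ℝ)+1) + 1 := fun k => by positivity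
  obtain ⟨B, hB⟩ := gcomb_bdd d (n^2) (kc (n^2)) _ ha
  obtain ⟨B', hB'⟩ := gcomb_bdd d (n^2) (kc (n^2)) _ ha'
  have hKc : Continuous (kern d (n^2)) := gcomb_continuous _ _ _ _
  refine iInf₂_le_of_le (fun X x => (1/(n:ℝ)) * ∑ i, kern d (n^2) (x - X i)) ?_ ?_
  · apply Continuous.measurable
    apply Continuous.const_mul
    exact continuous_finsetSum _ fun i _ => hKc.comp (continuous_snd.sub
        ((continuous_apply i).comp continuous_fst))
  refine iSup₂_le fun f hf => ?_
  obtain ⟨G, hG, rfl⟩ := hf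
  refine (kernel_risk d n hn0 G (kern d (n^2)) _ hKc B hB (gcomb_sq_integrable _ _ _ _ ha)
    (gcomb_continuous _ _ _ _) B' hB' (gcomb_conv d (n^2) (kc (n^2)) _ ha) ?_).trans ?_
  · simp_rw [kern_bias_eq]
    exact gcomb_sq_integrable _ _ _ _ (fun k => by positivity)
  rw [← ENNReal.ofReal_add (mul_nonneg (by positivity) (integral_nonneg fun y => sq_nonneg _))
    (integral_nonneg fun y => sq_nonneg _)]
  apply ENNReal.ofReal_le_ofReal
  have h1 := var_bound d n hn
  have h2 := bias_bound d n hn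
  rw [hpow]
  have h3 : (1/(n:ℝ)) * ∫ x, kern d (n^2) x ^ 2 ≤ A * Real.sqrt (Real.log n) ^ d / n := by
    calc _ ≤ (1/(n:ℝ)) * ((1/(2*Real.pi))^d * (Real.exp 1 * Real.sqrt (Real.pi * (2 * Real.log n))^d)) := by
          gcongr
      _ = _ := by
        rw [hA, ← mul_assoc Real.pi, Real.sqrt_mul (by positivity), mul_pow]; ring
  have h4 : (1/(2*Real.pi))^d * Real.sqrt (2*Real.pi)^d / n ≤ A' * Real.sqrt (Real.log n) ^ d / n := by
    apply div_le_div_of_nonneg_right _ hn'.le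
    rw [hA', div_mul_eq_mul_div, le_div_iff₀ (by positivity)]
    gcongr
  calc _ ≤ A * Real.sqrt (Real.log n) ^ d / n + A' * Real.sqrt (Real.log n) ^ d / n :=
        add_le_add h3 (h2.trans h4)
    _ = _ := by ring

/-! ### The hypercube of mixtures for the lower bound -/

lemma gauss_sin_integral (k x : ℝ) :
    ∫ v, gk (1/2) v * Real.sin (2*k*v + k*x) = Real.exp (-k^2) * Real.sin (k*x) := by
  have hb : (-1:ℂ).re < 0 := by simp
  have h := integral_cexp_quadratic hb (2*k*Complex.I) (k*x*Complex.I)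
  have hi := integrable_cexp_quadratic' hb (2*k*Complex.I) (k*x*Complex.I)
  have h2 := integral_im hi
  rw [h] at h2
  have e1 : ∀ v : ℝ, gk (1/2) v * Real.sin (2*k*v + k*x) =
      (RCLike.im (Complex.exp (-1 * (v:ℂ)^2 + 2*k*Complex.I*v + k*x*Complex.I))) / Real.sqrt Real.pi := by
    intro v
    have : (-1 * (v:ℂ)^2 + 2*k*Complex.I*v + k*x*Complex.I) =
      ((-v^2 : ℝ):ℂ) + ((2*k*v + k*x : ℝ):ℂ) * Complex.I := by push_cast; ring
    rw [this, Complex.exp_add, ← Complex.ofReal_exp]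
    simp only [RCLike.im_to_complex, Complex.im_ofReal_mul, Complex.exp_ofReal_mul_I_im]
    unfold gk
    rw [show 2*Real.pi*(1/2) = Real.pi by ring, show -v^2/(2*(1/2)) = -v^2 by ring]
    ring
  simp_rw [e1]
  rw [integral_div, h2]
  have e2 : (↑(k * x : ℝ) * Complex.I - (2*k*Complex.I)^2/(4*(-1)) : ℂ) =
      ((-k^2 : ℝ):ℂ) + ((k*x : ℝ):ℂ) * Complex.I := by
    rw [mul_pow, Complex.I_sq]; push_cast; ring
  push_cast at e2
  rw [e2, Complex.exp_add]
  have e3 : (Real.pi / - -1 : ℂ)^(1/2 : ℂ) = ((Real.sqrt Real.pi : ℝ) : ℂ) := by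
    rw [Real.sqrt_eq_rpow, Complex.ofReal_cpow Real.pi_pos.le]; simp
  rw [e3, show (-(k:ℂ)^2) = ((-k^2 : ℝ) : ℂ) by push_cast; ring,
    show ((k:ℂ)*x) = ((k*x : ℝ) : ℂ) by push_cast; ring, ← Complex.ofReal_exp]
  simp only [RCLike.im_to_complex, Complex.im_ofReal_mul, Complex.exp_ofReal_mul_I_im]
  have : 0 < Real.sqrt Real.pi := by have := Real.pi_pos; positivity
  field_simp

lemma gk_sin_conv (k x : ℝ) :
    ∫ u, gk 1 (x - u) * (gk 1 u * Real.sin (2*k*u)) = gk 2 x * (Real.exp (-k^2) * Real.sin (k*x)) := by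
  have h : ∀ u, gk 1 (x - u) * (gk 1 u * Real.sin (2*k*u)) =
      gk 2 x * (gk (1/2) (u - x/2) * Real.sin (2*k*(u - x/2) + k*x)) := by
    intro u
    rw [← mul_assoc, gk_mul one_pos one_pos]
    have e : 2*k*(u - x/2) + k*x = 2*k*u := by ring
    rw [e]
    norm_num
    ring
  simp_rw [h]
  rw [integral_const_mul, integral_sub_right_eq_self (fun v => gk (1/2) v * Real.sin (2*k*v + k*x)),
    gauss_sin_integral]

lemma gk_sin_zero (k : ℝ) : ∫ u, gk 1 u * Real.sin (2*k*u) = 0 := by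
  have h := integral_neg_eq_self (fun u => gk 1 u * Real.sin (2*k*u)) volume
  simp only [gk_neg, mul_neg, Real.sin_neg, integral_neg] at h
  linarith

lemma gk_sin_integrable {a : ℝ} (ha : 0 < a) (k : ℝ) : Integrable (fun u => gk a u * Real.sin (k*u)) :=
  (gk_integrable ha).mul_bdd (c := 1) (by fun_prop)
    (Filter.Eventually.of_forall fun u => Real.abs_sin_le_one _)

noncomputable def se {d M : ℕ} (s : ℝ) (j : Fin d → Fin M) (x : Fin d → ℝ) : ℝ :=
  ∏ i, Real.sin (s * ((j i : ℕ) + 1 : ℝ) * x i)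

lemma se_abs_le {d M : ℕ} (s : ℝ) (j : Fin d → Fin M) (x : Fin d → ℝ) : |se s j x| ≤ 1 := by
  unfold se
  rw [Finset.abs_prod]
  exact Finset.prod_le_one (fun _ _ => abs_nonneg _) (fun _ _ => Real.abs_sin_le_one _)

lemma se_continuous {d M : ℕ} (s : ℝ) (j : Fin d → Fin M) : Continuous (se s j) := by
  unfold se; fun_prop

noncomputable def kap {d M : ℕ} (j : Fin d → Fin M) : ℝ := ∏ i, Real.exp (((j i : ℕ) + 1 : ℝ)^2)

lemma kap_pos {d M : ℕ} (j : Fin d → Fin M) : 0 < kap j := Finset.prod_pos fun _ _ => Real.exp_pos _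

lemma one_le_kap {d M : ℕ} (j : Fin d → Fin M) : 1 ≤ kap j := by
  unfold kap
  rw [← Real.exp_sum, Real.one_le_exp_iff]
  positivity

lemma gkd_se_conv {d M : ℕ} (j : Fin d → Fin M) (x : Fin d → ℝ) :
    ∫ u, gkd d 1 (x - u) * (gkd d 1 u * (kap j * se 2 j u)) = gkd d 2 x * se 1 j x := by
  have h : ∀ u : Fin d → ℝ, gkd d 1 (x - u) * (gkd d 1 u * (kap j * se 2 j u)) =
      kap j * ∏ i, (gk 1 (x i - u i) * (gk 1 (u i) * Real.sin (2 * ((j i : ℕ) + 1 : ℝ) * u i))) := by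
    intro u
    simp only [gkd, se, Finset.prod_mul_distrib, Pi.sub_apply]
    ring
  simp_rw [h]
  rw [integral_const_mul, integral_fintype_prod_volume_eq_prod
    (fun i (u:ℝ) => (gk 1 (x i - u) * (gk 1 u * Real.sin (2 * ((j i : ℕ) + 1 : ℝ) * u))))]
  simp_rw [gk_sin_conv]
  unfold kap gkd se
  rw [← Finset.prod_mul_distrib, ← Finset.prod_mul_distrib]
  refine Finset.prod_congr rfl fun i _ => ?_
  rw [Real.exp_neg, one_mul]
  field_simp

lemma gkd_se_zero {d M : ℕ} (hd : 1 ≤ d) (j : Fin d → Fin M) :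
    ∫ u, gkd d 1 u * se 2 j u = 0 := by
  unfold gkd se
  simp_rw [← Finset.prod_mul_distrib]
  rw [integral_fintype_prod_volume_eq_prod
    (fun i (u:ℝ) => ((gk 1 u * Real.sin (2 * ((j i : ℕ) + 1 : ℝ) * u))))]
  exact Finset.prod_eq_zero (Finset.mem_univ ⟨0, hd⟩) (gk_sin_zero _)

lemma gkd_mul_bdd_integrable {d : ℕ} {a : ℝ} (ha : 0 < a) (h : (Fin d → ℝ) → ℝ) (hc : Continuous h)
    (B : ℝ) (hB : ∀ x, |h x| ≤ B) : Integrable (fun u => gkd d a u * h u) :=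
  (gkd_integrable d ha).mul_bdd (c := B) hc.aestronglyMeasurable (Filter.Eventually.of_forall hB)

noncomputable def sg (b : Bool) : ℝ := if b then 1 else -1

lemma sg_abs (b : Bool) : |sg b| = 1 := by cases b <;> simp [sg]

lemma sg_not (b : Bool) : sg (!b) = - sg b := by cases b <;> simp [sg]

/-- weight in the mixing density -/
noncomputable def wG {d M : ℕ} (ε : ℝ) (α : (Fin d → Fin M) → Bool) (u : Fin d → ℝ) : ℝ :=
  1 + ∑ j, (sg (α j) * ε) * (kap j * se 2 j u)

/-- relative perturbation of the density -/
noncomputable def uf {d M : ℕ} (ε : ℝ) (α : (Fin d → Fin M) → Bool) (x : Fin d → ℝ) : ℝ :=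
  ∑ j, (sg (α j) * ε) * se 1 j x

noncomputable def fα {d M : ℕ} (ε : ℝ) (α : (Fin d → Fin M) → Bool) (x : Fin d → ℝ) : ℝ :=
  gkd d 2 x * (1 + uf ε α x)

lemma wG_continuous {d M : ℕ} (ε : ℝ) (α : (Fin d → Fin M) → Bool) : Continuous (wG ε α) := by
  unfold wG
  exact continuous_const.add (continuous_finsetSum _ fun j _ =>
    ((se_continuous 2 j).const_mul _).const_mul _)

lemma uf_continuous {d M : ℕ} (ε : ℝ) (α : (Fin d → Fin M) → Bool) : Continuous (uf ε α) := by
  unfold uf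
  exact continuous_finsetSum _ fun j _ => (se_continuous 1 j).const_mul _

lemma wG_nonneg {d M : ℕ} (ε : ℝ) (hε : 0 ≤ ε) (hsum : ε * ∑ j : Fin d → Fin M, kap j ≤ 1/2)
    (α : (Fin d → Fin M) → Bool) (u : Fin d → ℝ) : 0 ≤ wG ε α u := by
  unfold wG
  have : |∑ j, (sg (α j) * ε) * (kap j * se 2 j u)| ≤ 1/2 := by
    refine (Finset.abs_sum_le_sum_abs _ _).trans (le_trans ?_ hsum)
    rw [Finset.mul_sum]
    refine Finset.sum_le_sum fun j _ => ?_
    rw [abs_mul, abs_mul, abs_mul, sg_abs, abs_of_nonneg hε, abs_of_pos (kap_pos j), one_mul]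
    have := se_abs_le 2 j u
    have h2 := (kap_pos j).le
    exact mul_le_mul_of_nonneg_left (mul_le_of_le_one_right h2 this) hε
  have := (abs_le.mp this).1
  linarith

lemma uf_abs {d M : ℕ} (ε : ℝ) (hε : 0 ≤ ε) (hsum : ε * ∑ j : Fin d → Fin M, kap j ≤ 1/2)
    (α : (Fin d → Fin M) → Bool) (x : Fin d → ℝ) : |uf ε α x| ≤ 1/2 := by
  unfold uf
  refine (Finset.abs_sum_le_sum_abs _ _).trans (le_trans ?_ hsum)
  rw [Finset.mul_sum]
  refine Finset.sum_le_sum fun j _ => ?_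
  rw [abs_mul, abs_mul, sg_abs, abs_of_nonneg hε, one_mul]
  exact mul_le_mul_of_nonneg_left ((se_abs_le 1 j x).trans (one_le_kap j)) hε

lemma fα_mem {d M : ℕ} (hd : 1 ≤ d) (ε : ℝ) (hε : 0 ≤ ε) (hsum : ε * ∑ j : Fin d → Fin M, kap j ≤ 1/2)
    (α : (Fin d → Fin M) → Bool) :
    ∃ G : Measure (Fin d → ℝ), IsProbabilityMeasure G ∧ fα ε α = mixDensity d G := by
  have hse : ∀ j : Fin d → Fin M, ∀ x, |kap j * se 2 j x| ≤ kap j := by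
    intro j x
    rw [abs_mul, abs_of_pos (kap_pos j)]
    exact mul_le_of_le_one_right (kap_pos j).le (se_abs_le 2 j x)
  have hexp : ∀ u, gkd d 1 u * wG ε α u =
      gkd d 1 u + ∑ j, (sg (α j) * ε) * (gkd d 1 u * (kap j * se 2 j u)) := by
    intro u
    unfold wG
    rw [mul_add, mul_one, Finset.mul_sum]
    congr 1
    exact Finset.sum_congr rfl fun j _ => by ring
  have hij : ∀ j : Fin d → Fin M, Integrable (fun u => gkd d 1 u * (kap j * se 2 j u)) := fun j =>
    gkd_mul_bdd_integrable one_pos _ ((se_continuous 2 j).const_mul _) _ (hse j)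
  have hwint : Integrable (fun u => gkd d 1 u * wG ε α u) := by
    simp_rw [hexp]
    exact (gkd_integrable d one_pos).add (integrable_finsetSum _ fun j _ => (hij j).const_mul _)
  have h0 : ∀ u, 0 ≤ gkd d 1 u * wG ε α u := fun u =>
    mul_nonneg (gkd_nonneg _ _ _) (wG_nonneg ε hε hsum α u)
  refine ⟨volume.withDensity (fun u => ENNReal.ofReal (gkd d 1 u * wG ε α u)), ⟨?_⟩, ?_⟩
  · rw [withDensity_apply _ MeasurableSet.univ, Measure.restrict_univ,
      ← ofReal_integral_eq_lintegral_ofReal hwint (Filter.Eventually.of_forall h0)]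
    simp_rw [hexp]
    rw [integral_add (gkd_integrable d one_pos)
      (integrable_finsetSum _ fun j _ => (hij j).const_mul _),
      integral_finsetSum _ fun j _ => (hij j).const_mul _, gkd_integral d one_pos]
    have : ∀ j : Fin d → Fin M, ∫ u, (sg (α j) * ε) * (gkd d 1 u * (kap j * se 2 j u)) = 0 := by
      intro j
      rw [integral_const_mul]
      simp_rw [mul_left_comm (gkd d 1 _) (kap j)]
      rw [integral_const_mul, gkd_se_zero hd, mul_zero, mul_zero]
    simp [this]
  · ext x
    have hmw : Measurable (fun u => ENNReal.ofReal (gkd d 1 u * wG ε α u)) :=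
      ((gkd_continuous d 1).mul (wG_continuous ε α)).measurable.ennreal_ofReal
    rw [mixDensity_eq, integral_withDensity_eq_integral_toReal_smul hmw
      (Filter.Eventually.of_forall fun _ => ENNReal.ofReal_lt_top)]
    simp_rw [ENNReal.toReal_ofReal (h0 _), smul_eq_mul, hexp]
    have e : ∀ u, (gkd d 1 u + ∑ j, (sg (α j) * ε) * (gkd d 1 u * (kap j * se 2 j u))) * gkd d 1 (x - u)
        = gkd d 1 (x - u) * gkd d 1 u +
          ∑ j, (sg (α j) * ε) * (gkd d 1 (x - u) * (gkd d 1 u * (kap j * se 2 j u))) := by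
      intro u
      rw [add_mul, Finset.sum_mul, mul_comm (gkd d 1 u)]
      congr 1
      exact Finset.sum_congr rfl fun j _ => by ring
    have hcx : Continuous fun u => gkd d 1 (x - u) :=
      (gkd_continuous d 1).comp (continuous_const.sub continuous_id)
    have hbx : ∀ᵐ u, ‖gkd d 1 (x - u)‖ ≤ (1 / Real.sqrt (2*Real.pi*1))^d :=
      Filter.Eventually.of_forall fun u => by
        rw [Real.norm_of_nonneg (gkd_nonneg _ _ _)]; exact gkd_le d one_pos _
    have hi1 : Integrable fun u => gkd d 1 (x - u) * gkd d 1 u :=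
      (gkd_integrable d one_pos).bdd_mul hcx.aestronglyMeasurable hbx
    have hi2 : ∀ j : Fin d → Fin M,
        Integrable fun u => gkd d 1 (x - u) * (gkd d 1 u * (kap j * se 2 j u)) := fun j =>
      (hij j).bdd_mul hcx.aestronglyMeasurable hbx
    simp_rw [e]
    rw [integral_add hi1 (integrable_finsetSum _ fun j _ => (hi2 j).const_mul _),
      integral_finsetSum _ fun j _ => (hi2 j).const_mul _, gkd_conv d one_pos one_pos]
    simp_rw [integral_const_mul, gkd_se_conv]
    unfold fα uf
    rw [mul_add, mul_one, Finset.mul_sum]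
    norm_num
    exact Finset.sum_congr rfl fun j _ => by ring

/-! ### Two point bound -/

lemma ofReal_integral_le {E : Type*} [MeasurableSpace E] {μ : Measure E} {h : E → ℝ}
    (hi : Integrable h μ) : ENNReal.ofReal (∫ x, h x ∂μ) ≤ ∫⁻ x, ENNReal.ofReal (h x) ∂μ := by
  have h1 : ∀ x, ENNReal.ofReal (h x) = ENNReal.ofReal (max (h x) 0) := fun x => by
    rw [ENNReal.ofReal_max]; simp
  simp_rw [h1]
  rw [← ofReal_integral_eq_lintegral_ofReal hi.pos_part
    (Filter.Eventually.of_forall fun x => le_max_right _ _)]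
  exact ENNReal.ofReal_le_ofReal (integral_mono hi hi.pos_part fun x => le_max_left _ _)

lemma two_point_algebra (a ε r s : ℝ) :
    4*ε^2*(r*s) - ε^2*(r^2+s^2) ≤ (a-ε)^2*r^2 + (a+ε)^2*s^2 := by
  by_cases h : r^2 + s^2 = 0
  · have hr : r = 0 := by nlinarith [sq_nonneg r, sq_nonneg s]
    have hs : s = 0 := by nlinarith [sq_nonneg r, sq_nonneg s]
    simp [hr, hs]
  · have hp : 0 < r^2+s^2 := lt_of_le_of_ne (by positivity) (Ne.symm h)
    have key : (r^2+s^2) * ((a-ε)^2*r^2 + (a+ε)^2*s^2 - (4*ε^2*(r*s) - ε^2*(r^2+s^2))) =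
      (a*(r^2+s^2) - ε*(r^2-s^2))^2 + ε^2*(r-s)^4 := by ring
    have : 0 ≤ (a-ε)^2*r^2 + (a+ε)^2*s^2 - (4*ε^2*(r*s) - ε^2*(r^2+s^2)) := by
      apply nonneg_of_mul_nonneg_right _ hp
      rw [key]; positivity
    linarith

lemma two_point {d n : ℕ} (f g p : (Fin d → ℝ) → ℝ) (ε : ℝ)
    (hf0 : ∀ x, 0 ≤ f x) (hg0 : ∀ x, 0 ≤ g x)
    (hfm : Measurable f) (hgm : Measurable g)
    (hf : Integrable f) (hg : Integrable g) (hp : Integrable p)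
    (hf1 : ∫ x, f x = 1) (hg1 : ∫ x, g x = 1) (hp1 : ∫ x, p x = 1)
    (hfg : ∀ x, (f x + g x)/2 - 2*ε^2 * p x ≤ Real.sqrt (f x) * Real.sqrt (g x))
    (hε : 8 * n * ε^2 ≤ 1) (hε1 : 4*ε^2 ≤ 1)
    (b : (Fin n → Fin d → ℝ) → ℝ) (hb : Measurable b) :
    ENNReal.ofReal (ε^2) ≤
      ∫⁻ X, ENNReal.ofReal ((b X - ε)^2) ∂(jointMeasure d n f) +
      ∫⁻ X, ENNReal.ofReal ((b X + ε)^2) ∂(jointMeasure d n g) := by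
  have hm : ∀ f : (Fin d → ℝ) → ℝ, Measurable f →
      Measurable (fun X : Fin n → Fin d → ℝ => ∏ i, f (X i)) := fun f hf =>
    Finset.measurable_fun_prod _ fun i _ => hf.comp (measurable_pi_apply i)
  have hj : ∀ f : (Fin d → ℝ) → ℝ, (∀ x, 0 ≤ f x) → Measurable f →
      ∀ c : (Fin n → Fin d → ℝ) → ℝ, Measurable c → (∀ X, 0 ≤ c X) →
      ∫⁻ X, ENNReal.ofReal (c X) ∂(jointMeasure d n f) =
        ∫⁻ X, ENNReal.ofReal (c X * ∏ i, f (X i)) := by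
    intro f h0 hfm c hc hc0
    unfold jointMeasure
    simp_rw [← ENNReal.ofReal_prod_of_nonneg (fun i _ => h0 _)]
    rw [lintegral_withDensity_eq_lintegral_mul _ (hm f hfm).ennreal_ofReal hc.ennreal_ofReal]
    refine lintegral_congr fun X => ?_
    rw [Pi.mul_apply, mul_comm, ENNReal.ofReal_mul (hc0 X)]
  have hmm : Measurable (fun X => ENNReal.ofReal ((b X - ε)^2 * ∏ i, f (X i))) :=
    (((hb.sub_const ε).pow_const 2).mul (hm f hfm)).ennreal_ofReal
  rw [hj f hf0 hfm _ ((hb.sub_const ε).pow_const 2) (fun X => sq_nonneg _),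
    hj g hg0 hgm _ ((hb.add_const ε).pow_const 2) (fun X => sq_nonneg _),
    ← lintegral_add_left hmm]
  have hs : Integrable (fun x => Real.sqrt (f x) * Real.sqrt (g x)) := by
    refine ((hf.add hg).mono' (hfm.sqrt.mul hgm.sqrt).aestronglyMeasurable
      (Filter.Eventually.of_forall fun x => ?_))
    rw [Real.norm_of_nonneg (by positivity), Pi.add_apply]
    nlinarith [Real.sq_sqrt (hf0 x), Real.sq_sqrt (hg0 x), sq_nonneg (Real.sqrt (f x) - Real.sqrt (g x)),
      hf0 x, hg0 x]
  have hρ : 1 - 2*ε^2 ≤ ∫ x, Real.sqrt (f x) * Real.sqrt (g x) := by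
    have := integral_mono (((hf.add hg).div_const 2).sub (hp.const_mul (2*ε^2))) hs hfg
    refine le_trans (le_of_eq ?_) this
    have e := integral_sub ((hf.add hg).div_const 2) (hp.const_mul (2*ε^2))
    simp only [Pi.add_apply] at e
    simp only [Pi.sub_apply, Pi.add_apply]
    rw [e, integral_div, integral_add hf hg, integral_const_mul, hf1, hg1, hp1]
    ring
  set ρ := ∫ x, Real.sqrt (f x) * Real.sqrt (g x) with hρd
  have hρn : 3/4 ≤ ρ^n := by
    have h1 := one_add_mul_le_pow (a := -(2*ε^2)) (by linarith) n
    have h2 : (1 + -(2*ε^2))^n ≤ ρ^n := pow_le_pow_left₀ (by nlinarith) (by linarith) n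
    nlinarith
  set h : (Fin n → Fin d → ℝ) → ℝ := fun X =>
    4*ε^2 * (∏ i, (Real.sqrt (f (X i)) * Real.sqrt (g (X i)))) -
      ε^2*(∏ i, f (X i) + ∏ i, g (X i)) with hh
  have i1 : Integrable (fun X : Fin n → Fin d → ℝ => ∏ i, (Real.sqrt (f (X i)) * Real.sqrt (g (X i)))) :=
    Integrable.fintype_prod (f := fun _ x => Real.sqrt (f x) * Real.sqrt (g x)) (fun _ => hs)
  have i2 : Integrable (fun X : Fin n → Fin d → ℝ => ∏ i, f (X i)) :=
    Integrable.fintype_prod (f := fun _ => f) (fun _ => hf)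
  have i3 : Integrable (fun X : Fin n → Fin d → ℝ => ∏ i, g (X i)) :=
    Integrable.fintype_prod (f := fun _ => g) (fun _ => hg)
  have hhi : Integrable h := (i1.const_mul _).sub ((i2.add i3).const_mul _)
  have hhI : ∫ X, h X = 4*ε^2*ρ^n - 2*ε^2 := by
    have e := integral_sub (i1.const_mul (4*ε^2)) ((i2.add i3).const_mul (ε^2))
    simp only [Pi.add_apply] at e
    rw [hh]
    simp only
    rw [e, integral_const_mul, integral_const_mul, integral_add i2 i3,
      integral_fintype_prod_volume_eq_pow (fun x => Real.sqrt (f x) * Real.sqrt (g x)),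
      integral_fintype_prod_volume_eq_pow f, integral_fintype_prod_volume_eq_pow g, hf1, hg1]
    simp
    ring
  calc ENNReal.ofReal (ε^2) ≤ ENNReal.ofReal (∫ X, h X) := by
        apply ENNReal.ofReal_le_ofReal
        rw [hhI]; nlinarith [sq_nonneg ε]
    _ ≤ ∫⁻ X, ENNReal.ofReal (h X) := ofReal_integral_le hhi
    _ ≤ _ := by
      refine lintegral_mono fun X => ?_
      have hP : 0 ≤ ∏ i, f (X i) := Finset.prod_nonneg fun i _ => hf0 _
      have hQ : 0 ≤ ∏ i, g (X i) := Finset.prod_nonneg fun i _ => hg0 _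
      rw [← ENNReal.ofReal_add (by positivity) (by positivity)]
      apply ENNReal.ofReal_le_ofReal
      have := two_point_algebra (b X) ε (∏ i, Real.sqrt (f (X i))) (∏ i, Real.sqrt (g (X i)))
      rw [← Finset.prod_pow, ← Finset.prod_pow] at this
      simp_rw [Real.sq_sqrt (hf0 _), Real.sq_sqrt (hg0 _)] at this
      rw [← Finset.prod_mul_distrib] at this
      exact this

lemma sqrt_ineq (A v : ℝ) (h1 : 1/2 ≤ A) (hv : 4*v^2 ≤ 1) :
    A - 2*v^2 ≤ Real.sqrt ((A+v)*(A-v)) := by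
  apply Real.le_sqrt_of_sq_le
  nlinarith [mul_nonneg (sq_nonneg v) (by linarith : (0:ℝ) ≤ 4*A - 1 - 4*v^2)]

/-! ### Bessel's inequality on a box -/

lemma cos_int (c : ℤ) : ∫ x in (-Real.pi)..Real.pi, Real.cos (c * x) = if c = 0 then 2*Real.pi else 0 := by
  split_ifs with h
  · simp [h]; ring
  · have hc : (c:ℝ) ≠ 0 := by exact_mod_cast h
    rw [intervalIntegral.integral_comp_mul_left (fun y => Real.cos y) hc, integral_cos]
    simp [Real.sin_int_mul_pi]

lemma sin_sin_int (a b : ℕ) :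
    ∫ x in (-Real.pi)..Real.pi, Real.sin (((a:ℝ)+1)*x) * Real.sin (((b:ℝ)+1)*x) =
      if a = b then Real.pi else 0 := by
  have h : ∀ x : ℝ, Real.sin (((a:ℝ)+1)*x) * Real.sin (((b:ℝ)+1)*x) =
      (1/2) * (Real.cos (((a - b : ℤ):ℝ) * x) - Real.cos (((a + b + 2 : ℤ):ℝ) * x)) := by
    intro x
    have := Real.two_mul_sin_mul_sin (((a:ℝ)+1)*x) (((b:ℝ)+1)*x)
    rw [show ((a:ℝ)+1)*x - ((b:ℝ)+1)*x = ((a - b : ℤ):ℝ) * x by push_cast; ring,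
      show ((a:ℝ)+1)*x + ((b:ℝ)+1)*x = ((a + b + 2 : ℤ):ℝ) * x by push_cast; ring] at this
    linarith
  simp_rw [h]
  rw [intervalIntegral.integral_const_mul, intervalIntegral.integral_sub, cos_int, cos_int]
  · have : ¬ ((a:ℤ) + b + 2 = 0) := by omega
    rw [if_neg this]
    by_cases hab : a = b
    · simp [hab]
    · have : ¬ ((a:ℤ) - b = 0) := by omega
      rw [if_neg this, if_neg hab]; simp
  · exact Continuous.intervalIntegrable (by fun_prop) _ _
  · exact Continuous.intervalIntegrable (by fun_prop) _ _

noncomputable def bx (d : ℕ) : Measure (Fin d → ℝ) :=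
  Measure.pi (fun _ : Fin d => (volume : Measure ℝ).restrict (Set.Icc (-Real.pi) Real.pi))

instance bx_finite (d : ℕ) : IsFiniteMeasure (bx d) := by unfold bx; infer_instance

lemma bx_eq (d : ℕ) : bx d = volume.restrict (Set.univ.pi fun _ => Set.Icc (-Real.pi) Real.pi) := by
  unfold bx
  rw [volume_pi, Measure.restrict_pi_pi]

lemma se_orth {d M : ℕ} (j k : Fin d → Fin M) :
    ∫ x, se 1 j x * se 1 k x ∂(bx d) = if j = k then Real.pi^d else 0 := by
  unfold se bx
  simp_rw [← Finset.prod_mul_distrib, one_mul]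
  rw [integral_fintype_prod_eq_prod
    (fun i (x:ℝ) => Real.sin (((j i : ℕ) + 1 : ℝ) * x) * Real.sin (((k i : ℕ) + 1 : ℝ) * x))]
  have h : ∀ i, ∫ x in Set.Icc (-Real.pi) Real.pi,
      Real.sin (((j i : ℕ) + 1 : ℝ) * x) * Real.sin (((k i : ℕ) + 1 : ℝ) * x) =
      if j i = k i then Real.pi else 0 := by
    intro i
    rw [integral_Icc_eq_integral_Ioc, ← intervalIntegral.integral_of_le (by linarith [Real.pi_pos]),
      sin_sin_int]
    simp [Fin.ext_iff]
  simp_rw [h]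
  split_ifs with hjk
  · simp [hjk]
  · obtain ⟨i, hi⟩ := Function.ne_iff.mp hjk
    exact Finset.prod_eq_zero (Finset.mem_univ i) (if_neg hi)

lemma bessel {E ι : Type*} [MeasurableSpace E] [Fintype ι] [DecidableEq ι] (μ : Measure E)
    [IsFiniteMeasure μ] (e : ι → E → ℝ) (he : ∀ j, Measurable (e j)) (hb : ∀ j x, |e j x| ≤ 1)
    (N : ℝ) (hN : 0 < N) (ho : ∀ j k, ∫ x, e j x * e k x ∂μ = if j = k then N else 0)
    (h : E → ℝ) (hm : MemLp h 2 μ) :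
    N * ∑ j, ((1/N) * ∫ x, h x * e j x ∂μ)^2 ≤ ∫ x, h x ^ 2 ∂μ := by
  set γ : ι → ℝ := fun j => (1/N) * ∫ x, h x * e j x ∂μ with hγ
  have hγ' : ∀ j, ∫ x, h x * e j x ∂μ = N * γ j := fun j => by
    rw [hγ]; field_simp
  have ih := hm.integrable one_le_two
  have ihe : ∀ j, Integrable (fun x => h x * e j x) μ := fun j =>
    ih.mul_bdd (c := 1) (he j).aestronglyMeasurable (Filter.Eventually.of_forall (hb j))
  have iee : ∀ j k, Integrable (fun x => e j x * e k x) μ := fun j k =>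
    Integrable.of_bound (C := 1) ((he j).mul (he k)).aestronglyMeasurable
      (Filter.Eventually.of_forall fun x => by
        rw [norm_mul]; exact mul_le_one₀ (hb j x) (norm_nonneg _) (hb k x))
  have ih2 := hm.integrable_sq
  have hex : ∀ x, (h x - ∑ j, γ j * e j x)^2 =
      h x ^ 2 - 2 * (∑ j, γ j * (h x * e j x)) + ∑ j, ∑ k, (γ j * γ k) * (e j x * e k x) := by
    intro x
    have e1 : ∑ j, γ j * (h x * e j x) = h x * ∑ j, γ j * e j x := by
      rw [Finset.mul_sum]; exact Finset.sum_congr rfl fun j _ => by ring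
    have e2 : ∑ j, ∑ k, (γ j * γ k) * (e j x * e k x) = (∑ j, γ j * e j x)^2 := by
      rw [sq, Finset.sum_mul_sum]
      exact Finset.sum_congr rfl fun j _ => Finset.sum_congr rfl fun k _ => by ring
    rw [e1, e2]; ring
  have hnn : 0 ≤ ∫ x, (h x - ∑ j, γ j * e j x)^2 ∂μ := integral_nonneg fun x => sq_nonneg _
  simp_rw [hex] at hnn
  have is1 : Integrable (fun x => ∑ j, γ j * (h x * e j x)) μ :=
    integrable_finsetSum _ fun j _ => (ihe j).const_mul _
  have is2 : Integrable (fun x => ∑ j, ∑ k, (γ j * γ k) * (e j x * e k x)) μ :=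
    integrable_finsetSum _ fun j _ => integrable_finsetSum _ fun k _ => (iee j k).const_mul _
  have is0 : Integrable (fun x => h x ^ 2 - 2 * ∑ j, γ j * (h x * e j x)) μ := ih2.sub (is1.const_mul 2)
  rw [integral_add is0 is2, integral_sub ih2 (is1.const_mul 2),
    integral_const_mul, integral_finsetSum _ fun j _ => (ihe j).const_mul _,
    integral_finsetSum _ fun j _ => integrable_finsetSum _ fun k _ => (iee j k).const_mul _] at hnn
  have e3 : ∀ j, ∫ x, ∑ k, (γ j * γ k) * (e j x * e k x) ∂μ = N * γ j^2 := by
    intro j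
    rw [integral_finsetSum _ fun k _ => (iee j k).const_mul _]
    simp_rw [integral_const_mul, ho]
    simp
    ring
  simp_rw [e3, integral_const_mul, hγ'] at hnn
  have e4 : ∑ j, γ j * (N * γ j) = N * ∑ j, γ j^2 := by
    rw [Finset.mul_sum]; exact Finset.sum_congr rfl fun j _ => by ring
  rw [e4, ← Finset.mul_sum] at hnn
  linarith

noncomputable def pmin (d : ℕ) : ℝ := (gk 2 Real.pi)^d

lemma pmin_pos (d : ℕ) : 0 < pmin d := by
  unfold pmin gk
  have := Real.pi_pos
  positivity

lemma pmin_le {d : ℕ} (x : Fin d → ℝ) (hx : x ∈ Set.univ.pi fun _ : Fin d => Set.Icc (-Real.pi) Real.pi) :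
    pmin d ≤ gkd d 2 x := by
  unfold pmin gkd
  rw [show gk 2 Real.pi ^ d = ∏ _i : Fin d, gk 2 Real.pi by simp]
  refine Finset.prod_le_prod (fun _ _ => gk_nonneg _ _) fun i _ => ?_
  have h := hx i (Set.mem_univ i)
  have h2 : x i ^ 2 ≤ Real.pi^2 := sq_le_sq' h.1 h.2
  unfold gk
  gcongr

/-- coefficient functional -/
noncomputable def coef {d M : ℕ} (g : (Fin d → ℝ) → ℝ) (j : Fin d → Fin M) : ℝ :=
  (1/Real.pi^d) * ∫ x, (g x / gkd d 2 x - 1) * se 1 j x ∂(bx d)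

lemma gkd_pos (d : ℕ) {a : ℝ} (ha : 0 < a) (x : Fin d → ℝ) : 0 < gkd d a x := by
  unfold gkd gk
  have := Real.pi_pos
  exact Finset.prod_pos fun i _ => by positivity

lemma loss_lower {d M : ℕ} (ε : ℝ) (α : (Fin d → Fin M) → Bool) (g : (Fin d → ℝ) → ℝ)
    (hg : Measurable g) :
    ENNReal.ofReal (pmin d ^ 2 * Real.pi^d) *
      ∑ j, ENNReal.ofReal ((coef g j - sg (α j) * ε)^2) ≤ L2sq d g (fα ε α) := by
  have hpi := Real.pi_pos
  by_cases htop : L2sq d g (fα ε α) = ⊤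
  · rw [htop]; exact le_top
  set h : (Fin d → ℝ) → ℝ := fun x => g x / gkd d 2 x - 1 - uf ε α x with hh
  have hhm : Measurable h :=
    ((hg.div (gkd_continuous d 2).measurable).sub_const 1).sub (uf_continuous ε α).measurable
  have hle : ENNReal.ofReal (pmin d ^ 2) * ∫⁻ x, ENNReal.ofReal (h x ^ 2) ∂(bx d) ≤ L2sq d g (fα ε α) := by
    rw [← lintegral_const_mul _ (hhm.pow_const 2).ennreal_ofReal, bx_eq]
    refine le_trans ?_ (setLIntegral_le_lintegral
      (Set.univ.pi fun _ => Set.Icc (-Real.pi) Real.pi) _)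
    refine setLIntegral_mono' (MeasurableSet.univ_pi fun _ => measurableSet_Icc) fun x hx => ?_
    rw [← ENNReal.ofReal_mul (sq_nonneg _)]
    apply ENNReal.ofReal_le_ofReal
    have hp := gkd_pos d two_pos x
    have : g x - fα ε α x = gkd d 2 x * h x := by
      rw [hh, fα]; field_simp; ring
    rw [this, mul_pow]
    have := pmin_pos d
    gcongr
    exact pmin_le x hx
  have hfin : ∫⁻ x, ENNReal.ofReal (h x ^ 2) ∂(bx d) ≠ ⊤ := by
    intro ht
    rw [ht, ENNReal.mul_top (by simpa using (pmin_pos d).ne')] at hle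
    exact htop (top_le_iff.mp hle)
  have hi2 : Integrable (fun x => h x ^ 2) (bx d) := by
    refine ⟨(hhm.pow_const 2).aestronglyMeasurable, ?_⟩
    rw [hasFiniteIntegral_iff_ofReal (Filter.Eventually.of_forall fun x => sq_nonneg _)]
    exact lt_top_iff_ne_top.mpr hfin
  have hL : MemLp h 2 (bx d) := (memLp_two_iff_integrable_sq hhm.aestronglyMeasurable).mpr hi2
  have hi := hL.integrable one_le_two
  have hiu : Integrable (uf ε α) (bx d) := by
    unfold uf
    refine integrable_finsetSum _ fun j _ => Integrable.const_mul ?_ _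
    exact Integrable.of_bound (C := 1) (se_continuous 1 j).aestronglyMeasurable
      (Filter.Eventually.of_forall (se_abs_le 1 j))
  have hmulb : ∀ {q : (Fin d → ℝ) → ℝ}, Integrable q (bx d) → ∀ j : Fin d → Fin M,
      Integrable (fun x => q x * se 1 j x) (bx d) := fun hq j =>
    hq.mul_bdd (c := 1) (se_continuous 1 j).aestronglyMeasurable (Filter.Eventually.of_forall (se_abs_le 1 j))
  have hse1 : ∀ k : Fin d → Fin M, Integrable (se 1 k) (bx d) := fun k =>
    Integrable.of_bound (C := 1) (se_continuous 1 k).aestronglyMeasurable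
      (Filter.Eventually.of_forall (se_abs_le 1 k))
  have hcoef : ∀ j, (1/Real.pi^d) * ∫ x, h x * se 1 j x ∂(bx d) = coef g j - sg (α j) * ε := by
    intro j
    have e1 : ∀ x, (g x / gkd d 2 x - 1) * se 1 j x = h x * se 1 j x + uf ε α x * se 1 j x := by
      intro x; rw [hh]; ring
    unfold coef
    simp_rw [e1]
    rw [integral_add (hmulb hi j) (hmulb hiu j)]
    have e2 : ∫ x, uf ε α x * se 1 j x ∂(bx d) = sg (α j) * ε * Real.pi^d := by
      unfold uf
      simp_rw [Finset.sum_mul, mul_assoc (sg _ * ε)]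
      rw [integral_finsetSum _ fun k _ => (hmulb (hse1 k) j).const_mul _]
      simp_rw [integral_const_mul, se_orth]
      simp
    rw [e2]
    field_simp
    ring
  have hB := bessel (bx d) (fun j : Fin d → Fin M => se 1 j) (fun j => (se_continuous 1 j).measurable)
    (fun j => se_abs_le 1 j) (Real.pi^d) (by positivity) se_orth h hL
  simp_rw [hcoef] at hB
  refine le_trans ?_ hle
  rw [ENNReal.ofReal_mul (sq_nonneg _), mul_assoc]
  gcongr
  rw [← ENNReal.ofReal_sum_of_nonneg (fun j _ => sq_nonneg _), ← ENNReal.ofReal_mul (by positivity),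
    ← ofReal_integral_eq_lintegral_ofReal hi2 (Filter.Eventually.of_forall fun x => sq_nonneg _)]
  exact ENNReal.ofReal_le_ofReal hB

lemma coef_measurable {d n M : ℕ} (fhat : (Fin n → Fin d → ℝ) → (Fin d → ℝ) → ℝ)
    (hf : Measurable (Function.uncurry fhat)) (j : Fin d → Fin M) :
    Measurable (fun X => coef (fhat X) j) := by
  unfold coef
  apply Measurable.const_mul
  have hm : Measurable (fun q : (Fin n → Fin d → ℝ) × (Fin d → ℝ) =>
      (fhat q.1 q.2 / gkd d 2 q.2 - 1) * se 1 j q.2) := by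
    have h1 : Measurable (fun q : (Fin n → Fin d → ℝ) × (Fin d → ℝ) => fhat q.1 q.2) := hf
    have h2 : Measurable (fun q : (Fin n → Fin d → ℝ) × (Fin d → ℝ) => gkd d 2 q.2) :=
      (gkd_continuous d 2).measurable.comp measurable_snd
    have h3 : Measurable (fun q : (Fin n → Fin d → ℝ) × (Fin d → ℝ) => se 1 j q.2) :=
      (se_continuous 1 j).measurable.comp measurable_snd
    exact ((h1.div h2).sub_const 1).mul h3
  exact (hm.stronglyMeasurable.integral_prod_right (ν := bx d)).measurable

/-! ## Assembly of the lower bound -/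

lemma uf_flip {d M : ℕ} (ε : ℝ) (α : (Fin d → Fin M) → Bool) (j : Fin d → Fin M) (x : Fin d → ℝ) :
    uf ε α x - uf ε (Function.update α j (!α j)) x = 2 * (sg (α j) * ε * se 1 j x) := by
  unfold uf
  rw [← Finset.sum_sub_distrib, Finset.sum_eq_single j]
  · rw [Function.update_self, sg_not]; ring
  · intro k _ hk
    rw [Function.update_of_ne hk, sub_self]
  · simp

lemma fα_flip_ineq {d M : ℕ} (ε : ℝ) (hε : 0 ≤ ε) (hsum : ε * ∑ j : Fin d → Fin M, kap j ≤ 1/2)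
    (hε1 : 4*ε^2 ≤ 1) (α : (Fin d → Fin M) → Bool) (j : Fin d → Fin M) (x : Fin d → ℝ) :
    (fα ε α x + fα ε (Function.update α j (!α j)) x)/2 - 2*ε^2 * gkd d 2 x ≤
      Real.sqrt (fα ε α x) * Real.sqrt (fα ε (Function.update α j (!α j)) x) := by
  have h1 := abs_le.mp (uf_abs ε hε hsum α x)
  have h2 := abs_le.mp (uf_abs ε hε hsum (Function.update α j (!α j)) x)
  have h3 := uf_flip ε α j x
  have hp := gkd_pos d (by norm_num : (0:ℝ) < 2) x
  unfold fα
  set u := uf ε α x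
  set w := uf ε (Function.update α j (!α j)) x
  set p := gkd d 2 x
  set v := sg (α j) * ε * se 1 j x with hv
  have hv2 : v^2 ≤ ε^2 := by
    rw [← sq_abs v, hv, abs_mul, abs_mul, sg_abs, abs_of_nonneg hε, one_mul]
    have := se_abs_le 1 j x
    have h0 := abs_nonneg (se 1 j x)
    apply pow_le_pow_left₀ (by positivity)
    exact mul_le_of_le_one_right hε this
  have hs := sqrt_ineq (1 + (u+w)/2) v (by linarith [h1.1, h2.1]) (by linarith)
  have e1 : (1 + (u+w)/2 + v) = 1 + u := by linarith
  have e2 : (1 + (u+w)/2 - v) = 1 + w := by linarith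
  rw [e1, e2] at hs
  have e3 : Real.sqrt (p*(1+u)) * Real.sqrt (p*(1+w)) = p * Real.sqrt ((1+u)*(1+w)) := by
    rw [← Real.sqrt_mul (mul_nonneg hp.le (by linarith [h1.1])),
      show p*(1+u)*(p*(1+w)) = p^2 * ((1+u)*(1+w)) by ring, Real.sqrt_mul (sq_nonneg p),
      Real.sqrt_sq hp.le]
  rw [e3]
  calc _ = p * (1 + (u+w)/2 - 2*ε^2) := by ring
    _ ≤ p * (1 + (u+w)/2 - 2*v^2) := by
      apply mul_le_mul_of_nonneg_left _ hp.le; linarith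
    _ ≤ _ := mul_le_mul_of_nonneg_left hs hp.le

lemma mixDensity_integral (d : ℕ) (G : Measure (Fin d → ℝ)) [IsProbabilityMeasure G] :
    ∫ x, mixDensity d G x = 1 := by
  rw [integral_eq_lintegral_of_nonneg_ae (Filter.Eventually.of_forall (mixDensity_nonneg d G))
    (mixDensity_measurable d G).aestronglyMeasurable, mixDensity_lintegral]
  simp

lemma pair_bound {d n M : ℕ} (hd : 1 ≤ d) (ε : ℝ) (hε : 0 ≤ ε)
    (hsum : ε * ∑ j : Fin d → Fin M, kap j ≤ 1/2) (hε8 : 8 * n * ε^2 ≤ 1)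
    (hε1 : 4*ε^2 ≤ 1) (b : (Fin n → Fin d → ℝ) → ℝ) (hb : Measurable b)
    (α : (Fin d → Fin M) → Bool) (j : Fin d → Fin M) :
    ENNReal.ofReal (ε^2) ≤
      ∫⁻ X, ENNReal.ofReal ((b X - sg (α j) * ε)^2) ∂(jointMeasure d n (fα ε α)) +
      ∫⁻ X, ENNReal.ofReal ((b X - sg (!α j) * ε)^2)
        ∂(jointMeasure d n (fα ε (Function.update α j (!α j)))) := by
  have hineq := fα_flip_ineq ε hε hsum hε1 α j
  obtain ⟨G, hG, h1⟩ := fα_mem hd ε hε hsum α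
  obtain ⟨H, hH, h2⟩ := fα_mem hd ε hε hsum (Function.update α j (!α j))
  have h2p : (0:ℝ) < 2 := by norm_num
  rw [h1, h2] at hineq ⊢
  cases hα : α j
  · have := two_point (n := n) (mixDensity d H) (mixDensity d G) (gkd d 2) ε
      (mixDensity_nonneg d H) (mixDensity_nonneg d G) (mixDensity_measurable d H)
      (mixDensity_measurable d G) (mixDensity_integrable d H) (mixDensity_integrable d G)
      (gkd_integrable d h2p) (mixDensity_integral d H) (mixDensity_integral d G)
      (gkd_integral d h2p)
      (fun x => by rw [add_comm, mul_comm (Real.sqrt _)]; exact hineq x) hε8 hε1 b hb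
    rw [add_comm]
    simpa [sg] using this
  · have := two_point (n := n) (mixDensity d G) (mixDensity d H) (gkd d 2) ε
      (mixDensity_nonneg d G) (mixDensity_nonneg d H) (mixDensity_measurable d G)
      (mixDensity_measurable d H) (mixDensity_integrable d G) (mixDensity_integrable d H)
      (gkd_integrable d h2p) (mixDensity_integral d G) (mixDensity_integral d H)
      (gkd_integral d h2p) hineq hε8 hε1 b hb
    simpa [sg] using this

lemma avg_bound {J : Type*} [Fintype J] [DecidableEq J] (T : (J → Bool) → J → ℝ≥0∞) (e R : ℝ≥0∞)
    (hT : ∀ α j, e ≤ T α j + T (Function.update α j (!α j)) j)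
    (hR : ∀ α, ∑ j, T α j ≤ R) : (Fintype.card J : ℝ≥0∞) * e ≤ 2 * R := by
  have hinv : ∀ j : J, Function.Involutive
      (fun α : J → Bool => Function.update α j (!α j)) := by
    intro j α
    simp
  have hj : ∀ j : J, (Fintype.card (J → Bool) : ℝ≥0∞) * e ≤ 2 * ∑ α, T α j := by
    intro j
    have hs : ∑ α : J → Bool, T (Function.update α j (!α j)) j = ∑ α, T α j :=
      Equiv.sum_comp (hinv j).toPerm (fun α => T α j)
    calc (Fintype.card (J → Bool) : ℝ≥0∞) * e = ∑ _α : J → Bool, e := by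
          rw [Finset.sum_const, Finset.card_univ, nsmul_eq_mul]
      _ ≤ ∑ α, (T α j + T (Function.update α j (!α j)) j) :=
          Finset.sum_le_sum fun α _ => hT α j
      _ = _ := by rw [Finset.sum_add_distrib, hs, two_mul]
  have h1 : (Fintype.card (J → Bool) : ℝ≥0∞) * ((Fintype.card J : ℝ≥0∞) * e) ≤
      (Fintype.card (J → Bool) : ℝ≥0∞) * (2 * R) := by
    calc _ = ∑ _j : J, (Fintype.card (J → Bool) : ℝ≥0∞) * e := by
          rw [Finset.sum_const, Finset.card_univ, nsmul_eq_mul]; ring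
      _ ≤ ∑ j, 2 * ∑ α, T α j := Finset.sum_le_sum fun j _ => hj j
      _ = 2 * ∑ α, ∑ j, T α j := by rw [← Finset.mul_sum, Finset.sum_comm]
      _ ≤ 2 * ∑ _α : J → Bool, R := by gcongr with α; exact hR α
      _ = _ := by rw [Finset.sum_const, Finset.card_univ, nsmul_eq_mul]; ring
  exact (ENNReal.mul_le_mul_iff_right (by simp) (by simp)).mp h1

lemma lower_core {d n M : ℕ} (hd : 1 ≤ d) (ε : ℝ) (hε : 0 ≤ ε)
    (hsum : ε * ∑ j : Fin d → Fin M, kap j ≤ 1/2) (hε8 : 8 * n * ε^2 ≤ 1)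
    (hε1 : 4*ε^2 ≤ 1) :
    ENNReal.ofReal (pmin d ^ 2 * Real.pi^d * (M^d * ε^2) / 2) ≤
      minimaxRisk d n (gaussMixtures d) (L2sq d) := by
  have hc1 : 0 < pmin d ^ 2 * Real.pi^d := by
    have := pmin_pos d
    have := Real.pi_pos
    positivity
  unfold minimaxRisk
  refine le_iInf₂ fun fhat hf => ?_
  set R := ⨆ f ∈ gaussMixtures d, ∫⁻ X, L2sq d (fhat X) f ∂(jointMeasure d n f) with hRdef
  set c1 := pmin d ^ 2 * Real.pi^d with hc1def
  have key := avg_bound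
    (fun (α : (Fin d → Fin M) → Bool) j => ENNReal.ofReal c1 *
      ∫⁻ X, ENNReal.ofReal ((coef (fhat X) j - sg (α j) * ε)^2) ∂(jointMeasure d n (fα ε α)))
    (ENNReal.ofReal c1 * ENNReal.ofReal (ε^2)) R
    (fun α j => by
      rw [← mul_add]
      have := pair_bound (n := n) hd ε hε hsum hε8 hε1 (fun X => coef (fhat X) j)
        (coef_measurable fhat hf j) α j
      gcongr
      simpa only [Function.update_self] using this)
    (fun α => by
      have hm : ∀ j : Fin d → Fin M, Measurable
          (fun X => ENNReal.ofReal ((coef (fhat X) j - sg (α j) * ε)^2)) := fun j =>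
        (((coef_measurable fhat hf j).sub_const _).pow_const 2).ennreal_ofReal
      rw [← Finset.mul_sum, ← lintegral_finsetSum _ (fun j _ => hm j),
        ← lintegral_const_mul _ (Finset.measurable_fun_sum _ fun j _ => hm j)]
      refine le_trans (lintegral_mono fun X => loss_lower ε α (fhat X) ?_) ?_
      · exact hf.comp measurable_prodMk_left
      · exact le_iSup₂_of_le (fα ε α) (fα_mem hd ε hε hsum α) le_rfl)
  have hcard : Fintype.card (Fin d → Fin M) = M^d := by simp
  rw [hcard, ← ENNReal.ofReal_mul hc1.le, ← ENNReal.ofReal_natCast,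
    ← ENNReal.ofReal_mul (by positivity)] at key
  rw [show c1 * (M^d * ε^2) / 2 = (((M^d : ℕ) : ℝ) * (c1 * ε^2)) / 2 by push_cast; ring,
    ENNReal.ofReal_div_of_pos (by norm_num)]
  refine ENNReal.div_le_of_le_mul ?_
  rw [mul_comm R]
  simpa using key

lemma kap_sum_le (d M : ℕ) : ∑ j : Fin d → Fin M, kap j ≤ Real.exp (2*d*(M:ℝ)^2) := by
  have h1 : ∀ j : Fin d → Fin M, kap j ≤ Real.exp ((M:ℝ)^2)^d := by
    intro j
    unfold kap
    calc _ ≤ ∏ _i : Fin d, Real.exp ((M:ℝ)^2) := by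
          refine Finset.prod_le_prod (fun i _ => (Real.exp_pos _).le) fun i _ => ?_
          apply Real.exp_le_exp.mpr
          have : (((j i : ℕ) + 1 : ℕ) : ℝ) ≤ M := by exact_mod_cast (j i).2
          push_cast at this
          exact pow_le_pow_left₀ (by positivity) this 2
      _ = _ := by simp
  have hM : (M:ℝ) ≤ Real.exp ((M:ℝ)^2) := by
    have := Real.add_one_le_exp ((M:ℝ)^2)
    nlinarith [sq_nonneg ((M:ℝ) - 1/2)]
  calc _ ≤ ∑ _j : Fin d → Fin M, Real.exp ((M:ℝ)^2)^d := Finset.sum_le_sum fun j _ => h1 j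
    _ = (M:ℝ)^d * Real.exp ((M:ℝ)^2)^d := by simp
    _ ≤ Real.exp ((M:ℝ)^2)^d * Real.exp ((M:ℝ)^2)^d := by gcongr
    _ = _ := by
      rw [← Real.exp_nat_mul, ← Real.exp_add]; congr 1; ring

theorem lower_bound (d : ℕ) (hd : 1 ≤ d) : ∃ c : ℝ, 0 < c ∧ ∀ n : ℕ, 2 ≤ n →
    ENNReal.ofReal (c * (Real.log n) ^ ((d : ℝ)/2) / n) ≤
      minimaxRisk d n (gaussMixtures d) (L2sq d) := by
  have hd' : (0:ℝ) < d := by exact_mod_cast hd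
  have hc1 : 0 < pmin d ^ 2 * Real.pi^d := by
    have := pmin_pos d
    have := Real.pi_pos
    positivity
  set c1 := pmin d ^ 2 * Real.pi^d with hc1def
  set c : ℝ := Real.sqrt (1/(8*d)) with hc
  have hcpos : 0 < c := Real.sqrt_pos.mpr (by positivity)
  have hc2 : c^2 = 1/(8*d) := Real.sq_sqrt (by positivity)
  set c0 : ℝ := Real.exp (-(4*d)) / 4 with hc0
  have hc0pos : 0 < c0 := by positivity
  have hc0le : c0 ≤ 1/4 := by
    have : Real.exp (-(4*(d:ℝ))) ≤ 1 := Real.exp_le_one_iff.mpr (by linarith)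
    rw [hc0]; linarith
  refine ⟨c1 * c0^2 * c^d / 2, by positivity, fun n hn => ?_⟩
  have hn2 : (2:ℝ) ≤ n := by exact_mod_cast hn
  have hn' : (0:ℝ) < n := by linarith
  have hL : 0 < Real.log n := Real.log_pos (by linarith)
  have hpow : (Real.log n) ^ ((d : ℝ)/2) = Real.sqrt (Real.log n) ^ d := by
    rw [Real.sqrt_eq_rpow, ← Real.rpow_natCast, ← Real.rpow_mul hL.le]
    congr 1; ring
  set s := Real.sqrt (Real.log n) with hs
  have hs0 : 0 ≤ s := Real.sqrt_nonneg _
  have hs2 : s^2 = Real.log n := Real.sq_sqrt hL.le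
  set M : ℕ := ⌈c * s⌉₊ with hM
  have hM1 : c * s ≤ M := Nat.le_ceil _
  have hM2 : (M:ℝ) < c * s + 1 := Nat.ceil_lt_add_one (by positivity)
  have hMsq : (M:ℝ)^2 ≤ 2 * (c^2 * s^2) + 2 := by
    have h0 : (0:ℝ) ≤ M := Nat.cast_nonneg _
    have : (M:ℝ)^2 ≤ (c*s+1)^2 := pow_le_pow_left₀ h0 hM2.le 2
    nlinarith [sq_nonneg (c*s-1)]
  have hexp : Real.exp (2*d*(M:ℝ)^2) ≤ Real.exp (4*d) * Real.sqrt n := by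
    have : Real.sqrt n = Real.exp (Real.log n / 2) := by
      rw [Real.sqrt_eq_rpow, Real.rpow_def_of_pos hn']; congr 1; ring
    rw [this, ← Real.exp_add]
    apply Real.exp_le_exp.mpr
    rw [hc2, hs2] at hMsq
    calc 2*d*(M:ℝ)^2 ≤ 2*d*(2 * (1/(8*d) * Real.log n) + 2) := by gcongr
      _ = _ := by field_simp; ring
  have hsn : 0 < Real.sqrt n := Real.sqrt_pos.mpr hn'
  have hsn2 : Real.sqrt n ^ 2 = n := Real.sq_sqrt hn'.le
  set ε := c0 / Real.sqrt n with hε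
  have hε0 : 0 ≤ ε := by positivity
  have hε2 : ε^2 = c0^2 / n := by rw [hε, div_pow, hsn2]
  have hc0sq : c0^2 ≤ 1/16 := by nlinarith
  have hsum : ε * ∑ j : Fin d → Fin M, kap j ≤ 1/2 := by
    calc _ ≤ ε * (Real.exp (4*d) * Real.sqrt n) :=
          mul_le_mul_of_nonneg_left ((kap_sum_le d M).trans hexp) hε0
      _ = (Real.exp (-(4*d)) * Real.exp (4*d)) / 4 := by
          rw [hε, hc0]; field_simp
      _ ≤ 1/2 := by rw [← Real.exp_add]; norm_num
  have hε8 : 8 * n * ε^2 ≤ 1 := by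
    rw [hε2, show 8 * (n:ℝ) * (c0^2/n) = 8 * c0^2 by field_simp]; linarith
  have hε1 : 4 * ε^2 ≤ 1 := by
    nlinarith [sq_nonneg ε]
  refine le_trans (ENNReal.ofReal_le_ofReal ?_) (lower_core (n := n) (M := M) hd ε hε0 hsum hε8 hε1)
  rw [hpow, hε2, ← hc1def]
  calc c1 * c0^2 * c^d / 2 * s^d / n = c1 * ((c*s)^d * (c0^2/n)) / 2 := by rw [mul_pow]; ring
    _ ≤ _ := by gcongr

theorem stmt0 (d : ℕ) (hd : 1 ≤ d) :
    ∃ c C : ℝ, 0 < c ∧ 0 < C ∧ ∀ n : ℕ, 2 ≤ n →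
      ENNReal.ofReal (c * (Real.log n) ^ ((d : ℝ)/2) / n)
          ≤ minimaxRisk d n (gaussMixtures d) (L2sq d) ∧
      minimaxRisk d n (gaussMixtures d) (L2sq d)
          ≤ ENNReal.ofReal (C * (Real.log n) ^ ((d : ℝ)/2) / n) := by
  obtain ⟨C, hC, hU⟩ := upper_bound d
  obtain ⟨c, hc, hL⟩ := lower_bound d hd
  exact ⟨c, C, hc, hC, fun n hn => ⟨hL n hn, hU n hn⟩⟩
end

section
/- There exists a constant c_d > 0 depending only on the dimension d such that for every Γ ≥ 1/c_d and every n ≥ 2, the minimax risk for estimating a Gaussian location mixture density with sub-Gaussian mixing measure under the squared Hellinger loss satisfies R_n(F_{G₁(Γ)}, h²) ≥ c_d·(log n)^d/n. -/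
open MeasureTheory Real ENNReal

noncomputable def euclNorm (d : ℕ) (u : Fin d → ℝ) : ℝ := Real.sqrt (∑ i, (u i)^2)

/-- The class `G₁(Γ)` of sub-Gaussian mixing measures:
`G {u : ‖u‖ > t} ≤ Γ exp(-t²/Γ)` for all `t > 0`. -/
def subGaussianClass (d : ℕ) (Γ : ℝ) : Set (Measure (Fin d → ℝ)) :=
  {G | IsProbabilityMeasure G ∧
    ∀ t : ℝ, 0 < t → G {u | t < euclNorm d u} ≤ ENNReal.ofReal (Γ * Real.exp (-(t^2)/Γ))}

/-- The class `F_{G₁(Γ)}` of Gaussian location mixtures with mixing measure in `G₁(Γ)`. -/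
def gaussMixturesSubG (d : ℕ) (Γ : ℝ) : Set ((Fin d → ℝ) → ℝ) :=
  {f | ∃ G ∈ subGaussianClass d Γ, f = mixDensity d G}

/-- Squared Hellinger distance. -/
noncomputable def hellSq (d : ℕ) (f g : (Fin d → ℝ) → ℝ) : ℝ≥0∞ :=
  ∫⁻ x, ENNReal.ofReal ((Real.sqrt (f x) - Real.sqrt (g x))^2)

noncomputable def gv (v x : ℝ) : ℝ := Real.exp (-(x^2)/(2*v)) / Real.sqrt (2*Real.pi*v)

lemma gauss_eq_gv (x : ℝ) : gauss x = gv 1 x := by simp [gauss, gv]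

lemma gv_pos {v : ℝ} (hv : 0 < v) (x : ℝ) : 0 < gv v x := by unfold gv; positivity

lemma gv_cont (v : ℝ) : Continuous (gv v) := by unfold gv; fun_prop

lemma gv_integrable {v : ℝ} (hv : 0 < v) : Integrable (gv v) := by
  unfold gv
  have := (integrable_exp_neg_mul_sq (b := 1/(2*v)) (by positivity)).div_const (√(2*π*v))
  refine this.congr (Filter.Eventually.of_forall fun x => ?_)
  simp only
  congr 2; ring

lemma gv_integral {v : ℝ} (hv : 0 < v) : ∫ x, gv v x = 1 := by
  unfold gv
  rw [integral_div]
  have := integral_gaussian (1/(2*v))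
  have h2 : (fun x : ℝ => rexp (-(x^2)/(2*v))) = fun x => rexp (-(1/(2*v)) * x^2) := by
    funext x; congr 1; ring
  rw [h2, this]
  have : π / (1/(2*v)) = 2*π*v := by field_simp
  rw [this]
  exact div_self (by positivity)

lemma gv_one_le (x : ℝ) : gv 1 x ≤ 1 := by
  unfold gv
  rw [div_le_one (by positivity)]
  calc rexp (-(x^2)/(2*1)) ≤ 1 := by
        rw [Real.exp_le_one_iff]; nlinarith [sq_nonneg x]
    _ ≤ √(2*π*1) := by
        rw [Real.one_le_sqrt]; nlinarith [Real.pi_gt_three]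

lemma integrable_of_le_gv {v C : ℝ} (hv : 0 < v) {F : ℝ → ℝ} (hF : Continuous F)
    (h : ∀ x, |F x| ≤ C * gv v x) : Integrable F :=
  ((gv_integrable hv).const_mul C).mono' hF.aestronglyMeasurable
    (Filter.Eventually.of_forall fun x => by simpa using h x)

/-- Gaussian convolution. -/
lemma gv_conv {v : ℝ} (hv : 0 < v) (x : ℝ) : ∫ u, gv 1 (x-u) * gv v u = gv (1+v) x := by
  have key : ∀ u, gv 1 (x-u) * gv v u = gv (1+v) x * gv (v/(1+v)) (u - x * v/(1+v)) := by
    intro u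
    unfold gv
    rw [div_mul_div_comm, div_mul_div_comm, ← Real.exp_add, ← Real.exp_add,
      ← Real.sqrt_mul (by positivity), ← Real.sqrt_mul (by positivity)]
    congr 2
    · field_simp; ring
    · field_simp
  simp_rw [key]
  rw [integral_const_mul, integral_sub_right_eq_self (fun u => gv (v/(1+v)) u),
    gv_integral (by positivity), mul_one]

/-- Hermite polynomials. -/
noncomputable def Hm : ℕ → ℝ → ℝ
  | 0, _ => 1
  | 1, x => x
  | (k+2), x => x * Hm (k+1) x - (k+1) * Hm k x

lemma Hm_succ (k : ℕ) (x : ℝ) : Hm (k+1) x = x * Hm k x - k * Hm (k-1) x := by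
  cases k with
  | zero => simp [Hm]
  | succ k => simp [Hm]

lemma Hm_deriv (k : ℕ) (x : ℝ) : HasDerivAt (Hm k) (k * Hm (k-1) x) x := by
  induction k using Nat.twoStepInduction with
  | zero =>
    simp only [CharP.cast_eq_zero, zero_mul]
    have : Hm 0 = fun _ => 1 := by funext x; simp [Hm]
    rw [this]; exact hasDerivAt_const _ _
  | one =>
    have : Hm 1 = fun x => x := by funext x; simp [Hm]
    rw [this]; simpa [Hm] using hasDerivAt_id' x
  | more k h1 h2 =>
    have : Hm (k+2) = fun x => x * Hm (k+1) x - (k+1) * Hm k x := by funext x; simp [Hm]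
    rw [this]
    have h3 := ((hasDerivAt_id x).mul h2).sub (h1.const_mul ((k:ℝ)+1))
    refine (h3.congr_deriv ?_)
    have e := Hm_succ k x
    simp only [id, Nat.add_sub_cancel, show k + 2 - 1 = k + 1 from rfl]
    push_cast
    rw [e]; ring

lemma Hm_cont (k : ℕ) : Continuous (Hm k) :=
  continuous_iff_continuousAt.2 fun x => (Hm_deriv k x).continuousAt

lemma Hm_bound0 (k : ℕ) (x : ℝ) : |Hm k x| ≤ (|x| + √k)^k := by
  induction k using Nat.twoStepInduction with
  | zero => simp [Hm]
  | one => simp [Hm]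
  | more k h1 h2 =>
    simp only [Hm]
    set s := √((k+2 : ℕ):ℝ) with hs
    have hs2 : s^2 = k + 2 := by rw [hs, Real.sq_sqrt (by positivity)]; push_cast; ring
    have hs0 : 0 ≤ s := Real.sqrt_nonneg _
    have e1 : |Hm k x| ≤ (|x| + s)^k := h1.trans (by
      gcongr; rw [hs]; apply Real.sqrt_le_sqrt; push_cast; linarith)
    have e2 : |Hm (k+1) x| ≤ (|x| + s)^(k+1) := h2.trans (by
      gcongr; rw [hs]; apply Real.sqrt_le_sqrt; push_cast; linarith)
    have hP : 0 ≤ (|x|+s)^k := by positivity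
    calc |x * Hm (k+1) x - (k+1) * Hm k x| ≤ |x * Hm (k+1) x| + |(k+1) * Hm k x| := abs_sub _ _
      _ = |x| * |Hm (k+1) x| + (k+1) * |Hm k x| := by
          rw [abs_mul, abs_mul, abs_of_nonneg (by positivity : (0:ℝ) ≤ k+1)]
      _ ≤ |x| * (|x|+s)^(k+1) + (k+1) * (|x|+s)^k := by gcongr
      _ = (|x| * (|x|+s) + (k+1)) * (|x|+s)^k := by ring
      _ ≤ (|x|+s)^2 * (|x|+s)^k := by
          gcongr
          nlinarith [abs_nonneg x, mul_nonneg (abs_nonneg x) hs0]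
      _ = (|x|+s)^(k+2) := by ring

lemma Hm_bound (k : ℕ) (x : ℝ) :
    |Hm k x| ≤ rexp (3*k) * √(k.factorial : ℝ) * rexp (x^2/8) := by
  refine (Hm_bound0 k x).trans ?_
  rcases Nat.eq_zero_or_pos k with rfl | hk
  · simp; positivity
  have hk' : (0:ℝ) < k := by exact_mod_cast hk
  set s := √(k:ℝ) with hs
  have hs2 : s^2 = k := Real.sq_sqrt hk'.le
  have hs0 : 0 < s := Real.sqrt_pos.2 hk'
  have h1 : |x| + s ≤ s * rexp (|x|/s) := by
    have := Real.add_one_le_exp (|x|/s)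
    calc |x| + s = s * (|x|/s + 1) := by field_simp
      _ ≤ _ := by gcongr
  have h2 : s^k ≤ rexp k * √(k.factorial : ℝ) := by
    have h3 : (k:ℝ)^k ≤ rexp k * k.factorial := by
      have := Real.pow_div_factorial_le_exp (k:ℝ) hk'.le k
      rwa [div_le_iff₀ (by positivity)] at this
    have h4 : (s^k)^2 ≤ (rexp k * √(k.factorial : ℝ))^2 := by
      rw [mul_pow, Real.sq_sqrt (by positivity), ← pow_mul, mul_comm k 2, pow_mul, hs2]
      refine h3.trans ?_
      gcongr
      have : 1 ≤ rexp (k:ℝ) := Real.one_le_exp hk'.le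
      nlinarith
    exact le_of_sq_le_sq h4 (by positivity)
  calc (|x|+s)^k ≤ (s * rexp (|x|/s))^k := by gcongr
    _ = s^k * rexp (k * (|x|/s)) := by rw [mul_pow, ← Real.exp_nat_mul]
    _ ≤ (rexp k * √(k.factorial : ℝ)) * rexp (2*k + x^2/8) := by
        gcongr
        have : (k:ℝ) * (|x|/s) = s * |x| := by rw [← hs2]; field_simp
        rw [this]
        have := sq_abs x
        nlinarith [sq_nonneg (|x| - 4*s)]
    _ = _ := by
        rw [Real.exp_add, show (3*k:ℝ) = k + 2*k by ring, Real.exp_add]; ring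


lemma exp_mul_gv1 (u : ℝ) : rexp (u^2/4) * gv 1 u = √2 * gv 2 u := by
  unfold gv
  rw [show (2*π*2) = 2 * (2*π*1) by ring, Real.sqrt_mul (x := 2) (by norm_num), mul_div_assoc',
    ← Real.exp_add, mul_div_assoc']
  rw [mul_div_mul_left _ _ (by positivity)]
  congr 2; ring

lemma exp8_mul_gv1_le (u : ℝ) : rexp (u^2/8) * gv 1 u ≤ √2 * gv 2 u := by
  rw [← exp_mul_gv1]
  have := (gv_pos one_pos u).le
  gcongr
  nlinarith [sq_nonneg u]

lemma Hm_mul_integrable (i j : ℕ) : Integrable (fun u => Hm i u * Hm j u * gv 1 u) := by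
  refine integrable_of_le_gv (v := 2)
    (C := (rexp (3*i) * √(i.factorial : ℝ)) * (rexp (3*j) * √(j.factorial : ℝ)) * √2)
    two_pos (((Hm_cont i).mul (Hm_cont j)).mul (gv_cont 1)) fun u => ?_
  have hg := gv_pos one_pos u
  rw [abs_mul, abs_mul, abs_of_pos hg]
  calc |Hm i u| * |Hm j u| * gv 1 u
      ≤ (rexp (3*i) * √(i.factorial : ℝ) * rexp (u^2/8)) *
        (rexp (3*j) * √(j.factorial : ℝ) * rexp (u^2/8)) * gv 1 u := by
        gcongr <;> apply Hm_bound
    _ = (rexp (3*i) * √(i.factorial : ℝ)) * (rexp (3*j) * √(j.factorial : ℝ)) *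
        (rexp (u^2/4) * gv 1 u) := by
        rw [show u^2/4 = u^2/8 + u^2/8 by ring, Real.exp_add]; ring
    _ = _ := by rw [exp_mul_gv1]; ring

lemma gv1_deriv (u : ℝ) : HasDerivAt (gv 1) (-(u * gv 1 u)) u := by
  unfold gv
  have h : HasDerivAt (fun x : ℝ => -(x^2)/(2*1)) (-u) u := by
    have := ((hasDerivAt_pow 2 u).neg).div_const (2*1)
    refine this.congr_deriv ?_
    simp; ring
  refine (h.exp.div_const _).congr_deriv ?_
  ring

lemma Hmgv_deriv (k : ℕ) (u : ℝ) :
    HasDerivAt (fun u => Hm k u * gv 1 u) (-(Hm (k+1) u * gv 1 u)) u := by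
  refine ((Hm_deriv k u).mul (gv1_deriv u)).congr_deriv ?_
  rw [Hm_succ]; ring

lemma Hm_orth_step (i j : ℕ) :
    ∫ u, Hm (i+1) u * Hm j u * gv 1 u = j * ∫ u, Hm i u * Hm (j-1) u * gv 1 u := by
  have hd : ∀ u, HasDerivAt (fun u => Hm j u * (Hm i u * gv 1 u))
      (j * (Hm i u * Hm (j-1) u * gv 1 u) - Hm (i+1) u * Hm j u * gv 1 u) u := by
    intro u
    refine ((Hm_deriv j u).mul (Hmgv_deriv i u)).congr_deriv ?_
    ring
  have h0 := integral_eq_zero_of_hasDerivAt_of_integrable hd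
    (((Hm_mul_integrable i (j-1)).const_mul _).sub (Hm_mul_integrable (i+1) j))
    ((Hm_mul_integrable j i).congr (Filter.Eventually.of_forall fun u => by simp only; ring))
  rw [integral_sub ((Hm_mul_integrable i (j-1)).const_mul _) (Hm_mul_integrable (i+1) j),
    integral_const_mul] at h0
  linarith

lemma Hm_orth (i j : ℕ) :
    ∫ u, Hm i u * Hm j u * gv 1 u = if i = j then (i.factorial : ℝ) else 0 := by
  induction i generalizing j with
  | zero =>
    cases j with
    | zero => simpa [Hm] using gv_integral one_pos
    | succ j =>
      have := Hm_orth_step j 0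
      simp only [CharP.cast_eq_zero, zero_mul] at this
      simp only [(Nat.succ_ne_zero j).symm, if_false]
      rw [← this]; congr 1; funext u; ring
  | succ i ih =>
    rw [Hm_orth_step]
    cases j with
    | zero => simp
    | succ j =>
      simp only [Nat.add_sub_cancel, ih j, Nat.factorial_succ]
      by_cases h : i = j
      · subst h; simp
      · simp [h]

lemma conv_integrable (x : ℝ) (k : ℕ) :
    Integrable (fun u => gv 1 (x-u) * (Hm k u * gv 1 u)) := by
  refine (Hm_mul_integrable k 0).mono
    ((((gv_cont 1).comp (continuous_const.sub continuous_id)).mul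
      ((Hm_cont k).mul (gv_cont 1))).aestronglyMeasurable)
    (Filter.Eventually.of_forall fun u => ?_)
  simp only [norm_mul, Real.norm_eq_abs, Hm, mul_one]
  have h1 := gv_one_le (x-u)
  rw [abs_of_pos (gv_pos one_pos (x-u))]
  exact mul_le_of_le_one_left (by positivity) h1

lemma conv_step (x : ℝ) (k : ℕ) :
    2 * ∫ u, gv 1 (x-u) * (Hm (k+1) u * gv 1 u) =
      x * (∫ u, gv 1 (x-u) * (Hm k u * gv 1 u)) -
        k * ∫ u, gv 1 (x-u) * (Hm (k-1) u * gv 1 u) := by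
  have hd : ∀ u, HasDerivAt (fun u => gv 1 (x-u) * (Hm k u * gv 1 u))
      (x * (gv 1 (x-u) * (Hm k u * gv 1 u)) - k * (gv 1 (x-u) * (Hm (k-1) u * gv 1 u))
        - 2 * (gv 1 (x-u) * (Hm (k+1) u * gv 1 u))) u := by
    intro u
    have h1 : HasDerivAt (fun u => gv 1 (x-u)) ((x-u) * gv 1 (x-u)) u := by
      have := (gv1_deriv (x-u)).comp u ((hasDerivAt_id u).const_sub x)
      refine this.congr_deriv ?_
      ring
    refine (h1.mul (Hmgv_deriv k u)).congr_deriv ?_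
    rw [Hm_succ]; ring
  have i1 := (conv_integrable x k).const_mul x
  have i2 := (conv_integrable x (k-1)).const_mul (k:ℝ)
  have i3 := (conv_integrable x (k+1)).const_mul 2
  have h0 := integral_eq_zero_of_hasDerivAt_of_integrable hd ((i1.sub i2).sub i3)
    (conv_integrable x k)
  have e := integral_sub (i1.sub i2) i3
  simp only [Pi.sub_apply] at e
  rw [e, integral_sub i1 i2, integral_const_mul, integral_const_mul, integral_const_mul] at h0
  linarith

lemma conv_Hm (x : ℝ) (k : ℕ) :
    (√2)^k * ∫ u, gv 1 (x-u) * (Hm k u * gv 1 u) = Hm k (x/√2) * gv 2 x := by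
  have h2 : √2 * √2 = (2:ℝ) := Real.mul_self_sqrt (by norm_num)
  have h2' : √2 ≠ (0:ℝ) := by positivity
  induction k using Nat.twoStepInduction with
  | zero =>
    have := gv_conv one_pos x
    norm_num at this
    simpa [Hm] using this
  | one =>
    have h := conv_step x 0
    have := gv_conv one_pos x
    norm_num at this
    simp only [Hm, CharP.cast_eq_zero, zero_mul, sub_zero, one_mul, this] at h
    simp only [Hm, pow_one]
    have h' : (√2 * √2) * ∫ u, gv 1 (x-u) * (Hm 1 u * gv 1 u) = x * gv 2 x := by
      rw [h2]; simpa [Hm] using h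
    simp only [Hm] at h'
    rw [div_mul_eq_mul_div, eq_div_iff h2', ← h']
    ring
  | more k h1 h2i =>
    have h := conv_step x (k+1)
    simp only [Nat.add_sub_cancel] at h
    rw [show Hm (k+2) (x/√2) = (x/√2) * Hm (k+1) (x/√2) - (k+1) * Hm k (x/√2) by simp [Hm]]
    rw [sub_mul, mul_assoc, mul_assoc, ← h1, ← h2i]
    have e : (√2)^(k+2) * ∫ u, gv 1 (x-u) * (Hm (k+2) u * gv 1 u) =
      (√2)^k * (2 * ∫ u, gv 1 (x-u) * (Hm (k+2) u * gv 1 u)) := by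
      rw [pow_add, pow_two, h2]; ring
    rw [e, h]
    push_cast
    rw [pow_succ]
    field_simp


noncomputable def wk (k : ℕ) (u : ℝ) : ℝ := (√2)^k / √(k.factorial : ℝ) * (Hm k u * gv 1 u)
noncomputable def ek (k : ℕ) (x : ℝ) : ℝ := Hm k (x/√2) / √(k.factorial : ℝ)

lemma wk_cont (k : ℕ) : Continuous (wk k) :=
  continuous_const.mul ((Hm_cont k).mul (gv_cont 1))

lemma ek_cont (k : ℕ) : Continuous (ek k) :=
  ((Hm_cont k).comp (continuous_id.div_const _)).div_const _

lemma ek_zero (x : ℝ) : ek 0 x = 1 := by simp [ek, Hm]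

lemma wk_bound {k : ℕ} (hk : 1 ≤ k) (u : ℝ) : |wk k u| ≤ rexp (7*k) * gv 2 u := by
  have hg := gv_pos one_pos u
  have hg2 := gv_pos two_pos u
  have hf : 0 < √(k.factorial : ℝ) := by positivity
  unfold wk
  rw [abs_mul, abs_mul, abs_of_pos hg, abs_of_pos (by positivity)]
  have hpow : (√2)^k * √2 ≤ rexp k := by
    calc (√2)^k * √2 = (√2)^(k+1) := by ring
      _ ≤ (√2)^(2*k) := pow_le_pow_right₀ (by rw [Real.one_le_sqrt]; norm_num) (by omega)
      _ = 2^k := by rw [pow_mul, Real.sq_sqrt (by norm_num)]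
      _ ≤ (rexp 1)^k := by gcongr; linarith [Real.add_one_le_exp (1:ℝ)]
      _ = rexp k := by rw [← Real.exp_nat_mul, mul_one]
  calc (√2)^k / √(k.factorial : ℝ) * (|Hm k u| * gv 1 u)
      ≤ (√2)^k / √(k.factorial : ℝ) *
        ((rexp (3*k) * √(k.factorial : ℝ) * rexp (u^2/8)) * gv 1 u) := by
        gcongr; apply Hm_bound
    _ = (√2)^k * rexp (3*k) * (rexp (u^2/8) * gv 1 u) := by field_simp
    _ ≤ (√2)^k * rexp (3*k) * (√2 * gv 2 u) := by
        exact mul_le_mul_of_nonneg_left (exp8_mul_gv1_le u) (by positivity)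
    _ = ((√2)^k * √2) * rexp (3*k) * gv 2 u := by ring
    _ ≤ rexp k * rexp (3*k) * gv 2 u := by gcongr
    _ ≤ rexp (7*k) * gv 2 u := by
        rw [← Real.exp_add]
        gcongr
        have : (0:ℝ) ≤ k := by positivity
        linarith

lemma wk_integrable (k : ℕ) : Integrable (wk k) := by
  have := (Hm_mul_integrable k 0).const_mul ((√2)^k / √(k.factorial : ℝ))
  refine this.congr (Filter.Eventually.of_forall fun u => ?_)
  simp [wk, Hm]

lemma wk_integral {k : ℕ} (hk : 1 ≤ k) : ∫ u, wk k u = 0 := by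
  unfold wk
  rw [integral_const_mul]
  have := Hm_orth k 0
  rw [if_neg (by omega)] at this
  simp only [Hm, mul_one] at this
  rw [this, mul_zero]

lemma wk_conv_integrable (x : ℝ) (k : ℕ) : Integrable (fun u => gauss (x-u) * wk k u) := by
  have := (conv_integrable x k).const_mul ((√2)^k / √(k.factorial : ℝ))
  refine this.congr (Filter.Eventually.of_forall fun u => ?_)
  simp only [wk, gauss_eq_gv]; ring

lemma wk_conv (x : ℝ) (k : ℕ) : ∫ u, gauss (x-u) * wk k u = ek k x * gv 2 x := by
  have h : (fun u => gauss (x-u) * wk k u) = fun u =>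
      (1/√(k.factorial : ℝ)) * ((√2)^k * (gv 1 (x-u) * (Hm k u * gv 1 u))) := by
    funext u; simp only [wk, gauss_eq_gv]; ring
  rw [h, integral_const_mul, integral_const_mul, conv_Hm]
  unfold ek; ring

lemma gv_conv_integrable {v : ℝ} (hv : 0 < v) (x : ℝ) :
    Integrable (fun u => gauss (x-u) * gv v u) := by
  simp only [gauss_eq_gv]
  refine (gv_integrable hv).mono
    ((((gv_cont 1).comp (continuous_const.sub continuous_id)).mul
      (gv_cont v)).aestronglyMeasurable)
    (Filter.Eventually.of_forall fun u => ?_)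
  simp only [norm_mul, Real.norm_eq_abs]
  rw [abs_of_pos (gv_pos one_pos (x-u))]
  exact mul_le_of_le_one_left (by positivity) (gv_one_le _)

lemma gv_conv' {v : ℝ} (hv : 0 < v) (x : ℝ) : ∫ u, gauss (x-u) * gv v u = gv (1+v) x := by
  simp only [gauss_eq_gv]; exact gv_conv hv x

lemma gv2_eq (x : ℝ) : gv 2 x = gv 1 (x/√2) / √2 := by
  unfold gv
  rw [div_div, ← Real.sqrt_mul (by positivity), div_pow, Real.sq_sqrt (by norm_num)]
  congr 2
  · ring
  · ring

lemma ek_orth (i j : ℕ) : ∫ x, ek i x * ek j x * gv 2 x = if i = j then 1 else 0 := by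
  have h : (fun x => ek i x * ek j x * gv 2 x) = fun x =>
      (1/(√(i.factorial : ℝ) * √(j.factorial : ℝ) * √2)) *
        ((fun u => Hm i u * Hm j u * gv 1 u) (x/√2)) := by
    funext x; simp only [ek, gv2_eq]; ring
  rw [h, integral_const_mul,
    Measure.integral_comp_div (fun u => Hm i u * Hm j u * gv 1 u) (√2), Hm_orth, smul_eq_mul,
    abs_of_pos (by positivity)]
  by_cases hij : i = j
  · subst hij
    simp only [if_true]
    rw [Real.mul_self_sqrt (by positivity)]
    field_simp
  · simp [hij]

lemma ek_bound (k : ℕ) (x : ℝ) : |ek k x| ≤ rexp (3*k) * rexp (x^2/16) := by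
  unfold ek
  rw [abs_div, abs_of_pos (a := √(k.factorial : ℝ)) (by positivity), div_le_iff₀ (by positivity)]
  refine (Hm_bound k _).trans (le_of_eq ?_)
  rw [div_pow, Real.sq_sqrt (by norm_num), show x^2/2/8 = x^2/16 by ring]; ring

lemma exp_mul_gv3 (x : ℝ) : rexp (x^2/8) * gv 3 x = 2 * gv 12 x := by
  unfold gv
  have : √(2*π*12) = 2 * √(2*π*3) := by
    rw [show 2*π*12 = 2^2 * (2*π*3) by ring, Real.sqrt_mul (by norm_num), Real.sqrt_sq (by norm_num)]
  rw [this, mul_div_assoc', ← Real.exp_add, mul_div_assoc', mul_div_mul_left _ _ (by norm_num)]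
  congr 2; ring

lemma gv2_le_gv3 (x : ℝ) : gv 2 x ≤ 2 * gv 3 x := by
  unfold gv
  rw [mul_div_assoc', div_le_div_iff₀ (by positivity) (by positivity)]
  have h1 : √(2*π*3) ≤ 2 * √(2*π*2) := by
    rw [show (2:ℝ) * √(2*π*2) = √(2^2) * √(2*π*2) by rw [Real.sqrt_sq (by norm_num)],
      ← Real.sqrt_mul (by norm_num)]
    apply Real.sqrt_le_sqrt; nlinarith [Real.pi_pos]
  have h2 : rexp (-(x^2)/(2*2)) ≤ rexp (-(x^2)/(2*3)) := by
    apply Real.exp_le_exp.2; nlinarith [sq_nonneg x]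
  calc _ ≤ rexp (-(x^2)/(2*3)) * (2 * √(2*π*2)) := by gcongr
    _ = _ := by ring

lemma ek_mul3_bound (i j : ℕ) (x : ℝ) :
    |ek i x * ek j x * gv 3 x| ≤ rexp (3*i) * rexp (3*j) * 2 * gv 12 x := by
  have hg := gv_pos three_pos x
  rw [abs_mul, abs_mul, abs_of_pos hg]
  calc |ek i x| * |ek j x| * gv 3 x
      ≤ (rexp (3*i) * rexp (x^2/16)) * (rexp (3*j) * rexp (x^2/16)) * gv 3 x := by
        gcongr <;> apply ek_bound
    _ = rexp (3*i) * rexp (3*j) * (rexp (x^2/8) * gv 3 x) := by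
        rw [show x^2/8 = x^2/16 + x^2/16 by ring, Real.exp_add]; ring
    _ = _ := by rw [exp_mul_gv3]; ring

lemma ek_mul3_integrable (i j : ℕ) : Integrable (fun x => ek i x * ek j x * gv 3 x) :=
  integrable_of_le_gv (v := 12) (by norm_num)
    (((ek_cont i).mul (ek_cont j)).mul (gv_cont 3)) (ek_mul3_bound i j)

lemma ek_mul2_integrable (i j : ℕ) : Integrable (fun x => ek i x * ek j x * gv 2 x) := by
  refine ((ek_mul3_integrable i j).const_mul 2).mono
    (((ek_cont i).mul (ek_cont j)).mul (gv_cont 2)).aestronglyMeasurable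
    (Filter.Eventually.of_forall fun x => ?_)
  simp only [norm_mul, Real.norm_eq_abs, abs_of_pos (gv_pos two_pos x),
    abs_of_pos (gv_pos three_pos x), abs_two]
  have := gv2_le_gv3 x
  calc |ek i x| * |ek j x| * gv 2 x ≤ |ek i x| * |ek j x| * (2 * gv 3 x) := by gcongr
    _ = _ := by ring

lemma ek_sq_gv3 {k : ℕ} (hk : 1 ≤ k) : ∫ x, ek k x * ek k x * gv 3 x ≤ rexp (7*k) := by
  have hk' : (1:ℝ) ≤ k := by exact_mod_cast hk
  calc ∫ x, ek k x * ek k x * gv 3 x ≤ ∫ x, rexp (3*k) * rexp (3*k) * 2 * gv 12 x := by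
        refine integral_mono (ek_mul3_integrable k k)
          ((gv_integrable (by norm_num)).const_mul _) fun x => ?_
        exact (le_abs_self _).trans (ek_mul3_bound k k x)
    _ = rexp (3*k) * rexp (3*k) * 2 := by
        rw [integral_const_mul, gv_integral (by norm_num), mul_one]
    _ ≤ rexp (3*k) * rexp (3*k) * rexp k := by
        gcongr; linarith [Real.add_one_le_exp (k:ℝ)]
    _ = rexp (7*k) := by rw [← Real.exp_add, ← Real.exp_add]; congr 1; ring


noncomputable def Gv (d : ℕ) (v : ℝ) (x : Fin d → ℝ) : ℝ := ∏ i, gv v (x i)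
noncomputable def WJ {d K : ℕ} (j : Fin d → Fin K) (u : Fin d → ℝ) : ℝ := ∏ i, wk (j i + 1) (u i)
noncomputable def EJ {d K : ℕ} (j : Fin d → Fin K) (x : Fin d → ℝ) : ℝ := ∏ i, ek (j i + 1) (x i)
noncomputable def gP {d : ℕ} (x u : Fin d → ℝ) : ℝ := ∏ i, gauss (x i - u i)

section
variable {d K : ℕ}

lemma gP_nonneg (x u : Fin d → ℝ) : 0 ≤ gP x u :=
  Finset.prod_nonneg fun _ _ => by rw [gauss_eq_gv]; exact (gv_pos one_pos _).le

lemma Gv_pos {v : ℝ} (hv : 0 < v) (x : Fin d → ℝ) : 0 < Gv d v x :=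
  Finset.prod_pos fun _ _ => gv_pos hv _

lemma Gv_cont (v : ℝ) : Continuous (Gv d v) :=
  continuous_finsetProd _ fun i _ => (gv_cont v).comp (continuous_apply i)

lemma WJ_cont (j : Fin d → Fin K) : Continuous (WJ j) :=
  continuous_finsetProd _ fun i _ => (wk_cont _).comp (continuous_apply i)

lemma EJ_cont (j : Fin d → Fin K) : Continuous (EJ j) :=
  continuous_finsetProd _ fun i _ => (ek_cont _).comp (continuous_apply i)

lemma Gv_integrable {v : ℝ} (hv : 0 < v) : Integrable (Gv d v) :=
  Integrable.fintype_prod (f := fun _ : Fin d => gv v) (μ := fun _ => volume)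
    fun _ => gv_integrable hv

lemma Gv_integral {v : ℝ} (hv : 0 < v) : ∫ x, Gv d v x = 1 := by
  have := integral_fintype_prod_volume_eq_prod (fun _ : Fin d => gv v)
  unfold Gv
  rw [this]; simp [gv_integral hv]

lemma idx_le (j : Fin d → Fin K) (i : Fin d) : (((j i : ℕ) + 1 : ℕ) : ℝ) ≤ K := by
  exact_mod_cast (j i).2

lemma exp_prod_le (j : Fin d → Fin K) :
    ∏ i, rexp (7 * (((j i : ℕ) + 1 : ℕ) : ℝ)) ≤ rexp (7*K*d) := by
  calc ∏ i, rexp (7 * (((j i : ℕ) + 1 : ℕ) : ℝ)) ≤ ∏ i : Fin d, rexp (7*K) := by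
        refine Finset.prod_le_prod (fun i _ => (Real.exp_pos _).le) fun i _ => ?_
        have := idx_le j i
        gcongr
    _ = rexp (7*K*d) := by
        rw [Finset.prod_const, Finset.card_univ, Fintype.card_fin, ← Real.exp_nat_mul]
        congr 1; ring

lemma WJ_bound (j : Fin d → Fin K) (u : Fin d → ℝ) : |WJ j u| ≤ rexp (7*K*d) * Gv d 2 u := by
  unfold WJ
  rw [Finset.abs_prod]
  calc ∏ i, |wk (j i + 1) (u i)|
      ≤ ∏ i, (rexp (7 * (((j i : ℕ) + 1 : ℕ) : ℝ)) * gv 2 (u i)) :=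
        Finset.prod_le_prod (fun i _ => abs_nonneg _) fun i _ => wk_bound (by omega) _
    _ = (∏ i, rexp (7 * (((j i : ℕ) + 1 : ℕ) : ℝ))) * Gv d 2 u := by
        rw [Finset.prod_mul_distrib]; rfl
    _ ≤ _ := by
        have := (Gv_pos two_pos u).le
        gcongr
        exact exp_prod_le j

lemma WJ_integrable (j : Fin d → Fin K) : Integrable (WJ j) :=
  Integrable.fintype_prod (f := fun i : Fin d => wk (j i + 1)) (μ := fun _ => volume)
    fun _ => wk_integrable _

lemma WJ_integral (hd : 1 ≤ d) (j : Fin d → Fin K) : ∫ u, WJ j u = 0 := by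
  have := integral_fintype_prod_volume_eq_prod (fun i : Fin d => wk (j i + 1))
  unfold WJ
  rw [this]
  exact Finset.prod_eq_zero (Finset.mem_univ (⟨0, hd⟩ : Fin d)) (wk_integral (by omega))

lemma WJ_conv_integrable (x : Fin d → ℝ) (j : Fin d → Fin K) :
    Integrable (fun u => gP x u * WJ j u) := by
  have := Integrable.fintype_prod
    (f := fun (i : Fin d) (u : ℝ) => gauss (x i - u) * wk (j i + 1) u) (μ := fun _ => volume)
    fun _ => wk_conv_integrable _ _
  simp only [Finset.prod_mul_distrib] at this
  exact this

lemma WJ_conv (x : Fin d → ℝ) (j : Fin d → Fin K) :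
    ∫ u, gP x u * WJ j u = EJ j x * Gv d 2 x := by
  have := integral_fintype_prod_volume_eq_prod
    (fun (i : Fin d) (u : ℝ) => gauss (x i - u) * wk (j i + 1) u)
  simp only [wk_conv, Finset.prod_mul_distrib] at this
  exact this

lemma Gv_conv_integrable {v : ℝ} (hv : 0 < v) (x : Fin d → ℝ) :
    Integrable (fun u => gP x u * Gv d v u) := by
  have := Integrable.fintype_prod
    (f := fun (i : Fin d) (u : ℝ) => gauss (x i - u) * gv v u) (μ := fun _ => volume)
    fun _ => gv_conv_integrable hv _
  simp only [Finset.prod_mul_distrib] at this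
  exact this

lemma Gv_conv {v : ℝ} (hv : 0 < v) (x : Fin d → ℝ) :
    ∫ u, gP x u * Gv d v u = Gv d (1+v) x := by
  have := integral_fintype_prod_volume_eq_prod
    (fun (i : Fin d) (u : ℝ) => gauss (x i - u) * gv v u)
  simp only [gv_conv' hv, Finset.prod_mul_distrib] at this
  exact this

lemma EJ_mul2_integrable (i j : Fin d → Fin K) :
    Integrable (fun x => EJ i x * EJ j x * Gv d 2 x) := by
  have := Integrable.fintype_prod
    (f := fun (l : Fin d) (x : ℝ) => ek (i l + 1) x * ek (j l + 1) x * gv 2 x)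
    (μ := fun _ => volume) fun _ => ek_mul2_integrable _ _
  simp only [Finset.prod_mul_distrib] at this
  exact this

lemma EJ_mul3_integrable (i j : Fin d → Fin K) :
    Integrable (fun x => EJ i x * EJ j x * Gv d 3 x) := by
  have := Integrable.fintype_prod
    (f := fun (l : Fin d) (x : ℝ) => ek (i l + 1) x * ek (j l + 1) x * gv 3 x)
    (μ := fun _ => volume) fun _ => ek_mul3_integrable _ _
  simp only [Finset.prod_mul_distrib] at this
  exact this

lemma EJ_orth (i j : Fin d → Fin K) :
    ∫ x, EJ i x * EJ j x * Gv d 2 x = if i = j then 1 else 0 := by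
  have := integral_fintype_prod_volume_eq_prod
    (fun (l : Fin d) (x : ℝ) => ek (i l + 1) x * ek (j l + 1) x * gv 2 x)
  simp only [ek_orth, Finset.prod_mul_distrib] at this
  refine Eq.trans this ?_
  by_cases h : i = j
  · subst h; simp
  · rw [if_neg h]
    obtain ⟨l, hl⟩ := Function.ne_iff.1 h
    refine Finset.prod_eq_zero (Finset.mem_univ l) (if_neg ?_)
    intro h'
    exact hl (Fin.ext (by omega))

lemma EJ_sq3 (j : Fin d → Fin K) : ∫ x, EJ j x * EJ j x * Gv d 3 x ≤ rexp (7*K*d) := by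
  have := integral_fintype_prod_volume_eq_prod
    (fun (l : Fin d) (x : ℝ) => ek (j l + 1) x * ek (j l + 1) x * gv 3 x)
  simp only [Finset.prod_mul_distrib] at this
  refine (le_of_eq this).trans (le_trans ?_ (exp_prod_le j))
  refine Finset.prod_le_prod (fun i _ => ?_) fun i _ => ek_sq_gv3 (by omega)
  refine integral_nonneg fun x => ?_
  have := (gv_pos three_pos x).le
  exact mul_nonneg (mul_self_nonneg _) this

lemma EJ_integrable (j : Fin d → Fin K) : Integrable (fun x => EJ j x * Gv d 2 x) := by
  have := Integrable.fintype_prod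
    (f := fun (l : Fin d) (x : ℝ) => ek (j l + 1) x * ek 0 x * gv 2 x)
    (μ := fun _ => volume) fun _ => ek_mul2_integrable _ _
  simp only [Finset.prod_mul_distrib, ek_zero, mul_one] at this
  exact this

lemma EJ_integral (hd : 1 ≤ d) (j : Fin d → Fin K) : ∫ x, EJ j x * Gv d 2 x = 0 := by
  have := integral_fintype_prod_volume_eq_prod
    (fun (l : Fin d) (x : ℝ) => ek (j l + 1) x * ek 0 x * gv 2 x)
  simp only [ek_orth, Finset.prod_mul_distrib] at this
  simp only [ek_zero, Finset.prod_const_one, mul_one] at this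
  refine Eq.trans this ?_
  exact Finset.prod_eq_zero (Finset.mem_univ (⟨0, hd⟩ : Fin d)) (if_neg (by omega))

/-- Perturbed mixing density. -/
noncomputable def gA (d K : ℕ) (η ε : ℝ) (a : (Fin d → Fin K) → ℝ) (u : Fin d → ℝ) : ℝ :=
  (1-η) * Gv d 1 u + η * Gv d 2 u + ε * ∑ j, a j * WJ j u

/-- Perturbed mixture density. -/
noncomputable def fA (d K : ℕ) (η ε : ℝ) (a : (Fin d → Fin K) → ℝ) (x : Fin d → ℝ) : ℝ :=
  (1-η) * Gv d 2 x + η * Gv d 3 x + ε * ∑ j, a j * (EJ j x * Gv d 2 x)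

lemma int_comb {ι : Type*} [Fintype ι] {A B : (Fin d → ℝ) → ℝ} {C : ι → (Fin d → ℝ) → ℝ}
    (c1 c2 ε : ℝ) (a : ι → ℝ) (hA : Integrable A) (hB : Integrable B)
    (hC : ∀ j, Integrable (C j)) :
    ∫ u, (c1 * A u + c2 * B u + ε * ∑ j, a j * C j u) =
      c1 * (∫ u, A u) + c2 * (∫ u, B u) + ε * ∑ j, a j * ∫ u, C j u := by
  have i1 := hA.const_mul c1
  have i2 := hB.const_mul c2
  have i3 := fun j => (hC j).const_mul (a j)
  have i4 := (integrable_finsetSum Finset.univ fun j _ => i3 j).const_mul ε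
  have i5 : Integrable (fun u => c1 * A u + c2 * B u) := i1.add i2
  rw [integral_add i5 i4, integral_add i1 i2, integral_const_mul, integral_const_mul,
    integral_const_mul, integral_finsetSum _ fun j _ => i3 j]
  simp only [integral_const_mul]

lemma gA_cont (η ε : ℝ) (a : (Fin d → Fin K) → ℝ) : Continuous (gA d K η ε a) :=
  (((Gv_cont 1).const_mul _).add ((Gv_cont 2).const_mul _)).add
    ((continuous_finsetSum _ fun j _ => (WJ_cont j).const_mul _).const_mul _)

lemma fA_cont (η ε : ℝ) (a : (Fin d → Fin K) → ℝ) : Continuous (fA d K η ε a) :=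
  (((Gv_cont 2).const_mul _).add ((Gv_cont 3).const_mul _)).add
    ((continuous_finsetSum _ fun j _ => ((EJ_cont j).mul (Gv_cont 2)).const_mul _).const_mul _)

lemma gA_integrable (η ε : ℝ) (a : (Fin d → Fin K) → ℝ) : Integrable (gA d K η ε a) :=
  (((Gv_integrable one_pos).const_mul _).add ((Gv_integrable two_pos).const_mul _)).add
    ((integrable_finsetSum _ fun j _ => (WJ_integrable j).const_mul _).const_mul _)

lemma fA_integrable (η ε : ℝ) (a : (Fin d → Fin K) → ℝ) : Integrable (fA d K η ε a) :=
  (((Gv_integrable two_pos).const_mul _).add ((Gv_integrable three_pos).const_mul _)).add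
    ((integrable_finsetSum _ fun j _ => (EJ_integrable j).const_mul _).const_mul _)

lemma gA_integral (hd : 1 ≤ d) (η ε : ℝ) (a : (Fin d → Fin K) → ℝ) :
    ∫ u, gA d K η ε a u = 1 := by
  unfold gA
  rw [int_comb _ _ _ _ (Gv_integrable one_pos) (Gv_integrable two_pos) WJ_integrable]
  simp [WJ_integral hd, Gv_integral]

lemma fA_integral (hd : 1 ≤ d) (η ε : ℝ) (a : (Fin d → Fin K) → ℝ) :
    ∫ u, fA d K η ε a u = 1 := by
  unfold fA
  rw [int_comb _ _ _ _ (Gv_integrable two_pos) (Gv_integrable three_pos) EJ_integrable]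
  simp [EJ_integral hd, Gv_integral]

lemma gA_conv_integrable (η ε : ℝ) (a : (Fin d → Fin K) → ℝ) (x : Fin d → ℝ) :
    Integrable (fun u => gP x u * gA d K η ε a u) := by
  have := (((Gv_conv_integrable one_pos x).const_mul (1-η)).add
    ((Gv_conv_integrable two_pos x).const_mul η)).add
    ((integrable_finsetSum Finset.univ fun j _ =>
      (WJ_conv_integrable x j).const_mul (a j)).const_mul ε)
  refine this.congr (Filter.Eventually.of_forall fun u => ?_)
  simp only [gA, Pi.add_apply, mul_add, Finset.mul_sum]
  congr 1
  · ring
  · exact Finset.sum_congr rfl fun j _ => by ring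

lemma gA_conv (η ε : ℝ) (a : (Fin d → Fin K) → ℝ) (x : Fin d → ℝ) :
    ∫ u, gP x u * gA d K η ε a u = fA d K η ε a x := by
  have e : (fun u => gP x u * gA d K η ε a u) = fun u =>
      ((1-η) * (gP x u * Gv d 1 u) + η * (gP x u * Gv d 2 u)) +
        ε * ∑ j, a j * (gP x u * WJ j u) := by
    funext u
    simp only [gA, mul_add, Finset.mul_sum]
    congr 1
    · ring
    · exact Finset.sum_congr rfl fun j _ => by ring
  rw [e, int_comb _ _ _ _ (Gv_conv_integrable one_pos x) (Gv_conv_integrable two_pos x)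
    (WJ_conv_integrable x)]
  simp only [WJ_conv, Gv_conv one_pos, Gv_conv two_pos, fA]
  norm_num

lemma pert_bound {η ε : ℝ} (hε : 0 ≤ ε) (hM : ε * (K^d * rexp (7*K*d)) ≤ η/2)
    {a : (Fin d → Fin K) → ℝ} (ha : ∀ j, |a j| ≤ 1) (u : Fin d → ℝ) :
    |ε * ∑ j, a j * WJ j u| ≤ η/2 * Gv d 2 u := by
  have hg := Gv_pos two_pos u
  rw [abs_mul, abs_of_nonneg hε]
  calc ε * |∑ j, a j * WJ j u| ≤ ε * ∑ j : Fin d → Fin K, (rexp (7*K*d) * Gv d 2 u) := by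
        gcongr
        refine (Finset.abs_sum_le_sum_abs _ _).trans (Finset.sum_le_sum fun j _ => ?_)
        rw [abs_mul]
        exact (mul_le_of_le_one_left (abs_nonneg _) (ha j)).trans (WJ_bound j u)
    _ = ε * (K^d * rexp (7*K*d)) * Gv d 2 u := by
        simp; ring
    _ ≤ _ := by gcongr

lemma gA_lower {η ε : ℝ} (hη : 0 ≤ η) (hη1 : η ≤ 1)
    (hε : 0 ≤ ε) (hM : ε * (K^d * rexp (7*K*d)) ≤ η/2)
    {a : (Fin d → Fin K) → ℝ} (ha : ∀ j, |a j| ≤ 1) (u : Fin d → ℝ) :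
    1/2 * gA d K η ε 0 u ≤ gA d K η ε a u := by
  have h := abs_le.1 (pert_bound hε hM ha u)
  have h1 := Gv_pos one_pos u
  have : 0 ≤ (1-η) * Gv d 1 u := mul_nonneg (by linarith) h1.le
  simp only [gA, Pi.zero_apply, zero_mul, Finset.sum_const_zero, mul_zero]
  linarith [h.1]

lemma gA_upper {η ε : ℝ} (hη : 0 ≤ η) (hη1 : η ≤ 1)
    (hε : 0 ≤ ε) (hM : ε * (K^d * rexp (7*K*d)) ≤ η/2)
    {a : (Fin d → Fin K) → ℝ} (ha : ∀ j, |a j| ≤ 1) (u : Fin d → ℝ) :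
    gA d K η ε a u ≤ 2 * gA d K η ε 0 u := by
  have h := abs_le.1 (pert_bound hε hM ha u)
  have h1 := Gv_pos one_pos u
  have h2 := Gv_pos two_pos u
  have : 0 ≤ (1-η) * Gv d 1 u := mul_nonneg (by linarith) h1.le
  have : 0 ≤ η * Gv d 2 u := mul_nonneg hη h2.le
  simp only [gA, Pi.zero_apply, zero_mul, Finset.sum_const_zero, mul_zero]
  linarith [h.2]

lemma gA_nonneg {η ε : ℝ} (hη : 0 ≤ η) (hη1 : η ≤ 1)
    (hε : 0 ≤ ε) (hM : ε * (K^d * rexp (7*K*d)) ≤ η/2)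
    {a : (Fin d → Fin K) → ℝ} (ha : ∀ j, |a j| ≤ 1) (u : Fin d → ℝ) :
    0 ≤ gA d K η ε a u := by
  refine le_trans ?_ (gA_lower hη hη1 hε hM ha u)
  have h1 := Gv_pos one_pos u
  have h2 := Gv_pos two_pos u
  have : 0 ≤ (1-η) * Gv d 1 u := mul_nonneg (by linarith) h1.le
  simp only [gA, Pi.zero_apply, zero_mul, Finset.sum_const_zero, mul_zero]
  positivity

lemma fA_lower {η ε : ℝ} (hη : 0 ≤ η) (hη1 : η ≤ 1/2)
    (hε : 0 ≤ ε) (hM : ε * (K^d * rexp (7*K*d)) ≤ η/2)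
    {a : (Fin d → Fin K) → ℝ} (ha : ∀ j, |a j| ≤ 1) (x : Fin d → ℝ) :
    1/4 * Gv d 2 x ≤ fA d K η ε a x := by
  have h : 1/2 * fA d K η ε 0 x ≤ fA d K η ε a x := by
    rw [← gA_conv, ← gA_conv, ← integral_const_mul]
    refine integral_mono ((gA_conv_integrable _ _ _ x).const_mul _) (gA_conv_integrable _ _ _ x)
      fun u => ?_
    have := mul_le_mul_of_nonneg_left (gA_lower hη (by linarith) hε hM ha u) (gP_nonneg x u)
    simp only; linarith
  refine le_trans ?_ h
  have h2 := Gv_pos two_pos x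
  have h3 := Gv_pos three_pos x
  have : 0 ≤ η * Gv d 3 x := by positivity
  simp only [fA, Pi.zero_apply, zero_mul, Finset.sum_const_zero, mul_zero]
  nlinarith

lemma fA_upper {η ε : ℝ} (hη : 0 ≤ η) (hη1 : η ≤ 1/2)
    (hε : 0 ≤ ε) (hM : ε * (K^d * rexp (7*K*d)) ≤ η/2)
    {a : (Fin d → Fin K) → ℝ} (ha : ∀ j, |a j| ≤ 1) (x : Fin d → ℝ) :
    fA d K η ε a x ≤ 2 * (Gv d 2 x + η * Gv d 3 x) := by
  have h : fA d K η ε a x ≤ 2 * fA d K η ε 0 x := by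
    rw [← gA_conv, ← gA_conv, ← integral_const_mul]
    refine integral_mono (gA_conv_integrable _ _ _ x) ((gA_conv_integrable _ _ _ x).const_mul _)
      fun u => ?_
    have := mul_le_mul_of_nonneg_left (gA_upper hη (by linarith) hε hM ha u) (gP_nonneg x u)
    simp only; linarith
  refine le_trans h ?_
  have h2 := Gv_pos two_pos x
  simp only [fA, Pi.zero_apply, zero_mul, Finset.sum_const_zero, mul_zero]
  nlinarith

end


lemma gv1_le_gv2 (x : ℝ) : gv 1 x ≤ √2 * gv 2 x := by
  rw [← exp_mul_gv1]
  have h := gv_pos one_pos x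
  have : 1 ≤ rexp (x^2/4) := Real.one_le_exp (by positivity)
  nlinarith

lemma gv2_eq_gv4 (x : ℝ) : gv 2 x = √2 * (rexp (-(x^2)/8) * gv 4 x) := by
  unfold gv
  rw [show (2*π*4) = 2 * (2*π*2) by ring, Real.sqrt_mul (x := 2) (by norm_num), mul_div_assoc',
    ← Real.exp_add, mul_div_assoc']
  rw [mul_div_mul_left _ _ (by positivity)]
  congr 2; ring

section
variable {d K : ℕ}

lemma Gv1_le (u : Fin d → ℝ) : Gv d 1 u ≤ (√2)^d * Gv d 2 u := by
  have : (√2)^d * Gv d 2 u = ∏ i, (√2 * gv 2 (u i)) := by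
    rw [Finset.prod_mul_distrib]; simp [Gv]
  rw [this]
  exact Finset.prod_le_prod (fun i _ => (gv_pos one_pos _).le) fun i _ => gv1_le_gv2 _

lemma Gv2_eq (u : Fin d → ℝ) :
    Gv d 2 u = (√2)^d * (rexp (-(∑ i, (u i)^2)/8) * Gv d 4 u) := by
  unfold Gv
  simp_rw [gv2_eq_gv4]
  rw [Finset.prod_mul_distrib, Finset.prod_mul_distrib, ← Real.exp_sum]
  simp only [Finset.prod_const, Finset.card_univ, Fintype.card_fin]
  congr 3
  rw [← Finset.sum_div, Finset.sum_neg_distrib]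

noncomputable def Cd (d : ℕ) : ℝ := 2 * ((√2)^d + 1) * (√2)^d

lemma gA_tail {η ε : ℝ} (hη : 0 ≤ η) (hη1 : η ≤ 1)
    (hε : 0 ≤ ε) (hM : ε * (K^d * rexp (7*K*d)) ≤ η/2)
    {a : (Fin d → Fin K) → ℝ} (ha : ∀ j, |a j| ≤ 1) {t : ℝ} (ht : 0 < t) (u : Fin d → ℝ)
    (hu : t < euclNorm d u) : gA d K η ε a u ≤ Cd d * rexp (-(t^2)/8) * Gv d 4 u := by
  have h := gA_upper hη hη1 hε hM ha u
  have h1 := Gv_pos one_pos u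
  have h2 := Gv_pos two_pos u
  have h4 := Gv_pos (d := d) (v := 4) (by norm_num) u
  have hs : t^2 ≤ ∑ i, (u i)^2 := by
    unfold euclNorm at hu
    exact ((Real.lt_sqrt ht.le).1 hu).le
  calc gA d K η ε a u ≤ 2 * (Gv d 1 u + Gv d 2 u) := by
        refine h.trans ?_
        simp only [gA, Pi.zero_apply, zero_mul, Finset.sum_const_zero, mul_zero]
        nlinarith
    _ ≤ 2 * ((√2)^d * Gv d 2 u + Gv d 2 u) := by gcongr; exact Gv1_le u
    _ = 2 * ((√2)^d + 1) * Gv d 2 u := by ring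
    _ = Cd d * rexp (-(∑ i, (u i)^2)/8) * Gv d 4 u := by rw [Gv2_eq, Cd]; ring
    _ ≤ _ := by
        have : 0 ≤ Cd d := by unfold Cd; positivity
        gcongr

lemma fA_mem (hd : 1 ≤ d) {η ε : ℝ} (hη : 0 ≤ η) (hη1 : η ≤ 1)
    (hε : 0 ≤ ε) (hM : ε * (K^d * rexp (7*K*d)) ≤ η/2)
    {a : (Fin d → Fin K) → ℝ} (ha : ∀ j, |a j| ≤ 1) {Γ : ℝ} (h8 : 8 ≤ Γ) (hC : Cd d ≤ Γ) :
    fA d K η ε a ∈ gaussMixturesSubG d Γ := by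
  have hnn := gA_nonneg hη hη1 hε hM ha
  have hmeas : Measurable (fun u => ENNReal.ofReal (gA d K η ε a u)) :=
    (gA_cont η ε a).measurable.ennreal_ofReal
  refine ⟨volume.withDensity (fun u => ENNReal.ofReal (gA d K η ε a u)), ⟨⟨?_⟩, ?_⟩, ?_⟩
  · rw [withDensity_apply _ MeasurableSet.univ, setLIntegral_univ,
      ← ofReal_integral_eq_lintegral_ofReal (gA_integrable η ε a)
        (Filter.Eventually.of_forall hnn), gA_integral hd]
    simp
  · intro t ht
    have hS : MeasurableSet {u : Fin d → ℝ | t < euclNorm d u} := by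
      unfold euclNorm
      exact measurableSet_lt measurable_const (by fun_prop)
    rw [withDensity_apply _ hS]
    have hCd : 0 ≤ Cd d := by unfold Cd; positivity
    calc ∫⁻ u in {u : Fin d → ℝ | t < euclNorm d u}, ENNReal.ofReal (gA d K η ε a u)
        ≤ ∫⁻ u in {u : Fin d → ℝ | t < euclNorm d u},
            ENNReal.ofReal (Cd d * rexp (-(t^2)/8) * Gv d 4 u) := by
          refine setLIntegral_mono' hS fun u hu => ?_
          exact ENNReal.ofReal_le_ofReal (gA_tail hη hη1 hε hM ha ht u hu)
      _ ≤ ∫⁻ u, ENNReal.ofReal (Cd d * rexp (-(t^2)/8) * Gv d 4 u) := setLIntegral_le_lintegral _ _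
      _ = ENNReal.ofReal (Cd d * rexp (-(t^2)/8)) := by
          rw [← ofReal_integral_eq_lintegral_ofReal ((Gv_integrable (by norm_num)).const_mul _)
            (Filter.Eventually.of_forall fun u => mul_nonneg (by positivity)
              (Gv_pos (by norm_num) u).le), integral_const_mul, Gv_integral (by norm_num), mul_one]
      _ ≤ ENNReal.ofReal (Γ * rexp (-(t^2)/Γ)) := by
          apply ENNReal.ofReal_le_ofReal
          have : -(t^2)/8 ≤ -(t^2)/Γ := by
            rw [neg_div, neg_div]
            apply neg_le_neg
            exact div_le_div_of_nonneg_left (by positivity) (by norm_num) h8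
          gcongr
  · funext x
    rw [← gA_conv]
    unfold mixDensity
    rw [integral_withDensity_eq_integral_toReal_smul hmeas
      (Filter.Eventually.of_forall fun _ => ENNReal.ofReal_lt_top)]
    congr 1; funext u
    rw [ENNReal.toReal_ofReal (hnn u), smul_eq_mul, mul_comm]; rfl

/-! ### Hellinger computations -/

lemma fA_sub (η ε : ℝ) (a b : (Fin d → Fin K) → ℝ) (x : Fin d → ℝ) :
    fA d K η ε a x - fA d K η ε b x = ε * (∑ j, (a j - b j) * EJ j x) * Gv d 2 x := by
  unfold fA
  rw [add_sub_add_left_eq_sub, ← mul_sub, ← Finset.sum_sub_distrib, mul_assoc, Finset.sum_mul]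
  congr 1
  exact Finset.sum_congr rfl fun j _ => by ring

lemma sqrt_ineq_s1 {f g lam T : ℝ} (hf : 0 ≤ f) (hg : 0 ≤ g) :
    2 * lam * ((f - g) * T) - 2 * lam^2 * ((f + g) * T^2) ≤ (√f - √g)^2 := by
  have h1 := Real.sq_sqrt hf
  have h2 := Real.sq_sqrt hg
  set p := √f
  set q := √g
  rw [← h1, ← h2]
  nlinarith [sq_nonneg ((p - q) - lam * (p+q) * T), sq_nonneg (lam * T * (p - q))]

lemma aff_ineq {f g G r : ℝ} (hG : 0 < G) (hf : 1/4 * G ≤ f) (hg : 1/4 * G ≤ g)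
    (h : f - g = r * G) : (f+g)/2 - r^2 * G ≤ √(f*g) := by
  have hf0 : 0 < f := by linarith
  have hg0 : 0 < g := by linarith
  rw [Real.sqrt_mul hf0.le]
  have h1 := Real.sq_sqrt hf0.le
  have h2 := Real.sq_sqrt hg0.le
  have hp : 0 < √f := Real.sqrt_pos.2 hf0
  have hq : 0 < √g := Real.sqrt_pos.2 hg0
  set p := √f
  set q := √g
  have hpq : (p - q)^2 * (1/2 * G) ≤ (r*G)^2 := by
    rw [← h, ← h1, ← h2]
    have : (p^2-q^2)^2 = (p-q)^2 * (p+q)^2 := by ring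
    rw [this]
    gcongr
    nlinarith [mul_pos hp hq]
  have h3 : (p-q)^2 ≤ 2 * (r^2 * G) := by
    have : (p - q)^2 * (1/2 * G) ≤ (2 * (r^2 * G)) * (1/2*G) := by nlinarith
    exact le_of_mul_le_mul_right this (by positivity)
  nlinarith
end


lemma ofReal_int_le {α : Type*} [MeasurableSpace α] {μ : Measure α} {F : α → ℝ}
    (hF : Integrable F μ) : ENNReal.ofReal (∫ x, F x ∂μ) ≤ ∫⁻ x, ENNReal.ofReal (F x) ∂μ := by
  have h1 : ∫ x, F x ∂μ ≤ ∫ x, max (F x) 0 ∂μ :=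
    integral_mono hF hF.pos_part fun x => le_max_left _ _
  refine (ENNReal.ofReal_le_ofReal h1).trans ?_
  rw [ofReal_integral_eq_lintegral_ofReal hF.pos_part
    (Filter.Eventually.of_forall fun x => le_max_right _ _)]
  refine lintegral_mono fun x => ?_
  simp

section
variable {d K : ℕ}

noncomputable def TT (c : (Fin d → Fin K) → ℝ) (x : Fin d → ℝ) : ℝ := ∑ j, c j * EJ j x

lemma TT_sq (c : (Fin d → Fin K) → ℝ) (v : ℝ) (x : Fin d → ℝ) :
    (TT c x)^2 * Gv d v x = ∑ i, ∑ j, (c i * c j) * (EJ i x * EJ j x * Gv d v x) := by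
  unfold TT
  rw [pow_two, Finset.sum_mul_sum, Finset.sum_mul]
  refine Finset.sum_congr rfl fun i _ => ?_
  rw [Finset.sum_mul]
  exact Finset.sum_congr rfl fun j _ => by ring

lemma TT2_integrable (c : (Fin d → Fin K) → ℝ) :
    Integrable (fun x => (TT c x)^2 * Gv d 2 x) := by
  simp only [TT_sq]
  exact integrable_finsetSum _ fun i _ => integrable_finsetSum _ fun j _ =>
    (EJ_mul2_integrable i j).const_mul _

lemma TT3_integrable (c : (Fin d → Fin K) → ℝ) :
    Integrable (fun x => (TT c x)^2 * Gv d 3 x) := by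
  simp only [TT_sq]
  exact integrable_finsetSum _ fun i _ => integrable_finsetSum _ fun j _ =>
    (EJ_mul3_integrable i j).const_mul _

lemma TT2_integral (c : (Fin d → Fin K) → ℝ) :
    ∫ x, (TT c x)^2 * Gv d 2 x = ∑ j, (c j)^2 := by
  simp only [TT_sq]
  rw [integral_finsetSum _ fun i _ => integrable_finsetSum _ fun j _ =>
    (EJ_mul2_integrable i j).const_mul _]
  refine Finset.sum_congr rfl fun i _ => ?_
  rw [integral_finsetSum _ fun j _ => (EJ_mul2_integrable i j).const_mul _]
  simp only [integral_const_mul, EJ_orth]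
  simp [pow_two]

lemma TT3_integral (c : (Fin d → Fin K) → ℝ) :
    ∫ x, (TT c x)^2 * Gv d 3 x ≤ (∑ j, (c j)^2) * (K^d * rexp (7*K*d)) := by
  calc ∫ x, (TT c x)^2 * Gv d 3 x
      ≤ ∫ x, (∑ j, (c j)^2) * ∑ j : Fin d → Fin K, EJ j x * EJ j x * Gv d 3 x := by
        refine integral_mono (TT3_integrable c) ((integrable_finsetSum _ fun j _ =>
          EJ_mul3_integrable j j).const_mul _) fun x => ?_
        have h3 := (Gv_pos three_pos x).le
        have := Finset.sum_mul_sq_le_sq_mul_sq Finset.univ c (fun j => EJ j x)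
        simp only
        rw [← Finset.sum_mul, ← mul_assoc]
        refine mul_le_mul_of_nonneg_right ?_ h3
        simpa [TT, pow_two] using this
    _ = (∑ j, (c j)^2) * ∑ j : Fin d → Fin K, ∫ x, EJ j x * EJ j x * Gv d 3 x := by
        rw [integral_const_mul, integral_finsetSum _ fun j _ => EJ_mul3_integrable j j]
    _ ≤ (∑ j, (c j)^2) * ∑ j : Fin d → Fin K, rexp (7*K*d) := by
        refine mul_le_mul_of_nonneg_left (Finset.sum_le_sum fun j _ => EJ_sq3 j)
          (Finset.sum_nonneg fun j _ => sq_nonneg _)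
    _ = _ := by simp

lemma hell_sep {η ε : ℝ} (hη : 0 ≤ η) (hη1 : η ≤ 1/2) (hε : 0 ≤ ε)
    (hM : ε * (K^d * rexp (7*K*d)) ≤ η/2) (hM2 : η * (K^d * rexp (7*K*d)) ≤ 1)
    {a b : (Fin d → Fin K) → ℝ} (ha : ∀ j, |a j| ≤ 1) (hb : ∀ j, |b j| ≤ 1) :
    ENNReal.ofReal (ε^2/16 * ∑ j, (a j - b j)^2) ≤ hellSq d (fA d K η ε a) (fA d K η ε b) := by
  set c : (Fin d → Fin K) → ℝ := fun j => a j - b j with hc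
  set m := ∑ j, (c j)^2 with hm
  have hm0 : 0 ≤ m := Finset.sum_nonneg fun j _ => sq_nonneg _
  set lam := ε/16 with hlam
  set F : (Fin d → ℝ) → ℝ := fun x =>
    (2*lam*ε - 8*lam^2) * ((TT c x)^2 * Gv d 2 x) - (8*lam^2*η) * ((TT c x)^2 * Gv d 3 x) with hF
  have hFi : Integrable F := ((TT2_integrable c).const_mul _).sub ((TT3_integrable c).const_mul _)
  have hFint : ε^2/16 * m ≤ ∫ x, F x := by
    rw [hF, integral_sub ((TT2_integrable c).const_mul _) ((TT3_integrable c).const_mul _),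
      integral_const_mul, integral_const_mul, TT2_integral]
    have h3 := TT3_integral c
    have h4 : η * ∫ x, (TT c x)^2 * Gv d 3 x ≤ m := by
      calc η * ∫ x, (TT c x)^2 * Gv d 3 x ≤ η * (m * (K^d * rexp (7*K*d))) := by gcongr
        _ = m * (η * (K^d * rexp (7*K*d))) := by ring
        _ ≤ m * 1 := by gcongr
        _ = m := mul_one m
    have h5 : 8*lam^2*η * ∫ x, (TT c x)^2 * Gv d 3 x ≤ 8*lam^2*m := by
      rw [mul_assoc]; gcongr
    rw [← hm]
    rw [hlam] at h5 ⊢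
    nlinarith
  refine (ENNReal.ofReal_le_ofReal hFint).trans ((ofReal_int_le hFi).trans ?_)
  unfold hellSq
  refine lintegral_mono fun x => ENNReal.ofReal_le_ofReal ?_
  have h2 := Gv_pos two_pos x
  have fa := fA_lower hη hη1 hε hM ha x
  have fb := fA_lower hη hη1 hε hM hb x
  have ua := fA_upper hη hη1 hε hM ha x
  have ub := fA_upper hη hη1 hε hM hb x
  have hs := fA_sub η ε a b x
  change _ = ε * TT c x * Gv d 2 x at hs
  have key := sqrt_ineq_s1 (f := fA d K η ε a x) (g := fA d K η ε b x) (lam := lam) (T := TT c x)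
    (by linarith) (by linarith)
  rw [hs] at key
  refine le_trans ?_ key
  have : (fA d K η ε a x + fA d K η ε b x) * (TT c x)^2 ≤
      (4 * (Gv d 2 x + η * Gv d 3 x)) * (TT c x)^2 := by
    gcongr; linarith
  have := mul_le_mul_of_nonneg_left this (by positivity : 0 ≤ 2*lam^2)
  simp only [hF]
  nlinarith

lemma hell_aff {η ε : ℝ} (hd : 1 ≤ d) (hη : 0 ≤ η) (hη1 : η ≤ 1/2) (hε : 0 ≤ ε)
    (hM : ε * (K^d * rexp (7*K*d)) ≤ η/2)
    {a b : (Fin d → Fin K) → ℝ} (ha : ∀ j, |a j| ≤ 1) (hb : ∀ j, |b j| ≤ 1)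
    (hab : ∑ j, (a j - b j)^2 ≤ 1) :
    Integrable (fun x => √(fA d K η ε a x * fA d K η ε b x)) ∧
    1 - ε^2 ≤ ∫ x, √(fA d K η ε a x * fA d K η ε b x) := by
  have hpa : ∀ x, 0 < fA d K η ε a x := fun x => by
    have := fA_lower hη hη1 hε hM ha x
    have := Gv_pos two_pos x
    linarith
  have hpb : ∀ x, 0 < fA d K η ε b x := fun x => by
    have := fA_lower hη hη1 hε hM hb x
    have := Gv_pos two_pos x
    linarith
  have hi : Integrable (fun x => √(fA d K η ε a x * fA d K η ε b x)) := by
    refine ((fA_integrable η ε a).add (fA_integrable η ε b)).mono'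
      (((fA_cont η ε a).mul (fA_cont η ε b)).sqrt.aestronglyMeasurable)
      (Filter.Eventually.of_forall fun x => ?_)
    rw [Real.norm_eq_abs, abs_of_nonneg (Real.sqrt_nonneg _)]
    simp only [Pi.add_apply]
    have h1 := hpa x
    have h2 := hpb x
    rw [Real.sqrt_le_left (by linarith)]
    nlinarith
  refine ⟨hi, ?_⟩
  set c : (Fin d → Fin K) → ℝ := fun j => a j - b j with hc
  have i1 := ((fA_integrable η ε a).add (fA_integrable η ε b)).div_const 2
  have i2 := (TT2_integrable c).const_mul (ε^2)
  have e : ∫ x, ((fA d K η ε a x + fA d K η ε b x)/2 - ε^2 * ((TT c x)^2 * Gv d 2 x)) =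
      1 - ε^2 * ∑ j, (c j)^2 := by
    have := integral_sub i1 i2
    simp only [Pi.add_apply] at this
    rw [this, integral_div, integral_add (fA_integrable η ε a) (fA_integrable η ε b),
      fA_integral hd, fA_integral hd, integral_const_mul, TT2_integral]
    norm_num
  calc 1 - ε^2 ≤ 1 - ε^2 * ∑ j, (c j)^2 := by nlinarith [sq_nonneg ε]
    _ = _ := e.symm
    _ ≤ _ := by
      refine integral_mono (i1.sub i2) hi fun x => ?_
      have hs := fA_sub η ε a b x
      have := aff_ineq (Gv_pos two_pos x) (fA_lower hη hη1 hε hM ha x)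
        (fA_lower hη hη1 hε hM hb x) (r := ε * TT c x) hs
      simp only
      rw [← mul_assoc, ← mul_pow]; exact this

lemma joint_aff {η ε : ℝ} (hd : 1 ≤ d) (hη : 0 ≤ η) (hη1 : η ≤ 1/2) (hε : 0 ≤ ε)
    (hM : ε * (K^d * rexp (7*K*d)) ≤ η/2) (n : ℕ) (hn : n * ε^2 ≤ 1/4) (hε1 : ε ≤ 1)
    {a b : (Fin d → Fin K) → ℝ} (ha : ∀ j, |a j| ≤ 1) (hb : ∀ j, |b j| ≤ 1)
    (hab : ∑ j, (a j - b j)^2 ≤ 1) :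
    ENNReal.ofReal (1/4) ≤ ∫⁻ X : Fin n → Fin d → ℝ,
      min (∏ i, ENNReal.ofReal (fA d K η ε a (X i))) (∏ i, ENNReal.ofReal (fA d K η ε b (X i))) := by
  obtain ⟨hi, h1⟩ := hell_aff hd hη hη1 hε hM ha hb hab
  have hpa : ∀ x, 0 ≤ fA d K η ε a x := fun x => by
    have := fA_lower hη hη1 hε hM ha x
    have := Gv_pos two_pos x
    linarith
  have hpb : ∀ x, 0 ≤ fA d K η ε b x := fun x => by
    have := fA_lower hη hη1 hε hM hb x
    have := Gv_pos two_pos x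
    linarith
  have iS : Integrable (fun X : Fin n → Fin d → ℝ =>
      ∏ i, √(fA d K η ε a (X i) * fA d K η ε b (X i))) :=
    Integrable.fintype_prod (f := fun _ x => √(fA d K η ε a x * fA d K η ε b x))
      (μ := fun _ => volume) fun _ => hi
  have iA : Integrable (fun X : Fin n → Fin d → ℝ => ∏ i, fA d K η ε a (X i)) :=
    Integrable.fintype_prod (f := fun _ x => fA d K η ε a x)
      (μ := fun _ => volume) fun _ => fA_integrable _ _ _
  have iB : Integrable (fun X : Fin n → Fin d → ℝ => ∏ i, fA d K η ε b (X i)) :=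
    Integrable.fintype_prod (f := fun _ x => fA d K η ε b x)
      (μ := fun _ => volume) fun _ => fA_integrable _ _ _
  have eS := integral_fintype_prod_volume_eq_pow (ι := Fin n)
    (fun x => √(fA d K η ε a x * fA d K η ε b x))
  have eA := integral_fintype_prod_volume_eq_pow (ι := Fin n) (fun x => fA d K η ε a x)
  have eB := integral_fintype_prod_volume_eq_pow (ι := Fin n) (fun x => fA d K η ε b x)
  rw [fA_integral hd, one_pow] at eA eB
  rw [Fintype.card_fin] at eS
  have hpow : 3/4 ≤ (∫ x, √(fA d K η ε a x * fA d K η ε b x))^n := by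
    have hb := one_add_mul_le_pow (a := -ε^2) (by nlinarith) n
    calc (3:ℝ)/4 ≤ 1 + n * (-ε^2) := by linarith
      _ ≤ (1 + -ε^2)^n := hb
      _ ≤ _ := by
        apply pow_le_pow_left₀
        · nlinarith
        · linarith
  have iAB := (iA.add iB).div_const 4
  have hIntB : ∫ X : Fin n → Fin d → ℝ, (∏ i, √(fA d K η ε a (X i) * fA d K η ε b (X i)) -
      (∏ i, fA d K η ε a (X i) + ∏ i, fA d K η ε b (X i))/4) ≥ 1/4 := by
    have := integral_sub iS iAB
    simp only [Pi.add_apply] at this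
    rw [this, integral_div, integral_add iA iB, eA, eB, eS]
    linarith
  refine (ENNReal.ofReal_le_ofReal hIntB).trans ((ofReal_int_le (iS.sub iAB)).trans ?_)
  refine lintegral_mono fun X => ?_
  rw [← ENNReal.ofReal_prod_of_nonneg fun i _ => hpa _,
    ← ENNReal.ofReal_prod_of_nonneg fun i _ => hpb _, ← ENNReal.ofReal_min]
  refine ENNReal.ofReal_le_ofReal ?_
  have e : ∏ i, √(fA d K η ε a (X i) * fA d K η ε b (X i)) =
      √((∏ i, fA d K η ε a (X i)) * ∏ i, fA d K η ε b (X i)) := by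
    rw [← Finset.prod_mul_distrib, Real.sqrt_prod]
    intro i _
    exact mul_nonneg (hpa _) (hpb _)
  simp only [Pi.sub_apply, Pi.add_apply]
  rw [e]
  have hA : 0 ≤ ∏ i, fA d K η ε a (X i) := Finset.prod_nonneg fun i _ => hpa _
  have hB : 0 ≤ ∏ i, fA d K η ε b (X i) := Finset.prod_nonneg fun i _ => hpb _
  generalize (∏ i, fA d K η ε a (X i)) = A at hA ⊢
  generalize (∏ i, fA d K η ε b (X i)) = B at hB ⊢
  rw [sub_le_iff_le_add, Real.sqrt_le_left (by positivity)]
  rcases le_total A B with h | h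
  · rw [min_eq_left h]; nlinarith [sq_nonneg (A - B/4), mul_nonneg hA hA]
  · rw [min_eq_right h]; nlinarith [sq_nonneg (B - A/4), mul_nonneg hB hB]

end


/-- Flip one coordinate. -/
def flipB {J : Type*} [DecidableEq J] (j : J) (α : J → Bool) : J → Bool :=
  Function.update α j (!(α j))

lemma flipB_flipB {J : Type*} [DecidableEq J] (j : J) (α : J → Bool) :
    flipB j (flipB j α) = α := by
  unfold flipB; simp

/-- The Assouad lemma. -/
lemma assouad {J Ω : Type*} [Fintype J] [DecidableEq J] [MeasurableSpace Ω] (μ : Measure Ω)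
    (p ℓ : (J → Bool) → Ω → ℝ≥0∞) (hp : ∀ α, Measurable (p α)) (hℓ : ∀ α, Measurable (ℓ α))
    (D c : ℝ≥0∞)
    (hsep : ∀ X α β, (∑ j, if α j = β j then 0 else D) ≤ 2 * (ℓ α X + ℓ β X))
    (haff : ∀ α j, c ≤ ∫⁻ X, min (p α X) (p (flipB j α) X) ∂μ) :
    ∃ α, Fintype.card J * (D * c) ≤ 8 * ∫⁻ X, p α X * ℓ α X ∂μ := by
  -- pointwise bound
  have hpt : ∀ X, (∑ α, ∑ j, D * min (p α X) (p (flipB j α) X)) ≤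
      8 * ∑ α, p α X * ℓ α X := by
    intro X
    obtain ⟨β, hβ⟩ := Finite.exists_min (fun α => ℓ α X)
    have h4 : ∀ α, (∑ j, if α j = β j then 0 else D) ≤ 4 * ℓ α X := fun α => by
      refine (hsep X α β).trans ?_
      calc 2 * (ℓ α X + ℓ β X) ≤ 2 * (ℓ α X + ℓ α X) := by gcongr; exact hβ α
        _ = 4 * ℓ α X := by ring
    have hj : ∀ j, ∑ α, D * min (p α X) (p (flipB j α) X) ≤
        2 * ∑ α, p α X * (if α j = β j then 0 else D) := by
      intro j
      have hsum : ∑ α, p α X * (if α j = β j then 0 else D) =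
          ∑ α, p (flipB j α) X * (if (flipB j α) j = β j then 0 else D) :=
        (Equiv.sum_comp (Function.Involutive.toPerm (flipB j) (flipB_flipB j))
          (fun α => p α X * (if α j = β j then 0 else D))).symm
      rw [two_mul]
      nth_rewrite 2 [hsum]
      rw [← Finset.sum_add_distrib]
      refine Finset.sum_le_sum fun α _ => ?_
      by_cases h : α j = β j
      · have h' : ¬ (flipB j α) j = β j := by simp [flipB, h]
        rw [if_pos h, if_neg h', mul_zero, zero_add, mul_comm]
        gcongr; exact min_le_right _ _
      · rw [if_neg h]
        refine le_trans ?_ le_self_add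
        rw [mul_comm]
        gcongr; exact min_le_left _ _
    calc (∑ α, ∑ j, D * min (p α X) (p (flipB j α) X))
        = ∑ j, ∑ α, D * min (p α X) (p (flipB j α) X) := Finset.sum_comm
      _ ≤ ∑ j, 2 * ∑ α, p α X * (if α j = β j then 0 else D) := Finset.sum_le_sum fun j _ => hj j
      _ = 2 * ∑ α, p α X * ∑ j, (if α j = β j then 0 else D) := by
          rw [← Finset.mul_sum, Finset.sum_comm]
          simp_rw [Finset.mul_sum]
      _ ≤ 2 * ∑ α, p α X * (4 * ℓ α X) := by
          gcongr with α _; exact h4 α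
      _ = 8 * ∑ α, p α X * ℓ α X := by
          rw [Finset.mul_sum, Finset.mul_sum]
          exact Finset.sum_congr rfl fun α _ => by ring
  -- integrate
  have hIntB : ∑ α : J → Bool, (Fintype.card J * (D * c) : ℝ≥0∞) ≤
      ∑ α, 8 * ∫⁻ X, p α X * ℓ α X ∂μ := by
    calc ∑ α : J → Bool, (Fintype.card J * (D * c) : ℝ≥0∞)
        = ∑ α : J → Bool, ∑ j : J, D * c := by simp
      _ ≤ ∑ α, ∑ j, D * ∫⁻ X, min (p α X) (p (flipB j α) X) ∂μ := by
          gcongr with α _ j _; exact haff α j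
      _ = ∫⁻ X, (∑ α, ∑ j, D * min (p α X) (p (flipB j α) X)) ∂μ := by
          have hm : ∀ α j, Measurable (fun X => min (p α X) (p (flipB j α) X)) :=
            fun α j => (hp α).min (hp _)
          rw [lintegral_finsetSum _ fun α _ =>
            Finset.measurable_fun_sum _ fun j _ => (hm α j).const_mul D]
          refine Finset.sum_congr rfl fun α _ => ?_
          rw [lintegral_finsetSum _ fun j _ => (hm α j).const_mul D]
          exact Finset.sum_congr rfl fun j _ => (lintegral_const_mul _ (hm α j)).symm
      _ ≤ ∫⁻ X, 8 * ∑ α, p α X * ℓ α X ∂μ := lintegral_mono hpt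
      _ = 8 * ∑ α, ∫⁻ X, p α X * ℓ α X ∂μ := by
          have hm : ∀ α, Measurable (fun X => p α X * ℓ α X) := fun α => (hp α).mul (hℓ α)
          rw [lintegral_const_mul _ (Finset.measurable_fun_sum _ fun α _ => hm α),
            lintegral_finsetSum _ fun α _ => hm α]
      _ = _ := by rw [Finset.mul_sum]
  obtain ⟨α, hα⟩ := Finite.exists_max (fun α => 8 * ∫⁻ X, p α X * ℓ α X ∂μ)
  refine ⟨α, ?_⟩
  have h2 := hIntB.trans (Finset.sum_le_sum fun β _ => hα β)
  rw [Finset.sum_const, Finset.sum_const, nsmul_eq_mul, nsmul_eq_mul] at h2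
  refine (ENNReal.mul_le_mul_iff_right ?_ ?_).1 h2
  · simp
  · exact ENNReal.natCast_ne_top _

lemma hell_tri {d : ℕ} {f g h : (Fin d → ℝ) → ℝ} (hf : Measurable f) (hh : Measurable h) :
    hellSq d f g ≤ 2 * (hellSq d h f + hellSq d h g) := by
  unfold hellSq
  have hm : Measurable fun x => ENNReal.ofReal ((√(h x) - √(f x))^2) := by fun_prop
  rw [← lintegral_add_left hm, ← lintegral_const_mul' _ _ (by norm_num)]
  refine lintegral_mono fun x => ?_
  rw [← ENNReal.ofReal_add (sq_nonneg _) (sq_nonneg _),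
    show (2:ℝ≥0∞) = ENNReal.ofReal 2 by simp, ← ENNReal.ofReal_mul (by norm_num)]
  apply ENNReal.ofReal_le_ofReal
  nlinarith [sq_nonneg ((√(h x) - √(f x)) + (√(h x) - √(g x)))]

def bR (b : Bool) : ℝ := if b then 1 else 0

lemma bR_abs (b : Bool) : |bR b| ≤ 1 := by cases b <;> simp [bR]

lemma bR_sub (b c : Bool) : (bR b - bR c)^2 = if b = c then 0 else 1 := by
  cases b <;> cases c <;> simp [bR]

/-- Core lower bound. -/
lemma core {d K n : ℕ} (hd : 1 ≤ d) {η ε Γ : ℝ} (hη : 0 ≤ η) (hη1 : η ≤ 1/2) (hε : 0 ≤ ε)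
    (hM : ε * (K^d * rexp (7*K*d)) ≤ η/2) (hM2 : η * (K^d * rexp (7*K*d)) ≤ 1)
    (hn : n * ε^2 ≤ 1/4) (hε1 : ε ≤ 1) (h8 : 8 ≤ Γ) (hC : Cd d ≤ Γ) :
    ENNReal.ofReal (K^d * (ε^2/512)) ≤ minimaxRisk d n (gaussMixturesSubG d Γ) (hellSq d) := by
  unfold minimaxRisk
  refine le_iInf fun fhat => le_iInf fun hfhat => ?_
  set A : ((Fin d → Fin K) → Bool) → (Fin d → ℝ) → ℝ := fun α => fA d K η ε (fun j => bR (α j))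
    with hA
  have hAm : ∀ α, Measurable (A α) := fun α => (fA_cont _ _ _).measurable
  set p : ((Fin d → Fin K) → Bool) → (Fin n → Fin d → ℝ) → ℝ≥0∞ :=
    fun α X => ∏ i, ENNReal.ofReal (A α (X i)) with hp
  set ℓ : ((Fin d → Fin K) → Bool) → (Fin n → Fin d → ℝ) → ℝ≥0∞ :=
    fun α X => hellSq d (fhat X) (A α) with hℓ
  have hpm : ∀ α, Measurable (p α) := fun α => by
    refine Finset.measurable_fun_prod _ fun i _ => ?_
    exact ((hAm α).comp (measurable_pi_apply i)).ennreal_ofReal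
  have hℓm : ∀ α, Measurable (ℓ α) := fun α => by
    have : Measurable (fun z : (Fin n → Fin d → ℝ) × (Fin d → ℝ) =>
        ENNReal.ofReal ((√(Function.uncurry fhat z) - √(A α z.2))^2)) :=
      ((hfhat.sqrt.sub ((hAm α).comp measurable_snd).sqrt).pow_const 2).ennreal_ofReal
    exact this.lintegral_prod_right'
  obtain ⟨α, hα⟩ := assouad (volume : Measure (Fin n → Fin d → ℝ)) p ℓ hpm hℓm
    (ENNReal.ofReal (ε^2/16)) (ENNReal.ofReal (1/4)) (by
      intro X α β
      have hs := hell_sep hη hη1 hε hM hM2 (a := fun j => bR (α j)) (b := fun j => bR (β j))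
        (fun j => bR_abs _) (fun j => bR_abs _)
      refine le_trans (le_of_eq ?_) (hs.trans
        (hell_tri (h := fhat X) (hAm α) (hfhat.comp measurable_prodMk_left)))
      rw [Finset.mul_sum, ENNReal.ofReal_sum_of_nonneg fun j _ => by positivity]
      refine Finset.sum_congr rfl fun j _ => ?_
      rw [bR_sub]
      split_ifs <;> simp) (by
      intro α j
      refine joint_aff hd hη hη1 hε hM n hn hε1 (fun j => bR_abs _) (fun j => bR_abs _) ?_
      simp only [bR_sub]
      rw [Finset.sum_eq_single j]
      · split_ifs <;> norm_num
      · intro i _ hij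
        simp [flipB, Function.update_of_ne hij]
      · simp)
  have hmem : A α ∈ gaussMixturesSubG d Γ :=
    fA_mem hd hη (by linarith) hε hM (fun j => bR_abs _) h8 hC
  refine le_trans ?_ (le_iSup₂ (f := fun f (_ : f ∈ gaussMixturesSubG d Γ) =>
    ∫⁻ X, hellSq d (fhat X) f ∂(jointMeasure d n f)) (A α) hmem)
  unfold jointMeasure
  rw [lintegral_withDensity_eq_lintegral_mul _ (hpm α) (hℓm α)]
  simp only [Pi.mul_apply]
  have h8' : (8:ℝ≥0∞) ≠ 0 := by norm_num
  have h8t : (8:ℝ≥0∞) ≠ ⊤ := by norm_num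
  rw [← ENNReal.mul_le_mul_iff_right h8' h8t]
  refine le_trans (le_of_eq ?_) hα
  rw [← ENNReal.ofReal_mul (by positivity), show (8:ℝ≥0∞) = ENNReal.ofReal 8 by simp,
    ← ENNReal.ofReal_mul (by norm_num)]
  have : ((Fintype.card (Fin d → Fin K) : ℕ) : ℝ≥0∞) = ENNReal.ofReal (K^d) := by
    rw [Fintype.card_fun, Fintype.card_fin, Fintype.card_fin, ← ENNReal.ofReal_natCast]
    push_cast; rfl
  rw [this, ← ENNReal.ofReal_mul (by positivity)]
  congr 1; ring


set_option maxHeartbeats 1000000 in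
lemma main_bound (d : ℕ) (hd : 1 ≤ d) : ∃ c : ℝ, 0 < c ∧ ∀ Γ : ℝ, 1/c ≤ Γ → ∀ n : ℕ, 2 ≤ n → ENNReal.ofReal (c * (Real.log n)^d / n) ≤ minimaxRisk d n (gaussMixturesSubG d Γ) (hellSq d) := by
  have hd' : (1:ℝ) ≤ d := by exact_mod_cast hd
  set L : ℝ := 34 * d with hL
  have hL0 : 0 < L := by linarith
  set c' : ℝ := 1 / ((2*L)^d * 2048 * rexp L) with hc'
  have hc'0 : 0 < c' := by positivity
  have hm0 : 0 < max 8 (Cd d) := lt_of_lt_of_le (by norm_num) (le_max_left _ _)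
  refine ⟨min c' (1 / max 8 (Cd d)), lt_min hc'0 (by positivity), ?_⟩
  intro Γ hΓ n hn
  have hΓ' : max 8 (Cd d) ≤ Γ := by
    refine le_trans ?_ hΓ
    rw [le_div_iff₀ (lt_min hc'0 (by positivity))]
    calc max 8 (Cd d) * min c' (1 / max 8 (Cd d)) ≤ max 8 (Cd d) * (1 / max 8 (Cd d)) := by
          gcongr; exact min_le_right _ _
      _ = 1 := by field_simp
  have hn2 : (2:ℝ) ≤ n := by exact_mod_cast hn
  set N : ℝ := max n (rexp L) with hN
  have hNn : (n:ℝ) ≤ N := le_max_left _ _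
  have hNe : rexp L ≤ N := le_max_right _ _
  have hN0 : 0 < N := by linarith
  have hlogL : L ≤ Real.log N := by rwa [Real.le_log_iff_exp_le hN0]
  set K : ℕ := ⌊Real.log N / L⌋₊ with hK
  have hq : 1 ≤ Real.log N / L := by rwa [le_div_iff₀ hL0, one_mul]
  have hK1 : 1 ≤ K := Nat.le_floor (by simpa using hq)
  have hK1' : (1:ℝ) ≤ K := by exact_mod_cast hK1
  have hKle : (K:ℝ) ≤ Real.log N / L := Nat.floor_le (by linarith)
  have hKlt : Real.log N / L < K + 1 := Nat.lt_floor_add_one _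
  have hKN : rexp (L * K) ≤ N := by
    rw [← Real.le_log_iff_exp_le hN0]
    rw [le_div_iff₀ hL0] at hKle; linarith
  set M : ℝ := K^d * rexp (7*K*d) with hMdef
  have hKd1 : (1:ℝ) ≤ (K:ℝ)*d := by nlinarith
  have hM1 : 1 ≤ M := by
    have h1 : (1:ℝ) ≤ (K:ℝ)^d := one_le_pow₀ hK1'
    have h2 : 1 ≤ rexp (7*K*d) := Real.one_le_exp (by positivity)
    nlinarith
  have hM0 : 0 < M := by linarith
  have hMe : M ≤ rexp (8*(K*d)) := by
    have h1 : (K:ℝ)^d ≤ rexp (K*d) := by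
      calc (K:ℝ)^d ≤ (rexp K)^d := by
            gcongr; linarith [Real.add_one_le_exp (K:ℝ)]
        _ = rexp (K*d) := by rw [← Real.exp_nat_mul]; ring_nf
    calc M ≤ rexp (K*d) * rexp (7*K*d) := by rw [hMdef]; gcongr
      _ = _ := by rw [← Real.exp_add]; ring_nf
  have h4 : 4 * M^4 ≤ N := by
    have h4e : (4:ℝ) ≤ rexp (2*(K*d)) := by
      have h2 : (2:ℝ) ≤ rexp (K*d) := by linarith [Real.add_one_le_exp ((K:ℝ)*d)]
      rw [show 2*((K:ℝ)*d) = K*d + K*d by ring, Real.exp_add]; nlinarith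
    calc 4 * M^4 ≤ rexp (2*(K*d)) * (rexp (8*(K*d)))^4 := by gcongr
      _ = rexp (L*K) := by
        rw [← Real.exp_nat_mul, ← Real.exp_add, hL]; push_cast; ring_nf
      _ ≤ N := hKN
  have hsq : 2 * M^2 ≤ √N := by
    apply Real.le_sqrt_of_sq_le; nlinarith
  have hs0 : 0 < √N := Real.sqrt_pos.2 hN0
  have hs2 : √N ^ 2 = N := Real.sq_sqrt hN0.le
  have hε2 : (1 / (2 * √N))^2 = 1 / (4*N) := by
    rw [div_pow, mul_pow, hs2]; norm_num
  have key := core (d := d) (K := K) (n := n) hd (η := 1/(2*M)) (ε := 1/(2*√N)) (Γ := Γ)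
    (by positivity)
    (by rw [div_le_div_iff₀ (by positivity) (by norm_num)]; linarith)
    (by positivity)
    (by
      rw [← hMdef]
      rw [div_mul_eq_mul_div, one_mul, div_div, div_le_div_iff₀ (by positivity) (by positivity)]
      nlinarith)
    (by
      rw [← hMdef]
      rw [div_mul_eq_mul_div, one_mul, div_le_one (by positivity)]; linarith)
    (by
      rw [hε2, mul_one_div, div_le_div_iff₀ (by positivity) (by norm_num)]; linarith)
    (by
      rw [div_le_one (by positivity)]; nlinarith)
    ((le_max_left _ _).trans hΓ') ((le_max_right _ _).trans hΓ')
  refine le_trans (ENNReal.ofReal_le_ofReal ?_) key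
  rw [hε2]
  have hlog0 : 0 ≤ Real.log n := Real.log_nonneg (by linarith)
  have hlogn : Real.log n ≤ Real.log N := Real.log_le_log (by linarith) hNn
  have hKlow : Real.log n / (2*L) ≤ K := by
    rw [div_lt_iff₀ hL0] at hKlt
    rw [div_le_iff₀ (by positivity)]
    nlinarith
  have hNup : N ≤ n * rexp L := by
    have he : 1 ≤ rexp L := Real.one_le_exp hL0.le
    exact max_le (le_mul_of_one_le_right (by linarith) he)
      (le_mul_of_one_le_left (by positivity) (by linarith))
  calc min c' (1 / max 8 (Cd d)) * Real.log n ^ d / n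
      ≤ c' * Real.log n ^ d / n := by gcongr; exact min_le_left _ _
    _ = (Real.log n / (2*L))^d * (1 / (4*(n * rexp L)) / 512) := by
        rw [hc', div_pow]; field_simp; norm_num; ring
    _ ≤ K^d * (1 / (4*N) / 512) := by
        gcongr


theorem stmt1 (d : ℕ) (hd : 1 ≤ d) :
    ∃ c : ℝ, 0 < c ∧ ∀ Γ : ℝ, 1/c ≤ Γ → ∀ n : ℕ, 2 ≤ n →
      ENNReal.ofReal (c * (Real.log n)^d / n)
        ≤ minimaxRisk d n (gaussMixturesSubG d Γ) (hellSq d) := by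
  exact main_bound d hd
end
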